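/- Let a < b be fixed real numbers and fix B > 0. For every multi-index length m there is a constant C such that: if u ∈ C^∞(ℝ_+×ℝ³×[a,b]) satisfies u(t,x,y)=0 for t ≤ 2B, □u(t,x,y)=0 for |x| > t−B, and the Neumann conditions ∂_y u(t,x,a)=∂_y u(t,x,b)=0, then for every product Γ̃^β of |β| ≤ m admissible vector fields and all t ≥ 2B, x, y ∈ [a,b]: (1+t) |Γ̃^β ∂_y u(t,x,y)| ≤ C Σ_{|α|≤|β|+10} Σ_{k∈ℤ} sup_{τ∈[2^{k−1},2^{k+1}]∩[2B,t]} 2^k ‖Γ̃^α □u(τ,·)‖_{L²(ℝ³×[a,b])} + C (1+t) Σ_{|α|≤|β|+6} ‖Γ̃^α □u(t,·)‖_{L²(ℝ³×[a,b])}. -/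

import Mathlib

open MeasureTheory

noncomputable section

/-- The partial derivative in the `i`-th coordinate direction on `ℝⁿ`. -/
def pd {n : ℕ} (i : Fin n) (u : (Fin n → ℝ) → ℝ) : (Fin n → ℝ) → ℝ :=
  fun z => fderiv ℝ u z (Pi.single i 1)

/-- Iterated application of a family of first-order operators along a list of indices. -/
def opIter {α γ : Type*} (F : α → γ → γ) : List α → γ → γ
  | [] => id
  | i :: L => fun u => F i (opIter F L u)

/-- The dyadic sum `Σ_k sup_{τ ∈ [2^{k-1},2^{k+1}] ∩ [2B,t]} 2^k g(τ)`; for each `k ∈ ℤ` the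
supremum is taken over the (possibly empty) intersection, and `sSup ∅ = 0` in `ℝ`. -/
def dyadic (g : ℝ → ℝ) (B t : ℝ) : ℝ :=
  ∑' k : ℤ, sSup ((fun τ => (2:ℝ)^k * g τ) ''
    (Set.Icc ((2:ℝ)^(k-1)) ((2:ℝ)^(k+1)) ∩ Set.Icc (2*B) t))

/-- The eleven admissible vector fields `Γ̃ = {Γ, ∂_y}` on `ℝ×ℝ³×ℝ`
(coordinates: `0 = t`, `1,2,3 = x`, `4 = y`). -/
def G5 (i : Fin 11) (u : (Fin 5 → ℝ) → ℝ) : (Fin 5 → ℝ) → ℝ :=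
  if i.val = 0 then pd 0 u
  else if i.val = 1 then pd 1 u
  else if i.val = 2 then pd 2 u
  else if i.val = 3 then pd 3 u
  else if i.val = 4 then fun z => z 1 * pd 2 u z - z 2 * pd 1 u z
  else if i.val = 5 then fun z => z 1 * pd 3 u z - z 3 * pd 1 u z
  else if i.val = 6 then fun z => z 2 * pd 3 u z - z 3 * pd 2 u z
  else if i.val = 7 then fun z => z 1 * pd 0 u z + z 0 * pd 1 u z
  else if i.val = 8 then fun z => z 2 * pd 0 u z + z 0 * pd 2 u z
  else if i.val = 9 then fun z => z 3 * pd 0 u z + z 0 * pd 3 u z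
  else pd 4 u

/-- The d'Alembertian `□ = ∂_t² - Δ_{ℝ³} - ∂_y²` on `ℝ×ℝ³×ℝ`. -/
def Box5 (u : (Fin 5 → ℝ) → ℝ) : (Fin 5 → ℝ) → ℝ :=
  fun z => pd 0 (pd 0 u) z - pd 1 (pd 1 u) z - pd 2 (pd 2 u) z -
    pd 3 (pd 3 u) z - pd 4 (pd 4 u) z

/-- The point `(t,x,y) ∈ ℝ×ℝ³×ℝ`. -/
def pt5 (t : ℝ) (x : Fin 3 → ℝ) (y : ℝ) : Fin 5 → ℝ :=
  Fin.cons t (Fin.snoc x y)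

/-- The spatial radius `r = |x|` of a point of `ℝ×ℝ³×ℝ`. -/
def rad5 (z : Fin 5 → ℝ) : ℝ := Real.sqrt ((z 1)^2 + (z 2)^2 + (z 3)^2)

/-- The `L²(ℝ³×[a,b])` norm at fixed time `t`. -/
def L2ab (a b : ℝ) (f : (Fin 5 → ℝ) → ℝ) (t : ℝ) : ℝ :=
  Real.sqrt (∫ x : Fin 3 → ℝ, ∫ y in Set.Icc a b, (f (pt5 t x y))^2)

/-- Smooth real functions on `ℝ⁵`. -/
abbrev Smooth5 (f : (Fin 5 → ℝ) → ℝ) : Prop := ContDiff ℝ ((⊤ : ℕ∞) : WithTop ℕ∞) f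

theorem Smooth5.differentiable {f : (Fin 5 → ℝ) → ℝ} (hf : Smooth5 f) : Differentiable ℝ f :=
  ContDiff.differentiable hf (by simp)

theorem Smooth5.pd {f : (Fin 5 → ℝ) → ℝ} (hf : Smooth5 f) (i : Fin 5) : Smooth5 (pd i f) := by
  unfold Smooth5 _root_.pd
  exact ContDiff.clm_apply (hf.fderiv_right (m := ((⊤ : ℕ∞) : WithTop ℕ∞)) (by simp)) contDiff_const

theorem smooth5_coord (i : Fin 5) : Smooth5 (fun z => z i) := contDiff_apply ℝ ℝ i

theorem pd_comm {f : (Fin 5 → ℝ) → ℝ} (hf : Smooth5 f) (i j : Fin 5) :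
    pd i (pd j f) = pd j (pd i f) := by
  funext z
  have hsym : IsSymmSndFDerivAt ℝ f z :=
    ContDiffAt.isSymmSndFDerivAt hf.contDiffAt (by
      rw [minSmoothness_of_isRCLikeNormedField]
      exact WithTop.coe_le_coe.2 (le_top : (2 : ℕ∞) ≤ ⊤))
  have hd : DifferentiableAt ℝ (fderiv ℝ f) z :=
    ((hf.fderiv_right (m := ((⊤ : ℕ∞) : WithTop ℕ∞)) (by simp)).differentiable (by simp)) z
  have key : ∀ k l : Fin 5, pd k (pd l f) z
      = fderiv ℝ (fderiv ℝ f) z (Pi.single k 1) (Pi.single l 1) := by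
    intro k l
    unfold pd
    rw [fderiv_clm_apply hd (differentiableAt_const _)]
    simp
  rw [key, key, hsym.eq]

theorem pd_add {f g : (Fin 5 → ℝ) → ℝ} (hf : Smooth5 f) (hg : Smooth5 g) (i : Fin 5) :
    pd i (fun z => f z + g z) = fun z => pd i f z + pd i g z := by
  funext z
  unfold pd
  rw [fderiv_fun_add (hf.differentiable z) (hg.differentiable z)]
  rfl

theorem pd_sub {f g : (Fin 5 → ℝ) → ℝ} (hf : Smooth5 f) (hg : Smooth5 g) (i : Fin 5) :
    pd i (fun z => f z - g z) = fun z => pd i f z - pd i g z := by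
  funext z
  unfold pd
  rw [fderiv_fun_sub (hf.differentiable z) (hg.differentiable z)]
  rfl

theorem pd_mul {f g : (Fin 5 → ℝ) → ℝ} (hf : Smooth5 f) (hg : Smooth5 g) (i : Fin 5) :
    pd i (fun z => f z * g z) = fun z => f z * pd i g z + pd i f z * g z := by
  funext z
  unfold pd
  rw [fderiv_fun_mul (hf.differentiable z) (hg.differentiable z)]
  simp
  ring

theorem pd_const_mul {f : (Fin 5 → ℝ) → ℝ} (hf : Smooth5 f) (c : ℝ) (i : Fin 5) :
    pd i (fun z => c * f z) = fun z => c * pd i f z := by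
  funext z
  unfold pd
  rw [fderiv_const_mul (hf.differentiable z)]
  rfl

theorem pd_coord (i j : Fin 5) (z : Fin 5 → ℝ) : pd i (fun z => z j) z = if i = j then 1 else 0 := by
  unfold pd
  have : fderiv ℝ (fun z : Fin 5 → ℝ => z j) z = ContinuousLinearMap.proj (R := ℝ) j :=
    (ContinuousLinearMap.proj (R := ℝ) (φ := fun _ : Fin 5 => ℝ) j).fderiv
  rw [this]
  simp [Pi.single_apply, eq_comm]

/-- The rotation or boost `z_p ∂_q + s z_q ∂_p`. -/
def rotBoost (p q : Fin 5) (s : ℝ) (f : (Fin 5 → ℝ) → ℝ) : (Fin 5 → ℝ) → ℝ :=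
  fun z => z p * pd q f z + s * (z q * pd p f z)

theorem Smooth5.rotBoost {f : (Fin 5 → ℝ) → ℝ} (hf : Smooth5 f) (p q : Fin 5) (s : ℝ) :
    Smooth5 (rotBoost p q s f) := by
  unfold Smooth5 _root_.rotBoost
  have h1 := hf.pd p
  have h2 := hf.pd q
  have h3 := smooth5_coord p
  have h4 := smooth5_coord q
  exact (h3.mul h2).add (contDiff_const.mul (h4.mul h1))

theorem pd_rotBoost {f : (Fin 5 → ℝ) → ℝ} (hf : Smooth5 f) (j p q : Fin 5) (s : ℝ) :
    pd j (rotBoost p q s f) = fun z => rotBoost p q s (pd j f) z +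
      ((if j = p then 1 else 0) * pd q f z + (s * (if j = q then 1 else 0)) * pd p f z) := by
  unfold rotBoost
  have h1 := hf.pd p
  have h2 := hf.pd q
  have h3 := smooth5_coord p
  have h4 := smooth5_coord q
  rw [pd_add (h3.mul h2) (contDiff_const.mul (h4.mul h1)), pd_mul h3 h2, pd_const_mul (h4.mul h1),
    pd_mul h4 h1]
  funext z
  simp only [pd_coord, pd_comm hf j p, pd_comm hf j q]
  ring

/-- The signature `(+,-,-,-,-)` of the d'Alembertian. -/
def sgn5 (j : Fin 5) : ℝ := if j = 0 then 1 else -1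

theorem Box5_eq_sum (f : (Fin 5 → ℝ) → ℝ) (z : Fin 5 → ℝ) :
    Box5 f z = ∑ j, sgn5 j * pd j (pd j f) z := by
  simp only [Box5, Fin.sum_univ_five, sgn5]
  simp
  ring

theorem Smooth5.Box5 {f : (Fin 5 → ℝ) → ℝ} (hf : Smooth5 f) : Smooth5 (Box5 f) := by
  unfold Smooth5 _root_.Box5
  exact (((((hf.pd 0).pd 0).sub ((hf.pd 1).pd 1)).sub ((hf.pd 2).pd 2)).sub ((hf.pd 3).pd 3)).sub
    ((hf.pd 4).pd 4)

theorem pd_sum {ι : Type*} (s : Finset ι) {F : ι → (Fin 5 → ℝ) → ℝ} (hF : ∀ i, Smooth5 (F i))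
    (i : Fin 5) : pd i (fun z => ∑ k ∈ s, F k z) = fun z => ∑ k ∈ s, pd i (F k) z := by
  funext z
  unfold pd
  rw [fderiv_fun_sum (fun k _ => (hF k).differentiable z)]
  simp

theorem pd_Box5 {f : (Fin 5 → ℝ) → ℝ} (hf : Smooth5 f) (i : Fin 5) :
    pd i (Box5 f) = Box5 (pd i f) := by
  have h : Box5 f = fun z => ∑ j, sgn5 j * pd j (pd j f) z := funext (Box5_eq_sum f)
  rw [h, pd_sum _ (fun j => contDiff_const.mul ((hf.pd j).pd j))]
  funext z
  rw [Box5_eq_sum]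
  refine Finset.sum_congr rfl fun j _ => ?_
  rw [pd_const_mul ((hf.pd j).pd j), pd_comm (hf.pd j) i j, pd_comm hf i j]

theorem Box5_rotBoost {f : (Fin 5 → ℝ) → ℝ} (hf : Smooth5 f) (p q : Fin 5) (s : ℝ)
    (hs : sgn5 p + s * sgn5 q = 0) : Box5 (rotBoost p q s f) = rotBoost p q s (Box5 f) := by
  have h2 : ∀ j z, pd j (pd j (rotBoost p q s f)) z = rotBoost p q s (pd j (pd j f)) z +
      ((if j = p then 1 else 0) * (2 * pd j (pd q f) z) +
        (s * (if j = q then 1 else 0)) * (2 * pd j (pd p f) z)) := by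
    intro j z
    rw [pd_rotBoost hf, pd_add ((hf.pd j).rotBoost p q s)
      ((contDiff_const.mul (hf.pd q)).add (contDiff_const.mul (hf.pd p))), pd_rotBoost (hf.pd j),
      pd_add (contDiff_const.mul (hf.pd q)) (contDiff_const.mul (hf.pd p)),
      pd_const_mul (hf.pd q), pd_const_mul (hf.pd p)]
    simp only [pd_comm hf j p, pd_comm hf j q]
    ring
  funext z
  rw [Box5_eq_sum]
  simp only [h2, mul_add, Finset.sum_add_distrib]
  have e1 : ∑ j, sgn5 j * ((if j = p then 1 else 0) * (2 * pd j (pd q f) z))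
      = sgn5 p * (2 * pd p (pd q f) z) := by
    simp [ite_mul]
  have e2 : ∑ j, sgn5 j * ((s * (if j = q then 1 else 0)) * (2 * pd j (pd p f) z))
      = s * sgn5 q * (2 * pd p (pd q f) z) := by
    simp only [mul_ite, mul_one, mul_zero, ite_mul, zero_mul, Finset.sum_ite_eq', Finset.mem_univ,
      if_true]
    rw [pd_comm hf q p]; ring
  rw [e1, e2, ← add_mul, hs, zero_mul, add_zero]
  unfold rotBoost
  rw [pd_Box5 hf, pd_Box5 hf, Box5_eq_sum, Box5_eq_sum, Finset.mul_sum, Finset.mul_sum,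
    Finset.mul_sum, ← Finset.sum_add_distrib]
  refine Finset.sum_congr rfl fun j _ => ?_
  rw [pd_comm (hf.pd j) p j, pd_comm hf p j, pd_comm (hf.pd j) q j, pd_comm hf q j]
  ring

/-- Every field other than `∂_y` is a translation or a Lorentz rotation tangential to the slab. -/
theorem G5_castSucc_cases (i : Fin 10) :
    (∃ j : Fin 5, j ≠ 4 ∧ G5 i.castSucc = pd j) ∨
      ∃ p q : Fin 5, ∃ s : ℝ, p ≠ 4 ∧ q ≠ 4 ∧ sgn5 p + s * sgn5 q = 0 ∧
        G5 i.castSucc = rotBoost p q s := by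
  have rot : ∀ p q : Fin 5, rotBoost p q (-1) = fun f z => z p * pd q f z - z q * pd p f z := by
    intro p q; funext f z; simp [rotBoost]; ring
  have boost : ∀ p q : Fin 5, rotBoost p q 1 = fun f z => z p * pd q f z + z q * pd p f z := by
    intro p q; funext f z; simp [rotBoost]
  have s0 : sgn5 0 = 1 := rfl
  have s1 : ∀ j : Fin 5, j ≠ 0 → sgn5 j = -1 := fun j hj => if_neg hj
  fin_cases i
  · exact Or.inl ⟨0, by decide, rfl⟩
  · exact Or.inl ⟨1, by decide, rfl⟩
  · exact Or.inl ⟨2, by decide, rfl⟩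
  · exact Or.inl ⟨3, by decide, rfl⟩
  · exact Or.inr ⟨1, 2, -1, by decide, by decide,
      by rw [s1 _ (by decide), s1 _ (by decide)]; norm_num, by rw [rot]; rfl⟩
  · exact Or.inr ⟨1, 3, -1, by decide, by decide,
      by rw [s1 _ (by decide), s1 _ (by decide)]; norm_num, by rw [rot]; rfl⟩
  · exact Or.inr ⟨2, 3, -1, by decide, by decide,
      by rw [s1 _ (by decide), s1 _ (by decide)]; norm_num, by rw [rot]; rfl⟩
  · exact Or.inr ⟨1, 0, 1, by decide, by decide,
      by rw [s1 _ (by decide), s0]; norm_num, by rw [boost]; rfl⟩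
  · exact Or.inr ⟨2, 0, 1, by decide, by decide,
      by rw [s1 _ (by decide), s0]; norm_num, by rw [boost]; rfl⟩
  · exact Or.inr ⟨3, 0, 1, by decide, by decide,
      by rw [s1 _ (by decide), s0]; norm_num, by rw [boost]; rfl⟩

theorem G5_last : G5 (Fin.last 10) = pd 4 := rfl

theorem Smooth5.G5 {f : (Fin 5 → ℝ) → ℝ} (hf : Smooth5 f) (i : Fin 11) : Smooth5 (G5 i f) := by
  induction i using Fin.lastCases with
  | last => rw [G5_last]; exact hf.pd 4
  | cast i =>
    rcases G5_castSucc_cases i with ⟨j, -, h⟩ | ⟨p, q, s, -, -, -, h⟩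
    · rw [h]; exact hf.pd j
    · rw [h]; exact hf.rotBoost p q s

theorem Box5_G5 {f : (Fin 5 → ℝ) → ℝ} (hf : Smooth5 f) (i : Fin 11) :
    Box5 (G5 i f) = G5 i (Box5 f) := by
  induction i using Fin.lastCases with
  | last => rw [G5_last, pd_Box5 hf]
  | cast i =>
    rcases G5_castSucc_cases i with ⟨j, -, h⟩ | ⟨p, q, s, -, -, hs, h⟩
    · rw [h, pd_Box5 hf]
    · rw [h, Box5_rotBoost hf p q s hs]

theorem pd_four_G5 {f : (Fin 5 → ℝ) → ℝ} (hf : Smooth5 f) (i : Fin 11) :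
    pd 4 (G5 i f) = G5 i (pd 4 f) := by
  induction i using Fin.lastCases with
  | last => rw [G5_last]
  | cast i =>
    rcases G5_castSucc_cases i with ⟨j, -, h⟩ | ⟨p, q, s, hp, hq, hs, h⟩
    · rw [h, pd_comm hf]
    · rw [h, pd_rotBoost hf, if_neg hp.symm, if_neg hq.symm]; simp

theorem Smooth5.opIter {f : (Fin 5 → ℝ) → ℝ} (hf : Smooth5 f) (L : List (Fin 11)) :
    Smooth5 (opIter _root_.G5 L f) := by
  induction L with
  | nil => exact hf
  | cons i L ih => exact ih.G5 i

theorem Box5_opIter {f : (Fin 5 → ℝ) → ℝ} (hf : Smooth5 f) (L : List (Fin 11)) :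
    Box5 (opIter G5 L f) = opIter G5 L (Box5 f) := by
  induction L with
  | nil => rfl
  | cons i L ih =>
    change Box5 (G5 i (opIter G5 L f)) = G5 i (opIter G5 L (Box5 f))
    rw [Box5_G5 (hf.opIter L), ih]

theorem pd_four_opIter {f : (Fin 5 → ℝ) → ℝ} (hf : Smooth5 f) (L : List (Fin 11)) :
    pd 4 (opIter G5 L f) = opIter G5 L (pd 4 f) := by
  induction L with
  | nil => rfl
  | cons i L ih =>
    change pd 4 (G5 i (opIter G5 L f)) = G5 i (opIter G5 L (pd 4 f))
    rw [pd_four_G5 (hf.opIter L), ih]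

theorem Smooth5.continuous {f : (Fin 5 → ℝ) → ℝ} (hf : Smooth5 f) : Continuous f :=
  ContDiff.continuous hf

theorem pd_eq_zero_of_vanish {A : Set (Fin 5 → ℝ)} (hA : A ⊆ closure (interior A))
    {f : (Fin 5 → ℝ) → ℝ} (hf : Smooth5 f) (h : ∀ z ∈ A, f z = 0) (i : Fin 5) :
    ∀ z ∈ A, pd i f z = 0 := by
  have hInt : ∀ z ∈ interior A, pd i f z = 0 := by
    intro z hz
    have : f =ᶠ[nhds z] fun _ => 0 := by
      filter_upwards [mem_interior_iff_mem_nhds.1 hz] with w hw using h w hw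
    unfold pd
    rw [this.fderiv_eq]
    simp
  have hcl : IsClosed {z | pd i f z = 0} := isClosed_eq (hf.pd i).continuous continuous_const
  exact fun z hz => (hcl.closure_subset_iff.2 hInt) (hA hz)

theorem slab_subset_closure_interior {a b : ℝ} (hab : a < b) {J : Set ℝ}
    (hJ : J ⊆ closure (interior J)) {O : Set (Fin 5 → ℝ)} (hO : IsOpen O) :
    {z : Fin 5 → ℝ | z 4 ∈ Set.Icc a b ∧ z 0 ∈ J ∧ z ∈ O} ⊆
      closure (interior {z : Fin 5 → ℝ | z 4 ∈ Set.Icc a b ∧ z 0 ∈ J ∧ z ∈ O}) := by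
  set c : Fin 5 → Set ℝ := ![J, Set.univ, Set.univ, Set.univ, Set.Icc a b] with hc
  have hmem : ∀ z : Fin 5 → ℝ, z ∈ Set.univ.pi c ↔ z 4 ∈ Set.Icc a b ∧ z 0 ∈ J := by
    intro z
    constructor
    · intro h; exact ⟨h 4 trivial, h 0 trivial⟩
    · rintro ⟨h4, h0⟩ i -
      fin_cases i
      · exact h0
      · trivial
      · trivial
      · trivial
      · exact h4
  have hcc : ∀ i, c i ⊆ closure (interior (c i)) := by
    intro i
    fin_cases i
    · exact hJ
    · simp [c]
    · simp [c]
    · simp [c]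
    · change Set.Icc a b ⊆ closure (interior (Set.Icc a b))
      rw [interior_Icc, closure_Ioo hab.ne]
  have hP : Set.univ.pi c ⊆ closure (interior (Set.univ.pi c)) := by
    rw [interior_pi_set Set.finite_univ, closure_pi_set]
    exact Set.pi_mono fun i _ => hcc i
  have hset : {z : Fin 5 → ℝ | z 4 ∈ Set.Icc a b ∧ z 0 ∈ J ∧ z ∈ O} = O ∩ Set.univ.pi c := by
    ext z
    rw [Set.mem_inter_iff, hmem]
    simp only [Set.mem_ofPred_eq]
    tauto
  rw [hset, interior_inter, hO.interior_eq]
  exact fun z hz => hO.inter_closure ⟨hz.1, hP hz.2⟩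

theorem continuous_rad5 : Continuous rad5 := by
  unfold rad5
  fun_prop

/-- Vanishing on the slab for early times and outside of the shifted light cone. -/
structure Vanish (a b B : ℝ) (f : (Fin 5 → ℝ) → ℝ) : Prop where
  early : ∀ z : Fin 5 → ℝ, z 4 ∈ Set.Icc a b → 0 ≤ z 0 → z 0 ≤ 2 * B → f z = 0
  far : ∀ z : Fin 5 → ℝ, z 4 ∈ Set.Icc a b → 0 ≤ z 0 → rad5 z > z 0 - B → f z = 0

theorem pd_early {a b B : ℝ} (hab : a < b) (hB : 0 < B) {f : (Fin 5 → ℝ) → ℝ} (hf : Smooth5 f)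
    (h : ∀ z : Fin 5 → ℝ, z 4 ∈ Set.Icc a b → 0 ≤ z 0 → z 0 ≤ 2 * B → f z = 0) (i : Fin 5) :
    ∀ z : Fin 5 → ℝ, z 4 ∈ Set.Icc a b → 0 ≤ z 0 → z 0 ≤ 2 * B → pd i f z = 0 := by
  have hJ : Set.Icc 0 (2 * B) ⊆ closure (interior (Set.Icc 0 (2 * B))) := by
    rw [interior_Icc, closure_Ioo (by linarith : (0 : ℝ) < 2 * B).ne]
  have := pd_eq_zero_of_vanish (slab_subset_closure_interior hab hJ isOpen_univ) hf
    (fun z hz => h z hz.1 hz.2.1.1 hz.2.1.2) i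
  exact fun z h4 h0 h1 => this z ⟨h4, ⟨h0, h1⟩, trivial⟩

theorem pd_far {a b B : ℝ} (hab : a < b) {f : (Fin 5 → ℝ) → ℝ} (hf : Smooth5 f)
    (h : ∀ z : Fin 5 → ℝ, z 4 ∈ Set.Icc a b → 0 ≤ z 0 → rad5 z > z 0 - B → f z = 0) (i : Fin 5) :
    ∀ z : Fin 5 → ℝ, z 4 ∈ Set.Icc a b → 0 ≤ z 0 → rad5 z > z 0 - B → pd i f z = 0 := by
  have hJ : Set.Ici (0 : ℝ) ⊆ closure (interior (Set.Ici 0)) := by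
    rw [interior_Ici, closure_Ioi]
  have hO : IsOpen {z : Fin 5 → ℝ | z 0 - B < rad5 z} :=
    isOpen_lt (by fun_prop) continuous_rad5
  have := pd_eq_zero_of_vanish (slab_subset_closure_interior hab hJ hO) hf
    (fun z hz => h z hz.1 hz.2.1 hz.2.2) i
  exact fun z h4 h0 h1 => this z ⟨h4, h0, h1⟩

theorem Vanish.pd {a b B : ℝ} (hab : a < b) (hB : 0 < B) {f : (Fin 5 → ℝ) → ℝ} (hf : Smooth5 f)
    (h : Vanish a b B f) (i : Fin 5) : Vanish a b B (pd i f) :=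
  ⟨pd_early hab hB hf h.early i, pd_far hab hf h.far i⟩

theorem Vanish.rotBoost {a b B : ℝ} (hab : a < b) (hB : 0 < B) {f : (Fin 5 → ℝ) → ℝ}
    (hf : Smooth5 f) (h : Vanish a b B f) (p q : Fin 5) (s : ℝ) :
    Vanish a b B (rotBoost p q s f) := by
  have h1 := h.pd hab hB hf p
  have h2 := h.pd hab hB hf q
  constructor <;> intro z z1 z2 z3 <;> unfold _root_.rotBoost
  · rw [h1.early z z1 z2 z3, h2.early z z1 z2 z3]; ring
  · rw [h1.far z z1 z2 z3, h2.far z z1 z2 z3]; ring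

theorem Vanish.G5 {a b B : ℝ} (hab : a < b) (hB : 0 < B) {f : (Fin 5 → ℝ) → ℝ} (hf : Smooth5 f)
    (h : Vanish a b B f) (i : Fin 11) : Vanish a b B (G5 i f) := by
  induction i using Fin.lastCases with
  | last => rw [G5_last]; exact h.pd hab hB hf 4
  | cast i =>
    rcases G5_castSucc_cases i with ⟨j, -, e⟩ | ⟨p, q, s, -, -, -, e⟩
    · rw [e]; exact h.pd hab hB hf j
    · rw [e]; exact h.rotBoost hab hB hf p q s

theorem Vanish.opIter {a b B : ℝ} (hab : a < b) (hB : 0 < B) {f : (Fin 5 → ℝ) → ℝ}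
    (hf : Smooth5 f) (h : Vanish a b B f) (L : List (Fin 11)) :
    Vanish a b B (opIter _root_.G5 L f) := by
  induction L with
  | nil => exact h
  | cons i L ih => exact ih.G5 hab hB (hf.opIter L) i

theorem Vanish.Box5 {a b B : ℝ} (hab : a < b) (hB : 0 < B) {f : (Fin 5 → ℝ) → ℝ} (hf : Smooth5 f)
    (h : Vanish a b B f) : Vanish a b B (Box5 f) := by
  have hj := fun j => (h.pd hab hB hf j).pd hab hB (hf.pd j) j
  constructor <;> intro z z1 z2 z3 <;> rw [Box5_eq_sum] <;>
    refine Finset.sum_eq_zero fun j _ => ?_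
  · rw [(hj j).early z z1 z2 z3, mul_zero]
  · rw [(hj j).far z z1 z2 z3, mul_zero]

/-- The Dirichlet condition on the two faces `y = a` and `y = b`. -/
def Dirichlet (a b : ℝ) (f : (Fin 5 → ℝ) → ℝ) : Prop :=
  ∀ z : Fin 5 → ℝ, z 4 = a ∨ z 4 = b → f z = 0

theorem hasDerivAt_line_pd {f : (Fin 5 → ℝ) → ℝ} (hf : Smooth5 f) (z : Fin 5 → ℝ) (i : Fin 5) :
    HasDerivAt (fun s : ℝ => f (z + s • (Pi.single i (1 : ℝ) : Fin 5 → ℝ))) (pd i f z) 0 := by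
  have h := (hf.differentiable z).hasFDerivAt.hasLineDerivAt (Pi.single i 1)
  exact h

theorem Dirichlet.pd {a b : ℝ} {f : (Fin 5 → ℝ) → ℝ} (hf : Smooth5 f) (h : Dirichlet a b f)
    {i : Fin 5} (hi : i ≠ 4) : Dirichlet a b (pd i f) := by
  intro z hz
  have h1 := hasDerivAt_line_pd hf z i
  have h2 : (fun s : ℝ => f (z + s • Pi.single i 1)) = fun _ => 0 := by
    funext s
    apply h
    simpa [Pi.single_apply, hi.symm] using hz
  rw [h2] at h1
  exact h1.unique (hasDerivAt_const _ _)

theorem Dirichlet.G5 {a b : ℝ} {f : (Fin 5 → ℝ) → ℝ} (hf : Smooth5 f) (h : Dirichlet a b f)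
    (i : Fin 10) : Dirichlet a b (G5 i.castSucc f) := by
  rcases G5_castSucc_cases i with ⟨j, hj, e⟩ | ⟨p, q, s, hp, hq, -, e⟩
  · rw [e]; exact h.pd hf hj
  · rw [e]
    intro z hz
    unfold rotBoost
    rw [h.pd hf hp z hz, h.pd hf hq z hz]
    ring

/-- Smooth functions with the support and boundary behaviour of `∂_y u`. -/
structure Good (a b B : ℝ) (v : (Fin 5 → ℝ) → ℝ) : Prop where
  smooth : Smooth5 v
  vanish : Vanish a b B v
  dirichlet : Dirichlet a b v

theorem Good.G5 {a b B : ℝ} (hab : a < b) (hB : 0 < B) {v : (Fin 5 → ℝ) → ℝ} (h : Good a b B v)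
    (i : Fin 10) : Good a b B (G5 i.castSucc v) :=
  ⟨h.smooth.G5 _, h.vanish.G5 hab hB h.smooth _, h.dirichlet.G5 h.smooth i⟩

/-- The space-time point with time `τ` and spatial part `Y = (x, y)`. -/
def cs (τ : ℝ) (Y : Fin 4 → ℝ) : Fin 5 → ℝ := Fin.cons τ Y

/-- The lower corner of the spatial box. -/
def boxLo (R a : ℝ) : Fin 4 → ℝ := ![-R, -R, -R, a]

/-- The upper corner of the spatial box. -/
def boxHi (R b : ℝ) : Fin 4 → ℝ := ![R, R, R, b]

/-- The spatial box `[-R,R]³ × [a,b]`. -/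
abbrev box4 (R a b : ℝ) : Set (Fin 4 → ℝ) := Set.Icc (boxLo R a) (boxHi R b)

theorem mem_box4 {R a b : ℝ} {Y : Fin 4 → ℝ} : Y ∈ box4 R a b ↔
    |Y 0| ≤ R ∧ |Y 1| ≤ R ∧ |Y 2| ≤ R ∧ Y 3 ∈ Set.Icc a b := by
  simp only [box4, Set.mem_Icc, Pi.le_def, Fin.forall_fin_succ, boxLo, boxHi, abs_le]
  simp
  tauto

theorem continuous_cs : Continuous fun p : ℝ × (Fin 4 → ℝ) => cs p.1 p.2 := by
  unfold cs
  refine continuous_pi fun i => ?_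
  refine Fin.cases ?_ (fun j => ?_) i
  · simpa using continuous_fst
  · simp only [Fin.cons_succ]
    fun_prop

/-- The energy density. -/
def ed (v : (Fin 5 → ℝ) → ℝ) (z : Fin 5 → ℝ) : ℝ :=
  ((pd 0 v z)^2 + (pd 1 v z)^2 + (pd 2 v z)^2 + (pd 3 v z)^2 + (pd 4 v z)^2) / 2

theorem ed_nonneg (v : (Fin 5 → ℝ) → ℝ) (z : Fin 5 → ℝ) : 0 ≤ ed v z := by
  unfold ed; positivity

theorem Smooth5.ed {v : (Fin 5 → ℝ) → ℝ} (hv : Smooth5 v) : Smooth5 (ed v) := by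
  unfold Smooth5 _root_.ed
  exact ((((((hv.pd 0).pow 2).add ((hv.pd 1).pow 2)).add ((hv.pd 2).pow 2)).add
    ((hv.pd 3).pow 2)).add ((hv.pd 4).pow 2)).div_const 2

theorem pd_ed {v : (Fin 5 → ℝ) → ℝ} (hv : Smooth5 v) (i : Fin 5) (z : Fin 5 → ℝ) :
    pd i (ed v) z = ∑ j, pd j v z * pd i (pd j v) z := by
  have : ed v = fun z => ∑ j, (1 / 2 : ℝ) * (pd j v z * pd j v z) := by
    funext z; simp only [ed, Fin.sum_univ_five]; ring
  rw [this, pd_sum _ (fun j => contDiff_const.mul ((hv.pd j).mul (hv.pd j)))]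
  refine Finset.sum_congr rfl fun j _ => ?_
  rw [pd_const_mul ((hv.pd j).mul (hv.pd j)), pd_mul (hv.pd j) (hv.pd j)]
  ring

/-- The energy current with weight `χ`. -/
def current (χ v : (Fin 5 → ℝ) → ℝ) (i : Fin 5) (z : Fin 5 → ℝ) : ℝ :=
  if i = 0 then χ z * ed v z else -1 * (χ z * (pd 0 v z * pd i v z))

/-- The divergence of the energy current. -/
def currentDiv (χ v : (Fin 5 → ℝ) → ℝ) (z : Fin 5 → ℝ) : ℝ :=
  pd 0 χ z * ed v z - pd 0 v z * (pd 1 χ z * pd 1 v z + pd 2 χ z * pd 2 v z + pd 3 χ z * pd 3 v z)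
    + χ z * (pd 0 v z * Box5 v z)

theorem smooth5_current {χ v : (Fin 5 → ℝ) → ℝ} (hχ : Smooth5 χ) (hv : Smooth5 v) (i : Fin 5) :
    Smooth5 (current χ v i) := by
  unfold Smooth5 current
  by_cases h : i = 0
  · simp only [h, if_true]; exact hχ.mul hv.ed
  · simp only [h, if_false]; exact contDiff_const.mul (hχ.mul ((hv.pd 0).mul (hv.pd i)))

theorem smooth5_currentDiv {χ v : (Fin 5 → ℝ) → ℝ} (hχ : Smooth5 χ) (hv : Smooth5 v) :
    Smooth5 (currentDiv χ v) := by
  unfold Smooth5 currentDiv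
  exact (((hχ.pd 0).mul hv.ed).sub ((hv.pd 0).mul ((((hχ.pd 1).mul (hv.pd 1)).add
    ((hχ.pd 2).mul (hv.pd 2))).add ((hχ.pd 3).mul (hv.pd 3))))).add
    (hχ.mul ((hv.pd 0).mul hv.Box5))

theorem sum_pd_current {χ v : (Fin 5 → ℝ) → ℝ} (hχ : Smooth5 χ) (hv : Smooth5 v)
    (h4 : ∀ z, pd 4 χ z = 0) (z : Fin 5 → ℝ) :
    ∑ i, pd i (current χ v i) z = currentDiv χ v z := by
  have e0 : pd 0 (current χ v 0) z = χ z * pd 0 (ed v) z + pd 0 χ z * ed v z := by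
    have : current χ v 0 = fun z => χ z * ed v z := by funext z; simp [current]
    rw [this, pd_mul hχ hv.ed]
  have ek : ∀ k : Fin 5, k ≠ 0 → pd k (current χ v k) z =
      -1 * (χ z * (pd 0 v z * pd k (pd k v) z + pd 0 (pd k v) z * pd k v z) +
        pd k χ z * (pd 0 v z * pd k v z)) := by
    intro k hk
    have : current χ v k = fun z => -1 * (χ z * (pd 0 v z * pd k v z)) := by
      funext z; simp [current, hk]
    rw [this, pd_const_mul (hχ.mul ((hv.pd 0).mul (hv.pd k))),
      pd_mul hχ ((hv.pd 0).mul (hv.pd k)), pd_mul (hv.pd 0) (hv.pd k), pd_comm hv k 0]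
  rw [Fin.sum_univ_five, e0, ek 1 (by decide), ek 2 (by decide), ek 3 (by decide),
    ek 4 (by decide), pd_ed hv, Fin.sum_univ_five, h4]
  unfold currentDiv Box5
  ring

theorem setIntegral_Icc_five {f : (Fin 5 → ℝ) → ℝ} (hf : Continuous f) {τ₀ τ₁ : ℝ}
    (hτ : τ₀ ≤ τ₁) (lo hi : Fin 4 → ℝ) :
    ∫ z in Set.Icc (cs τ₀ lo) (cs τ₁ hi), f z =
      ∫ τ in τ₀..τ₁, ∫ Y in Set.Icc lo hi, f (cs τ Y) := by
  have e := (volume_preserving_piFinSuccAbove (fun _ : Fin 5 => ℝ) 0).symm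
  have hpre : (MeasurableEquiv.piFinSuccAbove (fun _ : Fin 5 => ℝ) 0).symm ⁻¹'
      Set.Icc (cs τ₀ lo) (cs τ₁ hi) = Set.Icc τ₀ τ₁ ×ˢ Set.Icc lo hi := by
    ext ⟨τ, Y⟩
    simp only [Set.mem_preimage, Set.mem_Icc, Set.mem_prod, Pi.le_def, Fin.forall_fin_succ,
      MeasurableEquiv.piFinSuccAbove_symm_apply, cs]
    simp
    tauto
  have happ : ∀ p : ℝ × (Fin 4 → ℝ),
      (MeasurableEquiv.piFinSuccAbove (fun _ : Fin 5 => ℝ) 0).symm p = cs p.1 p.2 := by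
    intro p
    simp [MeasurableEquiv.piFinSuccAbove_symm_apply, cs, Fin.insertNthEquiv]
  rw [← e.setIntegral_preimage_emb (MeasurableEquiv.measurableEmbedding _), hpre]
  simp only [happ]
  rw [Measure.volume_eq_prod, setIntegral_prod]
  · rw [intervalIntegral.integral_of_le hτ, ← integral_Icc_eq_integral_Ioc]
  · have hc : Continuous fun p : ℝ × (Fin 4 → ℝ) => f (cs p.1 p.2) := hf.comp continuous_cs
    exact hc.continuousOn.integrableOn_compact (isCompact_Icc.prod isCompact_Icc)

theorem energy_identity {χ v : (Fin 5 → ℝ) → ℝ} (hχ : Smooth5 χ) (hv : Smooth5 v)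
    (h4 : ∀ z, pd 4 χ z = 0) {a b R τ₀ τ₁ : ℝ} (hab : a ≤ b) (hR : 0 ≤ R) (hτ : τ₀ ≤ τ₁)
    (hface : ∀ z : Fin 5 → ℝ, z 0 ∈ Set.Icc τ₀ τ₁ → z 4 ∈ Set.Icc a b →
      (|z 1| = R ∨ |z 2| = R ∨ |z 3| = R) → χ z * pd 0 v z = 0)
    (hbd : ∀ z : Fin 5 → ℝ, z 4 = a ∨ z 4 = b → pd 0 v z * pd 4 v z = 0) :
    (∫ Y in box4 R a b, χ (cs τ₁ Y) * ed v (cs τ₁ Y)) -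
      (∫ Y in box4 R a b, χ (cs τ₀ Y) * ed v (cs τ₀ Y)) =
      ∫ τ in τ₀..τ₁, ∫ Y in box4 R a b, currentDiv χ v (cs τ Y) := by
  set lo : Fin 5 → ℝ := cs τ₀ (boxLo R a) with hlo
  set hi : Fin 5 → ℝ := cs τ₁ (boxHi R b) with hhi
  have hle : lo ≤ hi := by
    intro i
    fin_cases i
    · exact hτ
    · change -R ≤ R; linarith
    · change -R ≤ R; linarith
    · change -R ≤ R; linarith
    · exact hab
  have hdiv := integral_divergence_of_hasFDerivAt_off_countable' lo hi hle
    (current χ v) (fun i z => fderiv ℝ (current χ v i) z) ∅ Set.countable_empty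
    (fun i => (smooth5_current hχ hv i).continuous.continuousOn)
    (fun z _ i => ((smooth5_current hχ hv i).differentiable z).hasFDerivAt)
    (by
      have : (fun z => ∑ i, (fderiv ℝ (current χ v i) z) (Pi.single i 1)) = currentDiv χ v :=
        funext fun z => sum_pd_current hχ hv h4 z
      rw [this]
      exact (smooth5_currentDiv hχ hv).continuous.continuousOn.integrableOn_compact isCompact_Icc)
  have hL : (∫ z in Set.Icc lo hi, ∑ i, (fderiv ℝ (current χ v i) z) (Pi.single i 1)) =
      ∫ τ in τ₀..τ₁, ∫ Y in box4 R a b, currentDiv χ v (cs τ Y) := by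
    rw [← setIntegral_Icc_five (smooth5_currentDiv hχ hv).continuous hτ]
    exact setIntegral_congr_fun measurableSet_Icc fun z _ => sum_pd_current hχ hv h4 z
  have hside : ∀ i : Fin 5, i ≠ 0 → ∀ c : ℝ, (c = lo i ∨ c = hi i) →
      (∫ x in Set.Icc (lo ∘ i.succAbove) (hi ∘ i.succAbove),
        current χ v i (i.insertNth c x)) = 0 := by
    intro i hi0 c hc
    refine setIntegral_eq_zero_of_forall_eq_zero fun x hx => ?_
    set z : Fin 5 → ℝ := i.insertNth c x with hz
    have hzi : z i = c := by simp [hz]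
    have hzmem : z ∈ Set.Icc lo hi := by
      have hc' : c ∈ Set.Icc (lo i) (hi i) := by
        rcases hc with h | h <;> rw [h]
        · exact ⟨le_rfl, hle i⟩
        · exact ⟨hle i, le_rfl⟩
      rw [hz, Fin.insertNth_mem_Icc]
      exact ⟨hc', hx⟩
    have hz0 : z 0 ∈ Set.Icc τ₀ τ₁ := ⟨hzmem.1 0, hzmem.2 0⟩
    have hz4 : z 4 ∈ Set.Icc a b := ⟨hzmem.1 4, hzmem.2 4⟩
    have habs : ∀ w : ℝ, (w = -R ∨ w = R) → |w| = R := by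
      rintro w (h | h) <;> simp [h, abs_of_nonneg hR]
    simp only [current, if_neg hi0]
    fin_cases i
    · exact absurd rfl hi0
    · have := hface z hz0 hz4 (Or.inl (habs _ (hzi.symm ▸ hc)))
      rw [← mul_assoc (χ z), this]; ring
    · have := hface z hz0 hz4 (Or.inr (Or.inl (habs _ (hzi.symm ▸ hc))))
      rw [← mul_assoc (χ z), this]; ring
    · have := hface z hz0 hz4 (Or.inr (Or.inr (habs _ (hzi.symm ▸ hc))))
      rw [← mul_assoc (χ z), this]; ring
    · have := hbd z (hzi.symm ▸ hc)
      change -1 * (χ z * (pd 0 v z * pd 4 v z)) = 0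
      rw [this]; ring
  rw [hL] at hdiv
  rw [hdiv, Fin.sum_univ_succ]
  have hrest : ∑ i : Fin 4, ((∫ x in Set.Icc (lo ∘ i.succ.succAbove) (hi ∘ i.succ.succAbove),
      current χ v i.succ (i.succ.insertNth (hi i.succ) x)) -
      ∫ x in Set.Icc (lo ∘ i.succ.succAbove) (hi ∘ i.succ.succAbove),
      current χ v i.succ (i.succ.insertNth (lo i.succ) x)) = 0 := by
    refine Finset.sum_eq_zero fun i _ => ?_
    rw [hside _ (Fin.succ_ne_zero i) _ (Or.inr rfl), hside _ (Fin.succ_ne_zero i) _ (Or.inl rfl),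
      sub_zero]
  rw [hrest, add_zero]
  have hface0 : Set.Icc (lo ∘ Fin.succAbove 0) (hi ∘ Fin.succAbove 0) = box4 R a b := by
    rfl
  rw [hface0]
  have hins : ∀ (c : ℝ) (Y : Fin 4 → ℝ), Fin.insertNth (α := fun _ => ℝ) 0 c Y = cs c Y := by
    intro c Y; rw [Fin.insertNth_zero]; rfl
  simp only [hins, current, if_true]
  rfl

/-- The hyperboloidal height function centred at `p`. -/
def hyp (δ : ℝ) (p : Fin 3 → ℝ) (z : Fin 5 → ℝ) : ℝ :=
  Real.sqrt (δ^2 + ((z 1 - p 0)^2 + (z 2 - p 1)^2 + (z 3 - p 2)^2))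

theorem hyp_arg_pos {δ : ℝ} (hδ : 0 < δ) (p : Fin 3 → ℝ) (z : Fin 5 → ℝ) :
    0 < δ^2 + ((z 1 - p 0)^2 + (z 2 - p 1)^2 + (z 3 - p 2)^2) := by positivity

theorem hyp_pos {δ : ℝ} (hδ : 0 < δ) (p : Fin 3 → ℝ) (z : Fin 5 → ℝ) : 0 < hyp δ p z :=
  Real.sqrt_pos.2 (hyp_arg_pos hδ p z)

theorem hyp_sq {δ : ℝ} (hδ : 0 < δ) (p : Fin 3 → ℝ) (z : Fin 5 → ℝ) :
    hyp δ p z ^ 2 = δ^2 + ((z 1 - p 0)^2 + (z 2 - p 1)^2 + (z 3 - p 2)^2) :=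
  Real.sq_sqrt (hyp_arg_pos hδ p z).le

theorem smooth5_hyp {δ : ℝ} (hδ : 0 < δ) (p : Fin 3 → ℝ) : Smooth5 (hyp δ p) := by
  unfold Smooth5 hyp
  refine ContDiff.sqrt ?_ fun z => (hyp_arg_pos hδ p z).ne'
  have h : ∀ (i : Fin 5) (c : ℝ), ContDiff ℝ ((⊤ : ℕ∞) : WithTop ℕ∞)
      (fun z : Fin 5 → ℝ => (z i - c)^2) := fun i c =>
    ((smooth5_coord i).sub contDiff_const).pow 2
  exact contDiff_const.add (((h 1 _).add (h 2 _)).add (h 3 _))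

theorem hyp_mul_pd {δ : ℝ} (hδ : 0 < δ) (p : Fin 3 → ℝ) (i : Fin 5) (z : Fin 5 → ℝ) :
    hyp δ p z * pd i (hyp δ p) z = (z 1 - p 0) * (if i = 1 then 1 else 0) +
      (z 2 - p 1) * (if i = 2 then 1 else 0) + (z 3 - p 2) * (if i = 3 then 1 else 0) := by
  have hs : (fun z => hyp δ p z * hyp δ p z) = fun z =>
      δ^2 + ∑ k : Fin 3, (z k.succ.castSucc - p k) * (z k.succ.castSucc - p k) := by
    funext z
    rw [← sq, hyp_sq hδ, Fin.sum_univ_three]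
    simp only [← sq]
    rfl
  have h1 := congrFun (pd_mul (smooth5_hyp hδ p) (smooth5_hyp hδ p) i) z
  have hc : ∀ k : Fin 3, Smooth5 fun z => z k.succ.castSucc - p k :=
    fun k => (smooth5_coord _).sub contDiff_const
  have hpc : ∀ (c : ℝ), pd i (fun _ : Fin 5 → ℝ => c) = fun _ => 0 := by
    intro c; funext z; simp [pd]
  rw [hs, pd_add (f := fun _ => δ^2) contDiff_const
    (ContDiff.sum fun k _ => (hc k).mul (hc k)), hpc,
    pd_sum _ (fun k => (hc k).mul (hc k))] at h1
  simp only [pd_mul (hc _) (hc _), pd_sub (smooth5_coord _) (g := fun _ => p _) contDiff_const,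
    hpc, pd_coord, Fin.sum_univ_three] at h1
  change 0 + (((z 1 - p 0) * ((if i = 1 then 1 else 0) - 0) + ((if i = 1 then 1 else 0) - 0) * (z 1 - p 0))
    + ((z 2 - p 1) * ((if i = 2 then 1 else 0) - 0) + ((if i = 2 then 1 else 0) - 0) * (z 2 - p 1))
    + ((z 3 - p 2) * ((if i = 3 then 1 else 0) - 0) + ((if i = 3 then 1 else 0) - 0) * (z 3 - p 2))) = _ at h1
  linarith

/-- The weight `F(t ± h)`. -/
def wt (F : ℝ → ℝ) (σ δ : ℝ) (p : Fin 3 → ℝ) (z : Fin 5 → ℝ) : ℝ := F (z 0 + σ * hyp δ p z)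

theorem smooth5_phase {δ : ℝ} (hδ : 0 < δ) (σ : ℝ) (p : Fin 3 → ℝ) :
    Smooth5 fun z => z 0 + σ * hyp δ p z :=
  (smooth5_coord 0).add (contDiff_const.mul (smooth5_hyp hδ p))

theorem smooth5_wt {F : ℝ → ℝ} (hF : ContDiff ℝ ((⊤ : ℕ∞) : WithTop ℕ∞) F) {δ : ℝ} (hδ : 0 < δ)
    (σ : ℝ) (p : Fin 3 → ℝ) : Smooth5 (wt F σ δ p) :=
  ContDiff.comp hF (smooth5_phase hδ σ p)

theorem pd_wt {F : ℝ → ℝ} (hF : ContDiff ℝ ((⊤ : ℕ∞) : WithTop ℕ∞) F) {δ : ℝ} (hδ : 0 < δ)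
    (σ : ℝ) (p : Fin 3 → ℝ) (i : Fin 5) (z : Fin 5 → ℝ) :
    pd i (wt F σ δ p) z = deriv F (z 0 + σ * hyp δ p z) *
      ((if i = 0 then 1 else 0) + σ * pd i (hyp δ p) z) := by
  have h2 : pd i (fun z => z 0 + σ * hyp δ p z) z =
      (if i = 0 then 1 else 0) + σ * pd i (hyp δ p) z := by
    rw [pd_add (smooth5_coord 0) (contDiff_const.mul (smooth5_hyp hδ p)),
      pd_const_mul (smooth5_hyp hδ p)]
    simp only [pd_coord]
  rw [← h2]
  have hd : HasDerivAt F (deriv F (z 0 + σ * hyp δ p z)) (z 0 + σ * hyp δ p z) :=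
    (hF.differentiable (by simp) _).hasDerivAt
  have := hd.comp_hasFDerivAt z ((smooth5_phase hδ σ p).differentiable z).hasFDerivAt
  unfold pd
  have e : fderiv ℝ (wt F σ δ p) z = _ := this.fderiv
  rw [e]
  simp

theorem current_quadratic_le {P q1 q2 q3 v0 v1 v2 v3 v4 : ℝ} (hP : P ≤ 0)
    (hq : q1^2 + q2^2 + q3^2 ≤ P^2) :
    P * ((v0^2 + v1^2 + v2^2 + v3^2 + v4^2) / 2) - v0 * (q1 * v1 + q2 * v2 + q3 * v3) ≤
      P / 2 * v4^2 := by
  have hcs : (q1 * v1 + q2 * v2 + q3 * v3)^2 ≤ (q1^2 + q2^2 + q3^2) * (v1^2 + v2^2 + v3^2) := by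
    nlinarith [sq_nonneg (q1 * v2 - q2 * v1), sq_nonneg (q1 * v3 - q3 * v1),
      sq_nonneg (q2 * v3 - q3 * v2)]
  have h2 : (q1 * v1 + q2 * v2 + q3 * v3)^2 ≤ P^2 * (v1^2 + v2^2 + v3^2) :=
    hcs.trans (mul_le_mul_of_nonneg_right hq (by positivity))
  set w := q1 * v1 + q2 * v2 + q3 * v3
  rcases hP.eq_or_lt with h | h
  · have : w = 0 := by
      have : w^2 ≤ 0 := by rw [h] at h2; simpa using h2
      nlinarith
    rw [this, h]; simp
  · suffices 0 ≤ (-2 * P) * (P / 2 * v4^2 - (P * ((v0^2 + v1^2 + v2^2 + v3^2 + v4^2) / 2) - v0 * w)) by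
      have h3 : 0 < -2 * P := by linarith
      nlinarith [nonneg_of_mul_nonneg_right this h3]
    nlinarith [sq_nonneg (P * v0 - w)]

theorem currentDiv_wt_le {F : ℝ → ℝ} (hF : ContDiff ℝ ((⊤ : ℕ∞) : WithTop ℕ∞) F)
    (hF' : ∀ s, deriv F s ≤ 0) {δ : ℝ} (hδ : 0 < δ) {σ : ℝ} (hσ : σ^2 = 1) (p : Fin 3 → ℝ)
    (v : (Fin 5 → ℝ) → ℝ) (z : Fin 5 → ℝ) :
    currentDiv (wt F σ δ p) v z ≤ deriv F (z 0 + σ * hyp δ p z) / 2 * (pd 4 v z)^2 +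
      wt F σ δ p z * (pd 0 v z * Box5 v z) := by
  unfold currentDiv ed
  have hh := hyp_pos hδ p z
  have d : ∀ i, _ := fun i => hyp_mul_pd hδ p i z
  have d0 := d 0
  have d1 := d 1
  have d2 := d 2
  have d3 := d 3
  simp +decide at d0 d1 d2 d3
  have d0' : pd 0 (hyp δ p) z = 0 := by rcases d0 with h | h; exacts [absurd h hh.ne', h]
  have hsum : (pd 1 (hyp δ p) z)^2 + (pd 2 (hyp δ p) z)^2 + (pd 3 (hyp δ p) z)^2 ≤ 1 := by
    have h1 : (hyp δ p z)^2 * ((pd 1 (hyp δ p) z)^2 + (pd 2 (hyp δ p) z)^2 +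
        (pd 3 (hyp δ p) z)^2) ≤ (hyp δ p z)^2 * 1 := by
      have : (hyp δ p z)^2 * ((pd 1 (hyp δ p) z)^2 + (pd 2 (hyp δ p) z)^2 +
        (pd 3 (hyp δ p) z)^2) = (z 1 - p 0)^2 + (z 2 - p 1)^2 + (z 3 - p 2)^2 := by
        rw [← d1, ← d2, ← d3]; ring
      rw [this, mul_one, hyp_sq hδ]
      nlinarith [sq_nonneg δ]
    exact le_of_mul_le_mul_left h1 (by positivity)
  have := current_quadratic_le (P := pd 0 (wt F σ δ p) z) (q1 := pd 1 (wt F σ δ p) z)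
    (q2 := pd 2 (wt F σ δ p) z) (q3 := pd 3 (wt F σ δ p) z) (v0 := pd 0 v z) (v1 := pd 1 v z)
    (v2 := pd 2 v z) (v3 := pd 3 v z) (v4 := pd 4 v z)
    (by rw [pd_wt hF hδ, d0']; simpa using hF' _)
    (by
      rw [pd_wt hF hδ, pd_wt hF hδ, pd_wt hF hδ, pd_wt hF hδ, d0']
      simp +decide only [if_false, if_true, zero_add, mul_zero, add_zero, mul_one]
      have : (deriv F (z 0 + σ * hyp δ p z) * (σ * pd 1 (hyp δ p) z)) ^ 2 +
        (deriv F (z 0 + σ * hyp δ p z) * (σ * pd 2 (hyp δ p) z)) ^ 2 +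
        (deriv F (z 0 + σ * hyp δ p z) * (σ * pd 3 (hyp δ p) z)) ^ 2 =
        deriv F (z 0 + σ * hyp δ p z) ^ 2 * ((pd 1 (hyp δ p) z)^2 + (pd 2 (hyp δ p) z)^2 +
        (pd 3 (hyp δ p) z)^2) * σ^2 := by ring
      rw [this, hσ, mul_one]
      exact mul_le_of_le_one_right (sq_nonneg _) hsum)
  have hP : pd 0 (wt F σ δ p) z = deriv F (z 0 + σ * hyp δ p z) := by
    rw [pd_wt hF hδ, d0']; simp
  rw [← hP]
  linarith

theorem pd_four_wt {F : ℝ → ℝ} (hF : ContDiff ℝ ((⊤ : ℕ∞) : WithTop ℕ∞) F) {δ : ℝ} (hδ : 0 < δ)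
    (σ : ℝ) (p : Fin 3 → ℝ) (z : Fin 5 → ℝ) : pd 4 (wt F σ δ p) z = 0 := by
  have h := hyp_mul_pd hδ p 4 z
  simp +decide at h
  have h' : pd 4 (hyp δ p) z = 0 := by
    rcases h with h | h; exacts [absurd h (hyp_pos hδ p z).ne', h]
  rw [pd_wt hF hδ, h']
  simp

theorem box4_subset_closure_interior {R a b : ℝ} (hR : 0 < R) (hab : a < b) :
    box4 R a b ⊆ closure (interior (box4 R a b)) := by
  have h : ∀ i, boxLo R a i < boxHi R b i := by
    intro i
    fin_cases i <;> simp [boxLo, boxHi] <;> linarith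
  have : box4 R a b = Set.univ.pi fun i => Set.Icc (boxLo R a i) (boxHi R b i) :=
    (Set.pi_univ_Icc _ _).symm
  rw [this, interior_pi_set Set.finite_univ, closure_pi_set]
  refine Set.pi_mono fun i _ => ?_
  rw [interior_Icc, closure_Ioo (h i).ne]

theorem eq_zero_of_setIntegral_box4_eq_zero {R a b : ℝ} (hR : 0 < R) (hab : a < b)
    {f : (Fin 4 → ℝ) → ℝ} (hf : Continuous f) (h0 : ∀ Y, 0 ≤ f Y)
    (hI : ∫ Y in box4 R a b, f Y ≤ 0) : ∀ Y ∈ box4 R a b, f Y = 0 := by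
  have hInt : IntegrableOn f (box4 R a b) := hf.continuousOn.integrableOn_compact isCompact_Icc
  have hI' : ∫ Y in box4 R a b, f Y = 0 := le_antisymm hI (integral_nonneg h0)
  have := (integral_eq_zero_iff_of_nonneg h0 hInt).1 hI'
  exact Measure.eqOn_of_ae_eq this hf.continuousOn continuousOn_const
    (box4_subset_closure_interior hR hab)

theorem continuous_cs_right (τ : ℝ) : Continuous (cs τ) :=
  continuous_cs.comp (Continuous.prodMk continuous_const continuous_id)

theorem cs_tail (z : Fin 5 → ℝ) : cs (z 0) (Fin.tail z) = z := Fin.cons_self_tail z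

theorem rad5_nonneg (z : Fin 5 → ℝ) : 0 ≤ rad5 z := Real.sqrt_nonneg _

theorem abs_le_rad5 (z : Fin 5 → ℝ) : |z 1| ≤ rad5 z ∧ |z 2| ≤ rad5 z ∧ |z 3| ≤ rad5 z := by
  refine ⟨?_, ?_, ?_⟩ <;> unfold rad5 <;> refine Real.abs_le_sqrt ?_ <;>
    nlinarith [sq_nonneg (z 1), sq_nonneg (z 2), sq_nonneg (z 3)]

theorem sqrt_add_sq_triangle (x y z x' y' z' : ℝ) :
    Real.sqrt ((x + x')^2 + (y + y')^2 + (z + z')^2) ≤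
      Real.sqrt (x^2 + y^2 + z^2) + Real.sqrt (x'^2 + y'^2 + z'^2) := by
  have h := norm_add_le (WithLp.toLp 2 ![x, y, z]) (WithLp.toLp 2 ![x', y', z'])
  simpa [EuclideanSpace.norm_eq, Fin.sum_univ_three] using h

theorem rad5_le_add_hyp (δ : ℝ) (p : Fin 3 → ℝ) (z : Fin 5 → ℝ) :
    Real.sqrt (p 0 ^2 + p 1 ^2 + p 2 ^2) ≤ rad5 z + hyp δ p z ∧
      rad5 z ≤ Real.sqrt (p 0 ^2 + p 1 ^2 + p 2 ^2) + hyp δ p z := by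
  have hle : Real.sqrt ((z 1 - p 0)^2 + (z 2 - p 1)^2 + (z 3 - p 2)^2) ≤ hyp δ p z :=
    Real.sqrt_le_sqrt (by nlinarith [sq_nonneg δ])
  have hle' : Real.sqrt ((p 0 - z 1)^2 + (p 1 - z 2)^2 + (p 2 - z 3)^2) ≤ hyp δ p z :=
    Real.sqrt_le_sqrt (by nlinarith [sq_nonneg δ])
  have h1 := sqrt_add_sq_triangle (z 1) (z 2) (z 3) (p 0 - z 1) (p 1 - z 2) (p 2 - z 3)
  have h2 := sqrt_add_sq_triangle (p 0) (p 1) (p 2) (z 1 - p 0) (z 2 - p 1) (z 3 - p 2)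
  simp only [add_sub_cancel] at h1 h2
  unfold rad5
  constructor <;> linarith

theorem smoothTransition_rev {c k : ℝ} (hk : 0 ≤ k) :
    ContDiff ℝ ((⊤ : ℕ∞) : WithTop ℕ∞) (fun s => Real.smoothTransition (c - k * s)) ∧
      ∀ s, deriv (fun s => Real.smoothTransition (c - k * s)) s ≤ 0 := by
  have hs : ContDiff ℝ ((⊤ : ℕ∞) : WithTop ℕ∞) Real.smoothTransition :=
    Real.smoothTransition.contDiff
  refine ⟨hs.comp (contDiff_const.sub (contDiff_const.mul contDiff_id)), fun s => ?_⟩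
  have hanti : Antitone fun s => Real.smoothTransition (c - k * s) := fun x y hxy =>
    Real.smoothTransition.monotone (by nlinarith)
  exact hanti.deriv_nonpos

/-- The hypotheses on a solution of the Neumann problem. -/
structure NeumannSol (a b B : ℝ) (u : (Fin 5 → ℝ) → ℝ) : Prop where
  smooth : Smooth5 u
  early : ∀ z : Fin 5 → ℝ, z 4 ∈ Set.Icc a b → 0 ≤ z 0 → z 0 ≤ 2 * B → u z = 0
  source : ∀ z : Fin 5 → ℝ, z 4 ∈ Set.Icc a b → 0 ≤ z 0 → rad5 z > z 0 - B → Box5 u z = 0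
  neumann : ∀ z : Fin 5 → ℝ, z 4 = a ∨ z 4 = b → pd 4 u z = 0

theorem NeumannSol.pd_zero_far {a b B : ℝ} (hab : a < b) (hB : 0 < B) {u : (Fin 5 → ℝ) → ℝ}
    (h : NeumannSol a b B u) (z : Fin 5 → ℝ) (hz4 : z 4 ∈ Set.Icc a b) (hz0 : 2 * B ≤ z 0)
    (hz : rad5 z > z 0 - B) : pd 0 u z = 0 := by
  set g := rad5 z - (z 0 - B) with hg
  have hgpos : 0 < g := by linarith
  set p : Fin 3 → ℝ := ![z 1, z 2, z 3] with hp
  have hrad : Real.sqrt (p 0 ^2 + p 1 ^2 + p 2 ^2) = rad5 z := rfl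
  set δ := g / 2 with hδ'
  have hδ : 0 < δ := by positivity
  set F : ℝ → ℝ := fun s => Real.smoothTransition ((z 0 + g) - 1 * s) with hF
  obtain ⟨hFc, hFd⟩ := smoothTransition_rev (c := z 0 + g) (k := 1) zero_le_one
  set χ := wt F 1 δ p with hχ
  have hχs : Smooth5 χ := smooth5_wt hFc hδ 1 p
  have hχ0 : ∀ w, 0 ≤ χ w := fun w => Real.smoothTransition.nonneg _
  have hsupp : ∀ w, z 0 + g ≤ w 0 + hyp δ p w → χ w = 0 := fun w hw =>
    Real.smoothTransition.zero_of_nonpos (by linarith)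
  set R := rad5 z + z 0 + g + 1 with hR
  have hRpos : 0 < R := by have := rad5_nonneg z; linarith
  have hid := energy_identity hχs h.smooth (pd_four_wt hFc hδ 1 p) hab.le hRpos.le hz0
    (by
      intro w hw0 hw4 hface
      rw [hsupp w, zero_mul]
      have h1 := (rad5_le_add_hyp δ p w).2
      rw [hrad] at h1
      have h2 := abs_le_rad5 w
      have h3 : R ≤ rad5 w := by rcases hface with h | h | h <;> rw [← h]; exacts [h2.1, h2.2.1, h2.2.2]
      linarith [hw0.1])
    (fun w hw => by rw [h.neumann w hw, mul_zero])
  have hnonpos : ∫ τ in (2*B)..(z 0), ∫ Y in box4 R a b, currentDiv χ u (cs τ Y) ≤ 0 := by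
    rw [intervalIntegral.integral_of_le hz0]
    refine setIntegral_nonpos measurableSet_Ioc fun τ hτ => ?_
    refine setIntegral_nonpos measurableSet_Icc fun Y hY => ?_
    refine (currentDiv_wt_le hFc hFd hδ (by norm_num) p u (cs τ Y)).trans ?_
    have hb : χ (cs τ Y) * (pd 0 u (cs τ Y) * Box5 u (cs τ Y)) = 0 := by
      by_cases hc : z 0 + g ≤ (cs τ Y) 0 + hyp δ p (cs τ Y)
      · rw [hsupp _ hc, zero_mul]
      · have h1 := (rad5_le_add_hyp δ p (cs τ Y)).1
        rw [hrad] at h1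
        have e0 : (cs τ Y) 0 = τ := rfl
        rw [h.source (cs τ Y) (mem_box4.1 hY).2.2.2 (by rw [e0]; linarith [hτ.1])
          (by rw [e0] at hc ⊢; linarith)]
        ring
    rw [hb, add_zero]
    have := hFd ((cs τ Y) 0 + 1 * hyp δ p (cs τ Y))
    nlinarith [sq_nonneg (pd 4 u (cs τ Y))]
  have hzero : ∫ Y in box4 R a b, χ (cs (2*B) Y) * ed u (cs (2*B) Y) = 0 := by
    refine setIntegral_eq_zero_of_forall_eq_zero fun Y hY => ?_
    have : ∀ i, pd i u (cs (2*B) Y) = 0 := fun i =>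
      pd_early hab hB h.smooth h.early i _ (mem_box4.1 hY).2.2.2 (by change 0 ≤ 2*B; linarith) (le_refl (2*B))
    simp [ed, this]
  rw [hzero, sub_zero] at hid
  have hpt := eq_zero_of_setIntegral_box4_eq_zero hRpos hab
    (f := fun Y => χ (cs (z 0) Y) * ed u (cs (z 0) Y))
    ((hχs.continuous.mul h.smooth.ed.continuous).comp (continuous_cs_right (z 0)))
    (fun Y => mul_nonneg (hχ0 _) (ed_nonneg _ _)) (hid.le.trans hnonpos) (Fin.tail z)
    (by
      rw [mem_box4]
      have h2 := abs_le_rad5 z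
      refine ⟨?_, ?_, ?_, hz4⟩
      · change |z 1| ≤ R; linarith [h2.1]
      · change |z 2| ≤ R; linarith [h2.2.1]
      · change |z 3| ≤ R; linarith [h2.2.2])
  simp only [cs_tail] at hpt
  have hχz : 0 < χ z := by
    refine Real.smoothTransition.pos_of_pos ?_
    have : hyp δ p z = δ := by
      simp [hyp, hp, Real.sqrt_sq hδ.le]
    rw [this]; linarith
  have hed : ed u z = 0 := by
    rcases mul_eq_zero.1 hpt with h | h
    exacts [absurd h hχz.ne', h]
  unfold ed at hed
  nlinarith [sq_nonneg (pd 0 u z), sq_nonneg (pd 1 u z), sq_nonneg (pd 2 u z), sq_nonneg (pd 3 u z), sq_nonneg (pd 4 u z)]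

theorem hasDerivAt_line_pd_at {f : (Fin 5 → ℝ) → ℝ} (hf : Smooth5 f) (z : Fin 5 → ℝ) (i : Fin 5)
    (s : ℝ) : HasDerivAt (fun s : ℝ => f (z + s • (Pi.single i (1 : ℝ) : Fin 5 → ℝ)))
      (pd i f (z + s • (Pi.single i (1 : ℝ) : Fin 5 → ℝ))) s := by
  have h1 : HasDerivAt (fun s : ℝ => z + s • (Pi.single i (1 : ℝ) : Fin 5 → ℝ))
      (Pi.single i (1 : ℝ) : Fin 5 → ℝ) s := by
    simpa using ((hasDerivAt_id s).smul_const (Pi.single i (1 : ℝ) : Fin 5 → ℝ)).const_add z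
  exact ((hf.differentiable _).hasFDerivAt).comp_hasDerivAt s h1

theorem NeumannSol.vanish {a b B : ℝ} (hab : a < b) (hB : 0 < B) {u : (Fin 5 → ℝ) → ℝ}
    (h : NeumannSol a b B u) : Vanish a b B u := by
  refine ⟨h.early, fun z hz4 hz0 hz => ?_⟩
  rcases le_total (z 0) (2 * B) with h0 | h0
  · exact h.early z hz4 hz0 h0
  set ρ : ℝ → Fin 5 → ℝ := fun s => z + s • (Pi.single 0 (1 : ℝ) : Fin 5 → ℝ) with hρ
  have hρ0 : ∀ s, ρ s 0 = z 0 + s := fun s => by simp [hρ]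
  have hρk : ∀ s (k : Fin 4), ρ s k.succ = z k.succ := fun s k => by
    simp [hρ, Fin.succ_ne_zero]
  have hrad : ∀ s, rad5 (ρ s) = rad5 z := by
    intro s
    unfold rad5
    have h1 := hρk s 0
    have h2 := hρk s 1
    have h3 := hρk s 2
    simp only [Fin.succ_zero_eq_one, Fin.succ_one_eq_two] at h1 h2
    change ρ s 3 = z 3 at h3
    rw [h1, h2, h3]
  have hconst := constant_of_has_deriv_right_zero (f := fun s => u (ρ s)) (a := 2 * B - z 0) (b := 0)
    (fun s _ => (hasDerivAt_line_pd_at h.smooth z 0 s).continuousAt.continuousWithinAt)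
    (fun s hs => by
      have : HasDerivAt (fun s => u (ρ s)) (pd 0 u (ρ s)) s :=
        hasDerivAt_line_pd_at h.smooth z 0 s
      have h4 : ρ s 4 = z 4 := hρk s 3
      rw [h.pd_zero_far hab hB (ρ s) (h4 ▸ hz4) (by rw [hρ0]; linarith [hs.1])
        (by rw [hρ0, hrad]; linarith [hs.2])] at this
      exact this.hasDerivWithinAt)
    0 ⟨by linarith, le_rfl⟩
  have e0 : ρ 0 = z := by simp [hρ]
  simp only [e0] at hconst
  rw [hconst]
  have h4 : ρ (2 * B - z 0) 4 = z 4 := hρk _ 3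
  exact h.early _ (h4 ▸ hz4) (by rw [hρ0]; linarith) (by rw [hρ0]; linarith)

theorem NeumannSol.good {a b B : ℝ} (hab : a < b) (hB : 0 < B) {u : (Fin 5 → ℝ) → ℝ}
    (h : NeumannSol a b B u) : Good a b B (pd 4 u) :=
  ⟨h.smooth.pd 4, (h.vanish hab hB).pd hab hB h.smooth 4, h.neumann⟩

/-- The measurable equivalence appending the last coordinate. -/
def snocEquiv : ((Fin 3 → ℝ) × ℝ) ≃ᵐ (Fin 4 → ℝ) :=
  MeasurableEquiv.prodComm.trans (MeasurableEquiv.piFinSuccAbove (fun _ : Fin 4 => ℝ) (Fin.last 3)).symm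

theorem snocEquiv_apply (p : (Fin 3 → ℝ) × ℝ) : snocEquiv p = Fin.snoc p.1 p.2 := by
  simp [snocEquiv, MeasurableEquiv.piFinSuccAbove_symm_apply, Fin.insertNthEquiv,
    MeasurableEquiv.prodComm]
  exact Fin.insertNth_last' _ _

theorem measurePreserving_snocEquiv : MeasurePreserving snocEquiv :=
  ((volume_preserving_piFinSuccAbove (fun _ : Fin 4 => ℝ) (Fin.last 3)).symm).comp
    Measure.measurePreserving_swap

/-- The cube `[-R,R]³`. -/
abbrev box3 (R : ℝ) : Set (Fin 3 → ℝ) := Set.Icc (fun _ => -R) (fun _ => R)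

theorem snocEquiv_preimage_box4 (R a b : ℝ) :
    snocEquiv ⁻¹' box4 R a b = box3 R ×ˢ Set.Icc a b := by
  ext ⟨x, y⟩
  rw [Set.mem_preimage, mem_box4, snocEquiv_apply]
  simp only [box3, Set.mem_prod, Set.mem_Icc, Pi.le_def, Fin.forall_fin_succ, abs_le]
  have h0 : (Fin.snoc x y : Fin 4 → ℝ) 0 = x 0 := rfl
  have h1 : (Fin.snoc x y : Fin 4 → ℝ) 1 = x 1 := rfl
  have h2 : (Fin.snoc x y : Fin 4 → ℝ) 2 = x 2 := rfl
  have h3 : (Fin.snoc x y : Fin 4 → ℝ) 3 = y := rfl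
  rw [h0, h1, h2, h3]
  simp
  tauto

theorem lintegral_box4 (R a b : ℝ) {F : (Fin 4 → ℝ) → ENNReal} (hF : Measurable F) :
    ∫⁻ Y in box4 R a b, F Y = ∫⁻ x in box3 R, ∫⁻ y in Set.Icc a b, F (Fin.snoc x y) := by
  rw [← measurePreserving_snocEquiv.setLIntegral_comp_preimage_emb
    snocEquiv.measurableEmbedding, snocEquiv_preimage_box4, Measure.volume_eq_prod,
    setLIntegral_prod (fun p => F (snocEquiv p)) (hF.comp snocEquiv.measurable).aemeasurable]
  simp only [snocEquiv_apply]

theorem setIntegral_box4 (R a b : ℝ) {F : (Fin 4 → ℝ) → ℝ} (hF : Continuous F) :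
    ∫ Y in box4 R a b, F Y = ∫ x in box3 R, ∫ y in Set.Icc a b, F (Fin.snoc x y) := by
  rw [← measurePreserving_snocEquiv.setIntegral_preimage_emb
    snocEquiv.measurableEmbedding, snocEquiv_preimage_box4, Measure.volume_eq_prod,
    setIntegral_prod]
  · simp only [snocEquiv_apply]
  · simp only [snocEquiv_apply]
    have hc : Continuous fun p : (Fin 3 → ℝ) × ℝ => (Fin.snoc p.1 p.2 : Fin 4 → ℝ) := by
      fun_prop
    exact (hF.comp hc).continuousOn.integrableOn_compact (isCompact_Icc.prod isCompact_Icc)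

/-- Integral of `f` over the spatial box at time `τ`. -/
def boxInt (R a b : ℝ) (f : (Fin 5 → ℝ) → ℝ) (τ : ℝ) : ℝ := ∫ Y in box4 R a b, f (cs τ Y)

theorem continuous_boxInt (R a b : ℝ) {f : (Fin 5 → ℝ) → ℝ} (hf : Continuous f) :
    Continuous (boxInt R a b f) := by
  unfold boxInt
  refine continuous_parametric_integral_of_continuous (f := fun τ Y => f (cs τ Y)) ?_ isCompact_Icc
  exact hf.comp continuous_cs

theorem integrableOn_box4 (R a b τ : ℝ) {f : (Fin 5 → ℝ) → ℝ} (hf : Continuous f) :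
    IntegrableOn (fun Y => f (cs τ Y)) (box4 R a b) :=
  (hf.comp (continuous_cs_right τ)).continuousOn.integrableOn_compact isCompact_Icc

theorem boxInt_mono (R a b τ : ℝ) {f g : (Fin 5 → ℝ) → ℝ} (hf : Continuous f) (hg : Continuous g)
    (h : ∀ z, f z ≤ g z) : boxInt R a b f τ ≤ boxInt R a b g τ :=
  setIntegral_mono (integrableOn_box4 R a b τ hf) (integrableOn_box4 R a b τ hg) fun _ => h _

theorem boxInt_nonneg (R a b τ : ℝ) {f : (Fin 5 → ℝ) → ℝ} (h : ∀ z, 0 ≤ f z) :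
    0 ≤ boxInt R a b f τ := integral_nonneg fun _ => h _

theorem L2ab_eq_boxInt {a b B : ℝ} (hB : 0 < B) {f : (Fin 5 → ℝ) → ℝ} (hf : Continuous f)
    (h : Vanish a b B f) {τ R : ℝ} (hτ : 0 ≤ τ) (hR : τ ≤ R) :
    L2ab a b f τ = Real.sqrt (boxInt R a b (fun z => f z ^ 2) τ) := by
  unfold L2ab boxInt
  have hc : Continuous fun Y => f (cs τ Y) ^ 2 := (hf.comp (continuous_cs_right τ)).pow 2
  rw [setIntegral_box4 R a b hc]
  congr 1
  symm
  refine setIntegral_eq_integral_of_forall_compl_eq_zero fun x hx => ?_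
  refine setIntegral_eq_zero_of_forall_eq_zero fun y hy => ?_
  have hz : f (cs τ (Fin.snoc x y)) = 0 := by
    refine h.far _ hy hτ ?_
    change rad5 (cs τ (Fin.snoc x y)) > τ - B
    have h2 := abs_le_rad5 (cs τ (Fin.snoc x y))
    by_contra hcon
    apply hx
    have hle : rad5 (cs τ (Fin.snoc x y)) ≤ R := by linarith
    simp only [box3, Set.mem_Icc, Pi.le_def, ← forall_and, ← abs_le]
    intro i
    fin_cases i
    · exact h2.1.trans hle
    · exact h2.2.1.trans hle
    · exact h2.2.2.trans hle
  change f (cs τ (Fin.snoc x y)) ^ 2 = 0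
  rw [hz]; ring

theorem L2ab_nonneg (a b : ℝ) (f : (Fin 5 → ℝ) → ℝ) (τ : ℝ) : 0 ≤ L2ab a b f τ := Real.sqrt_nonneg _

theorem boxInt_mul_le (R a b τ : ℝ) {f g : (Fin 5 → ℝ) → ℝ} (hf : Continuous f)
    (hg : Continuous g) : boxInt R a b (fun z => f z * g z) τ ≤
      Real.sqrt (boxInt R a b (fun z => f z ^ 2) τ) *
        Real.sqrt (boxInt R a b (fun z => g z ^ 2) τ) := by
  have hff : IntegrableOn (fun Y => f (cs τ Y) ^ 2) (box4 R a b) :=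
    integrableOn_box4 R a b τ (hf.pow 2)
  have hgg : IntegrableOn (fun Y => g (cs τ Y) ^ 2) (box4 R a b) :=
    integrableOn_box4 R a b τ (hg.pow 2)
  have hfg : IntegrableOn (fun Y => f (cs τ Y) * g (cs τ Y)) (box4 R a b) :=
    integrableOn_box4 R a b τ (hf.mul hg)
  have hq : ∀ s : ℝ, 0 ≤ boxInt R a b (fun z => f z ^ 2) τ * (s * s) +
      (2 * boxInt R a b (fun z => f z * g z) τ) * s + boxInt R a b (fun z => g z ^ 2) τ := by
    intro s
    have h0 : 0 ≤ boxInt R a b (fun z => (f z * s + g z) ^ 2) τ :=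
      boxInt_nonneg R a b τ fun z => sq_nonneg _
    have e : boxInt R a b (fun z => (f z * s + g z) ^ 2) τ =
        (s * s) * boxInt R a b (fun z => f z ^ 2) τ +
          (2 * s) * boxInt R a b (fun z => f z * g z) τ + boxInt R a b (fun z => g z ^ 2) τ := by
      unfold boxInt
      have : ∀ Y, (f (cs τ Y) * s + g (cs τ Y)) ^ 2 = ((s * s) * f (cs τ Y) ^ 2 +
          (2 * s) * (f (cs τ Y) * g (cs τ Y))) + g (cs τ Y) ^ 2 := fun Y => by ring
      simp only [this]
      rw [integral_add (f := fun Y => (s * s) * f (cs τ Y) ^ 2 +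
        (2 * s) * (f (cs τ Y) * g (cs τ Y))) ((hff.const_mul _).add (hfg.const_mul _)) hgg,
        integral_add (hff.const_mul _) (hfg.const_mul _), integral_const_mul, integral_const_mul]
    rw [e] at h0
    linarith
  have hd := discrim_le_zero hq
  unfold discrim at hd
  rw [← Real.sqrt_mul (boxInt_nonneg R a b τ fun z => sq_nonneg _)]
  refine Real.le_sqrt_of_sq_le ?_
  nlinarith

theorem Good.pd_far_face {a b B : ℝ} (hab : a < b) (hB : 0 < B) {v : (Fin 5 → ℝ) → ℝ}
    (hv : Good a b B v) {τ₀ τ₁ R : ℝ} (h0 : 0 ≤ τ₀) (hR : τ₁ ≤ R) (z : Fin 5 → ℝ)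
    (hz0 : z 0 ∈ Set.Icc τ₀ τ₁) (hz4 : z 4 ∈ Set.Icc a b)
    (hface : |z 1| = R ∨ |z 2| = R ∨ |z 3| = R) : pd 0 v z = 0 := by
  refine (hv.vanish.pd hab hB hv.smooth 0).far z hz4 (h0.trans hz0.1) ?_
  have h2 := abs_le_rad5 z
  have h3 : R ≤ rad5 z := by
    rcases hface with h | h | h <;> rw [← h]
    exacts [h2.1, h2.2.1, h2.2.2]
  linarith [hz0.2]

theorem Good.energy_bound {a b B : ℝ} (hab : a < b) (hB : 0 < B) {v : (Fin 5 → ℝ) → ℝ}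
    (hv : Good a b B v) {F : ℝ → ℝ} (hF : ContDiff ℝ ((⊤ : ℕ∞) : WithTop ℕ∞) F)
    (hF' : ∀ s, deriv F s ≤ 0) {K : ℝ} (hF0 : ∀ s, 0 ≤ F s) (hFK : ∀ s, F s ≤ K) (hK : 0 < K)
    {δ : ℝ} (hδ : 0 < δ) {σ : ℝ} (hσ : σ^2 = 1) (p : Fin 3 → ℝ) {τ₀ τ₁ R D : ℝ} (h0 : 0 ≤ τ₀)
    (h01 : τ₀ ≤ τ₁) (hR : τ₁ ≤ R) (hD : ∫ τ in τ₀..τ₁, L2ab a b (Box5 v) τ ≤ D) :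
    ∀ τ ∈ Set.Icc τ₀ τ₁, boxInt R a b (fun z => wt F σ δ p z * ed v z) τ +
      (∫ s in τ₀..τ, boxInt R a b
        (fun z => (-deriv F (z 0 + σ * hyp δ p z) / 2) * (pd 4 v z)^2) s) ≤
      2 * boxInt R a b (fun z => wt F σ δ p z * ed v z) τ₀ + 2 * K * D^2 := by
  set χ := wt F σ δ p with hχ
  have hχs : Smooth5 χ := smooth5_wt hF hδ σ p
  have hχ0 : ∀ z, 0 ≤ χ z := fun z => hF0 _
  set E := boxInt R a b (fun z => χ z * ed v z) with hE
  set q : (Fin 5 → ℝ) → ℝ := fun z => (-deriv F (z 0 + σ * hyp δ p z) / 2) * (pd 4 v z)^2 with hq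
  have hF'c : Continuous (deriv F) := hF.continuous_deriv (by simp)
  have hqc : Continuous q := by
    have := (smooth5_phase hδ σ p).continuous
    exact (((hF'c.comp this).neg).div_const 2).mul ((hv.smooth.pd 4).continuous.pow 2)
  have hq0 : ∀ z, 0 ≤ q z := fun z => by
    have := hF' (z 0 + σ * hyp δ p z)
    exact mul_nonneg (by linarith) (sq_nonneg _)
  have hEc : Continuous E := continuous_boxInt R a b (hχs.continuous.mul hv.smooth.ed.continuous)
  have hE0 : ∀ τ, 0 ≤ E τ := fun τ => boxInt_nonneg R a b τ fun z => mul_nonneg (hχ0 z) (ed_nonneg v z)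
  set g := fun τ => Real.sqrt (boxInt R a b (fun z => Box5 v z ^ 2) τ) with hg
  have hgc : Continuous g := (continuous_boxInt R a b (hv.smooth.Box5.continuous.pow 2)).sqrt
  have hg0 : ∀ τ, 0 ≤ g τ := fun τ => Real.sqrt_nonneg _
  have hgL : ∀ τ ∈ Set.Icc τ₀ τ₁, L2ab a b (Box5 v) τ = g τ := fun τ hτ =>
    L2ab_eq_boxInt hB hv.smooth.Box5.continuous (hv.vanish.Box5 hab hB hv.smooth)
      (h0.trans hτ.1) (hτ.2.trans hR)
  have hDg : ∫ τ in τ₀..τ₁, g τ ≤ D := by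
    rw [← intervalIntegral.integral_congr (f := L2ab a b (Box5 v))]
    · exact hD
    · intro τ hτ
      rw [Set.uIcc_of_le h01] at hτ
      exact hgL τ hτ
  have hDτ : ∀ τ ∈ Set.Icc τ₀ τ₁, ∫ s in τ₀..τ, g s ≤ D := by
    intro τ hτ
    refine le_trans ?_ hDg
    exact intervalIntegral.integral_mono_interval le_rfl hτ.1 hτ.2
      (Filter.Eventually.of_forall hg0) (hgc.intervalIntegrable _ _)
  have hD0 : 0 ≤ D := le_trans (intervalIntegral.integral_nonneg h01 fun _ _ => hg0 _) hDg
  have hcs : ∀ s, boxInt R a b (fun z => χ z * (pd 0 v z * Box5 v z)) s ≤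
      Real.sqrt (2 * K * E s) * g s := by
    intro s
    have h1 := boxInt_mul_le R a b s (f := fun z => χ z * pd 0 v z)
      (hχs.continuous.mul (hv.smooth.pd 0).continuous) hv.smooth.Box5.continuous
    simp only [mul_assoc] at h1
    refine h1.trans (mul_le_mul_of_nonneg_right (Real.sqrt_le_sqrt ?_) (hg0 s))
    have h2 : boxInt R a b (fun z => (χ z * pd 0 v z)^2) s ≤
        boxInt R a b (fun z => 2 * K * (χ z * ed v z)) s := by
      refine boxInt_mono R a b s ((hχs.continuous.mul (hv.smooth.pd 0).continuous).pow 2)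
        (continuous_const.mul (hχs.continuous.mul hv.smooth.ed.continuous)) fun z => ?_
      have hk : χ z ≤ K := hFK _
      have : (pd 0 v z)^2 ≤ 2 * ed v z := by
        unfold ed
        nlinarith [sq_nonneg (pd 1 v z), sq_nonneg (pd 2 v z), sq_nonneg (pd 3 v z), sq_nonneg (pd 4 v z)]
      calc (χ z * pd 0 v z)^2 = χ z * χ z * (pd 0 v z)^2 := by ring
        _ ≤ χ z * K * (2 * ed v z) := by
          gcongr
          · exact mul_nonneg (hχ0 z) hK.le
          · exact hχ0 z
        _ = _ := by ring
    refine h2.trans (le_of_eq ?_)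
    simp only [boxInt, integral_const_mul, hE]
  have key : ∀ τ ∈ Set.Icc τ₀ τ₁, E τ + (∫ s in τ₀..τ, boxInt R a b q s) ≤
      E τ₀ + ∫ s in τ₀..τ, Real.sqrt (2 * K * E s) * g s := by
    intro τ hτ
    have hid := energy_identity hχs hv.smooth (pd_four_wt hF hδ σ p) hab.le
      ((h0.trans h01).trans hR) hτ.1
      (fun z hz0 hz4 hface => by
        rw [hv.pd_far_face hab hB h0 hR z ⟨hz0.1, hz0.2.trans hτ.2⟩ hz4 hface, mul_zero])
      (fun z hz => by rw [hv.dirichlet.pd hv.smooth (by decide) z hz, zero_mul])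
    have hq' : Continuous (boxInt R a b q) := continuous_boxInt R a b hqc
    have hs' : Continuous fun s => Real.sqrt (2 * K * E s) * g s :=
      ((continuous_const.mul hEc).sqrt).mul hgc
    have hle : (∫ s in τ₀..τ, boxInt R a b (currentDiv χ v) s) ≤
        ∫ s in τ₀..τ, (Real.sqrt (2 * K * E s) * g s - boxInt R a b q s) := by
      refine intervalIntegral.integral_mono_on hτ.1
        ((continuous_boxInt R a b (smooth5_currentDiv hχs hv.smooth).continuous).intervalIntegrable _ _)
        ((hs'.sub hq').intervalIntegrable _ _) fun s _ => ?_
      have hcb : Continuous fun z => χ z * (pd 0 v z * Box5 v z) :=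
        hχs.continuous.mul ((hv.smooth.pd 0).continuous.mul hv.smooth.Box5.continuous)
      have h1 : boxInt R a b (currentDiv χ v) s ≤
          boxInt R a b (fun z => χ z * (pd 0 v z * Box5 v z) - q z) s :=
        boxInt_mono R a b s (smooth5_currentDiv hχs hv.smooth).continuous (hcb.sub hqc) fun z => by
          have := currentDiv_wt_le hF hF' hδ hσ p v z
          simp only [hq]
          linarith
      have h2 : boxInt R a b (fun z => χ z * (pd 0 v z * Box5 v z) - q z) s =
          boxInt R a b (fun z => χ z * (pd 0 v z * Box5 v z)) s - boxInt R a b q s :=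
        integral_sub (integrableOn_box4 R a b s hcb) (integrableOn_box4 R a b s hqc)
      linarith [hcs s]
    rw [intervalIntegral.integral_sub (hs'.intervalIntegrable _ _) (hq'.intervalIntegrable _ _)] at hle
    change E τ - E τ₀ = ∫ s in τ₀..τ, boxInt R a b (currentDiv χ v) s at hid
    linarith
  obtain ⟨τm, hτm, hmax⟩ := isCompact_Icc.exists_isMaxOn (Set.nonempty_Icc.2 h01) hEc.continuousOn
  set M := E τm with hM
  have hx2 : Real.sqrt (2 * K * M) ^ 2 = 2 * K * M := Real.sq_sqrt (by have := hE0 τm; positivity)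
  have hamgm : Real.sqrt (2 * K * M) * D ≤ M / 2 + K * D^2 := by
    have : 0 ≤ 4 * K * (M / 2 + K * D^2 - Real.sqrt (2 * K * M) * D) := by
      nlinarith [sq_nonneg (Real.sqrt (2 * K * M) - 2 * K * D)]
    have := nonneg_of_mul_nonneg_right this (by positivity)
    linarith
  have hInt : ∀ τ ∈ Set.Icc τ₀ τ₁, (∫ s in τ₀..τ, Real.sqrt (2 * K * E s) * g s) ≤
      M / 2 + K * D^2 := by
    intro τ hτ
    refine le_trans ?_ hamgm
    calc (∫ s in τ₀..τ, Real.sqrt (2 * K * E s) * g s) ≤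
        ∫ s in τ₀..τ, Real.sqrt (2 * K * M) * g s := by
          refine intervalIntegral.integral_mono_on hτ.1
            ((((continuous_const.mul hEc).sqrt).mul hgc).intervalIntegrable _ _)
            ((continuous_const.mul hgc).intervalIntegrable _ _) fun s hs => ?_
          have hm : E s ≤ M := hmax ⟨hs.1, hs.2.trans hτ.2⟩
          have := hg0 s
          gcongr
      _ = Real.sqrt (2 * K * M) * ∫ s in τ₀..τ, g s := intervalIntegral.integral_const_mul _ _
      _ ≤ _ := mul_le_mul_of_nonneg_left (hDτ τ hτ) (Real.sqrt_nonneg _)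
  have hMle : M ≤ 2 * E τ₀ + 2 * K * D^2 := by
    have h1 := key τm hτm
    have h2 := hInt τm hτm
    have h3 : 0 ≤ ∫ s in τ₀..τm, boxInt R a b q s :=
      intervalIntegral.integral_nonneg hτm.1 fun s _ => boxInt_nonneg R a b s hq0
    linarith
  intro τ hτ
  have h1 := key τ hτ
  have h2 := hInt τ hτ
  linarith

/-- The inhomogeneous term of the equation for `v` is controlled by `D` up to time `t`. -/
structure Ctl (a b B t D : ℝ) (v : (Fin 5 → ℝ) → ℝ) : Prop where
  good : Good a b B v
  int_le : ∫ τ in (2*B)..t, L2ab a b (Box5 v) τ ≤ D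
  mul_le : ∀ τ ∈ Set.Icc (2*B) t, t / 2 ≤ τ → t * L2ab a b (Box5 v) τ ≤ D

theorem lintegral_box4_ofReal (R a b τ : ℝ) {f : (Fin 5 → ℝ) → ℝ} (hf : Continuous f)
    (h0 : ∀ z, 0 ≤ f z) :
    ∫⁻ Y in box4 R a b, ENNReal.ofReal (f (cs τ Y)) = ENNReal.ofReal (boxInt R a b f τ) :=
  (ofReal_integral_eq_lintegral_ofReal (integrableOn_box4 R a b τ hf)
    (Filter.Eventually.of_forall fun _ => h0 _)).symm

theorem Good.ed_early {a b B : ℝ} (hab : a < b) (hB : 0 < B) {v : (Fin 5 → ℝ) → ℝ}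
    (hv : Good a b B v) (R : ℝ) (χ : (Fin 5 → ℝ) → ℝ) :
    boxInt R a b (fun z => χ z * ed v z) (2*B) = 0 := by
  refine setIntegral_eq_zero_of_forall_eq_zero fun Y hY => ?_
  have : ∀ i, pd i v (cs (2*B) Y) = 0 := fun i =>
    (hv.vanish.pd hab hB hv.smooth i).early _ (mem_box4.1 hY).2.2.2
      (by change 0 ≤ 2*B; linarith) (le_refl (2*B))
  simp [ed, this]

theorem Good.continuousOn_L2ab_Box5 {a b B : ℝ} (hab : a < b) (hB : 0 < B)
    {v : (Fin 5 → ℝ) → ℝ} (hv : Good a b B v) (t : ℝ) :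
    ContinuousOn (L2ab a b (Box5 v)) (Set.Icc (2*B) t) := by
  have hgc : Continuous fun τ => Real.sqrt (boxInt t a b (fun z => Box5 v z ^ 2) τ) :=
    (continuous_boxInt t a b (hv.smooth.Box5.continuous.pow 2)).sqrt
  refine hgc.continuousOn.congr fun τ hτ => ?_
  exact L2ab_eq_boxInt hB hv.smooth.Box5.continuous (hv.vanish.Box5 hab hB hv.smooth)
    (by linarith [hτ.1]) hτ.2

theorem Ctl.int_le_of_le {a b B t D : ℝ} (hab : a < b) (hB : 0 < B) {v : (Fin 5 → ℝ) → ℝ}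
    (hv : Ctl a b B t D v) {τ : ℝ} (hτ : τ ∈ Set.Icc (2*B) t) :
    ∫ s in (2*B)..τ, L2ab a b (Box5 v) s ≤ D := by
  refine le_trans ?_ hv.int_le
  refine intervalIntegral.integral_mono_interval le_rfl hτ.1 hτ.2
    (Filter.Eventually.of_forall fun _ => L2ab_nonneg _ _ _ _) ?_
  refine ContinuousOn.intervalIntegrable ?_
  rw [Set.uIcc_of_le (hτ.1.trans hτ.2)]
  exact hv.good.continuousOn_L2ab_Box5 hab hB t

theorem Ctl.nonneg {a b B t D : ℝ} {v : (Fin 5 → ℝ) → ℝ} (ht : 2 * B ≤ t)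
    (hv : Ctl a b B t D v) : 0 ≤ D :=
  (intervalIntegral.integral_nonneg ht fun _ _ => L2ab_nonneg _ _ _ _).trans hv.int_le

theorem Ctl.flat_energy {a b B t D : ℝ} (hab : a < b) (hB : 0 < B) {v : (Fin 5 → ℝ) → ℝ}
    (hv : Ctl a b B t D v) {τ : ℝ} (hτ : τ ∈ Set.Icc (2*B) t) :
    boxInt t a b (ed v) τ ≤ 2 * D^2 := by
  have h := hv.good.energy_bound hab hB (F := fun _ => 1) (K := 1) contDiff_const
    (by simp) (by simp) (by simp) one_pos (δ := 1) one_pos (σ := 1) (by norm_num) 0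
    (by linarith : 0 ≤ 2 * B) hτ.1 hτ.2 (hv.int_le_of_le hab hB hτ) τ ⟨hτ.1, le_rfl⟩
  rw [hv.good.ed_early hab hB] at h
  simp [wt, boxInt] at h
  simpa [boxInt] using h

/-- The decreasing profile used across hyperboloids. -/
def arcProfile (s : ℝ) : ℝ := Real.pi / 2 - Real.arctan s

theorem deriv_arcProfile (s : ℝ) : deriv arcProfile s = -(1 / (1 + s^2)) := by
  have := (Real.hasDerivAt_arctan s).const_sub (Real.pi / 2)
  exact this.deriv

theorem Ctl.hyperboloid_energy {a b B t D : ℝ} (hab : a < b) (hB : 0 < B) (ht : 2 * B ≤ t)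
    {v : (Fin 5 → ℝ) → ℝ} (hv : Ctl a b B t D v) {δ : ℝ} (hδ : 0 < δ) :
    ∫⁻ τ in Set.Icc (2*B) t, ∫⁻ Y in box4 t a b,
      ENNReal.ofReal (1 / (1 + (τ - hyp δ 0 (cs τ Y))^2) * (pd 4 v (cs τ Y))^2) ≤
      ENNReal.ofReal (16 * D^2) := by
  have hF : ContDiff ℝ ((⊤ : ℕ∞) : WithTop ℕ∞) arcProfile :=
    contDiff_const.sub Real.contDiff_arctan
  have h := hv.good.energy_bound hab hB (F := arcProfile) (K := Real.pi) hF
    (by intro s; rw [deriv_arcProfile]; have : 0 ≤ 1 / (1 + s^2) := by positivity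
        linarith)
    (by intro s; have := Real.arctan_lt_pi_div_two s; unfold arcProfile; linarith)
    (by intro s; have := Real.neg_pi_div_two_lt_arctan s; unfold arcProfile; linarith) Real.pi_pos
    hδ (σ := -1) (by norm_num) 0 (by linarith : 0 ≤ 2 * B) ht le_rfl hv.int_le t ⟨ht, le_rfl⟩
  rw [hv.good.ed_early hab hB] at h
  have hpos : 0 ≤ boxInt t a b (fun z => wt arcProfile (-1) δ 0 z * ed v z) t := by
    refine boxInt_nonneg _ _ _ _ fun z => mul_nonneg ?_ (ed_nonneg _ _)
    have := Real.arctan_lt_pi_div_two (z 0 + (-1) * hyp δ 0 z)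
    simp only [wt, arcProfile]; linarith
  set q : (Fin 5 → ℝ) → ℝ := fun z => 1 / (1 + (z 0 - hyp δ 0 z)^2) * (pd 4 v z)^2 with hq
  have hqe : (fun z => (-deriv arcProfile (z 0 + -1 * hyp δ 0 z) / 2) * (pd 4 v z)^2) =
      fun z => (1/2) * q z := by
    funext z
    rw [deriv_arcProfile, hq]
    have : z 0 + -1 * hyp δ 0 z = z 0 - hyp δ 0 z := by ring
    rw [this]; ring
  have hqc : Continuous q := by
    refine Continuous.mul (continuous_const.div ?_ fun z => by positivity)
      ((hv.good.smooth.pd 4).continuous.pow 2)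
    exact continuous_const.add (((continuous_apply 0).sub (smooth5_hyp hδ 0).continuous).pow 2)
  have hq0 : ∀ z, 0 ≤ q z := fun z => by simp only [hq]; positivity
  have hb : ∀ s, boxInt t a b (fun z => (1/2) * q z) s = (1/2) * boxInt t a b q s := fun s => by
    simp only [boxInt, integral_const_mul]
  rw [hqe] at h
  simp only [hb, intervalIntegral.integral_const_mul] at h
  have hmain : ∫ s in (2*B)..t, boxInt t a b q s ≤ 16 * D^2 := by
    have hpi := Real.pi_le_four
    have hD2 := sq_nonneg D
    nlinarith
  have e1 : ∀ τ, ∫⁻ Y in box4 t a b,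
      ENNReal.ofReal (1 / (1 + (τ - hyp δ 0 (cs τ Y))^2) * (pd 4 v (cs τ Y))^2) =
      ENNReal.ofReal (boxInt t a b q τ) := fun τ => lintegral_box4_ofReal t a b τ hqc hq0
  simp only [e1]
  rw [← ofReal_integral_eq_lintegral_ofReal]
  · refine ENNReal.ofReal_le_ofReal ?_
    rw [integral_Icc_eq_integral_Ioc, ← intervalIntegral.integral_of_le ht]
    exact hmain
  · exact (continuous_boxInt t a b hqc).continuousOn.integrableOn_compact isCompact_Icc
  · exact Filter.Eventually.of_forall fun _ => boxInt_nonneg _ _ _ _ hq0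

theorem Ctl.local_energy {a b B t D : ℝ} (hab : a < b) (hB : 0 < B)
    {v : (Fin 5 → ℝ) → ℝ} (hv : Ctl a b B t D v) {l : ℝ} (hl : 0 < l) (hlt : 2 * B ≤ t - l)
    (hlt' : t / 2 ≤ t - l) (p : Fin 3 → ℝ) :
    boxInt t a b (fun z => Real.smoothTransition ((4 * l - (z 0 - t + hyp l p z)) / l) * ed v z) t ≤
      2 * boxInt t a b
        (fun z => Real.smoothTransition ((4 * l - (z 0 - t + hyp l p z)) / l) * ed v z) (t - l) +
      2 * (l * (D / t))^2 := by
  have ht : 0 < t := by linarith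
  have hcont := hv.good.continuousOn_L2ab_Box5 hab hB t
  have hInt : ∫ τ in (t - l)..t, L2ab a b (Box5 v) τ ≤ l * (D / t) := by
    calc ∫ τ in (t - l)..t, L2ab a b (Box5 v) τ ≤ ∫ τ in (t - l)..t, D / t := by
          refine intervalIntegral.integral_mono_on (by linarith) ?_ (by simp) fun τ hτ => ?_
          · refine ContinuousOn.intervalIntegrable ?_
            rw [Set.uIcc_of_le (by linarith)]
            exact hcont.mono (Set.Icc_subset_Icc_left hlt)
          · rw [le_div_iff₀ ht, mul_comm]
            exact hv.mul_le τ ⟨hlt.trans hτ.1, hτ.2⟩ (hlt'.trans hτ.1)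
      _ = l * (D / t) := by rw [intervalIntegral.integral_const, smul_eq_mul]; ring
  obtain ⟨hF, hF'⟩ := smoothTransition_rev (c := 4 + t / l) (k := 1 / l) (by positivity)
  have h := hv.good.energy_bound hab hB hF hF' (K := 1) (fun _ => Real.smoothTransition.nonneg _)
    (fun _ => Real.smoothTransition.le_one _) one_pos hl (σ := 1) (by norm_num) p
    (by linarith : 0 ≤ t - l) (by linarith : t - l ≤ t) le_rfl hInt t ⟨by linarith, le_rfl⟩
  have e : (fun z => wt (fun s => Real.smoothTransition (4 + t / l - 1 / l * s)) 1 l p z * ed v z) =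
      fun z => Real.smoothTransition ((4 * l - (z 0 - t + hyp l p z)) / l) * ed v z := by
    funext z
    have harg : 4 + t / l - 1 / l * (z 0 + 1 * hyp l p z) =
        (4 * l - (z 0 - t + hyp l p z)) / l := by
      field_simp
      ring
    simp only [wt, harg]
  rw [e] at h
  have hnn : 0 ≤ ∫ s in (t - l)..t, boxInt t a b (fun z => (-deriv (fun s =>
      Real.smoothTransition (4 + t / l - 1 / l * s)) (z 0 + 1 * hyp l p z) / 2) * (pd 4 v z)^2) s := by
    refine intervalIntegral.integral_nonneg (by linarith) fun s _ => boxInt_nonneg _ _ _ _ fun z => ?_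
    have := hF' (z 0 + 1 * hyp l p z)
    exact mul_nonneg (by linarith) (sq_nonneg _)
  linarith

/-- Sum of the squares of all tangential derivatives of order at most `n`. -/
def Phi : ℕ → ((Fin 5 → ℝ) → ℝ) → (Fin 5 → ℝ) → ℝ
  | 0, f => fun z => f z ^ 2
  | n + 1, f => fun z => Phi n f z + ∑ i : Fin 10, Phi n (G5 i.castSucc f) z

theorem Phi_nonneg (n : ℕ) (f : (Fin 5 → ℝ) → ℝ) (z : Fin 5 → ℝ) : 0 ≤ Phi n f z := by
  induction n generalizing f with
  | zero => exact sq_nonneg _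
  | succ n ih => exact add_nonneg (ih f) (Finset.sum_nonneg fun i _ => ih _)

theorem continuous_Phi (n : ℕ) {f : (Fin 5 → ℝ) → ℝ} (hf : Smooth5 f) : Continuous (Phi n f) := by
  induction n generalizing f with
  | zero => exact hf.continuous.pow 2
  | succ n ih => exact (ih hf).add (continuous_finsetSum _ fun i _ => ih (hf.G5 _))

/-- Iterated tangential derivatives. -/
abbrev tang (w : List (Fin 10)) (f : (Fin 5 → ℝ) → ℝ) : (Fin 5 → ℝ) → ℝ :=
  opIter G5 (w.map Fin.castSucc) f

theorem opIter_append {α γ : Type*} (F : α → γ → γ) (L L' : List α) (u : γ) :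
    opIter F (L ++ L') u = opIter F L (opIter F L' u) := by
  induction L with
  | nil => rfl
  | cons i L ih => simp only [List.cons_append, opIter, ih]

theorem tang_G5 (w : List (Fin 10)) (i : Fin 10) (f : (Fin 5 → ℝ) → ℝ) :
    tang w (G5 i.castSucc f) = tang (w ++ [i]) f := by
  simp only [tang, List.map_append, opIter_append]
  rfl

theorem lintegral_Phi_le {α : Type*} [MeasurableSpace α] {μ : Measure α} {ω : α → ENNReal}
    (hω : Measurable ω) {γ : α → Fin 5 → ℝ} (hγ : Measurable γ) (n : ℕ) {c : ENNReal}
    {f : (Fin 5 → ℝ) → ℝ} (hf : Smooth5 f)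
    (h : ∀ w : List (Fin 10), w.length ≤ n →
      ∫⁻ p, ω p * ENNReal.ofReal ((tang w f (γ p))^2) ∂μ ≤ c) :
    ∫⁻ p, ω p * ENNReal.ofReal (Phi n f (γ p)) ∂μ ≤ 11 ^ n * c := by
  induction n generalizing f with
  | zero =>
    have := h [] le_rfl
    simp only [pow_zero, one_mul]
    exact this
  | succ n ih =>
    have hm : ∀ g, Smooth5 g → Measurable fun p => ω p * ENNReal.ofReal (Phi n g (γ p)) :=
      fun g hg => hω.mul (((continuous_Phi n hg).measurable.comp hγ).ennreal_ofReal)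
    have e : ∀ p, ω p * ENNReal.ofReal (Phi (n+1) f (γ p)) =
        ω p * ENNReal.ofReal (Phi n f (γ p)) +
          ∑ i : Fin 10, ω p * ENNReal.ofReal (Phi n (G5 i.castSucc f) (γ p)) := by
      intro p
      rw [Phi, ENNReal.ofReal_add (Phi_nonneg _ _ _) (Finset.sum_nonneg fun i _ => Phi_nonneg _ _ _),
        ENNReal.ofReal_sum_of_nonneg fun i _ => Phi_nonneg _ _ _, mul_add, Finset.mul_sum]
    simp only [e]
    rw [lintegral_add_left (hm f hf), lintegral_finsetSum _ fun i _ => hm _ (hf.G5 _)]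
    have h1 := ih hf fun w hw => h w (hw.trans (Nat.le_succ n))
    have h2 : ∀ i : Fin 10, ∫⁻ p, ω p * ENNReal.ofReal (Phi n (G5 i.castSucc f) (γ p)) ∂μ ≤
        11 ^ n * c := fun i => ih (hf.G5 _) fun w hw => by
      rw [tang_G5]
      exact h _ (by simpa using hw)
    calc _ ≤ 11 ^ n * c + ∑ i : Fin 10, 11 ^ n * c := add_le_add h1 (Finset.sum_le_sum fun i _ => h2 i)
      _ = 11 ^ (n+1) * c := by
        rw [Finset.sum_const, Finset.card_univ, Fintype.card_fin, nsmul_eq_mul]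
        push_cast
        ring

theorem sq_le_integral_sq_add {g g' : ℝ → ℝ} (hg : ∀ s, HasDerivAt g (g' s) s)
    (hg' : Continuous g') {l : ℝ} (hl : 0 < l) :
    g 0 ^ 2 ≤ (2 / l) * ∫ s in (0:ℝ)..l, (g s ^ 2 + l^2 * g' s ^ 2) := by
  have hgc : Continuous g := continuous_iff_continuousAt.2 fun s => (hg s).continuousAt
  set A := ∫ s in (0:ℝ)..l, (g s ^ 2 + l^2 * g' s ^ 2) with hA
  have hcA : Continuous fun s => g s ^ 2 + l^2 * g' s ^ 2 :=
    (hgc.pow 2).add (continuous_const.mul (hg'.pow 2))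
  have hpt : ∀ s ∈ Set.Icc 0 l, g 0 ^ 2 ≤ g s ^ 2 + A / l := by
    intro s hs
    have hft : ∫ r in (0:ℝ)..s, 2 * g r * g' r = g s ^ 2 - g 0 ^ 2 := by
      refine intervalIntegral.integral_eq_sub_of_hasDerivAt (f := fun r => g r ^ 2)
        (fun r _ => ?_) (((continuous_const.mul hgc).mul hg').intervalIntegrable _ _)
      have e : HasDerivAt (fun r => g r ^ 2) _ r := (hg r).pow 2
      refine e.congr_deriv ?_
      norm_num
    have h1 : -(∫ r in (0:ℝ)..s, 2 * g r * g' r) ≤ A / l := by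
      rw [← intervalIntegral.integral_neg]
      calc ∫ r in (0:ℝ)..s, -(2 * g r * g' r) ≤ ∫ r in (0:ℝ)..s, (1/l) * (g r ^ 2 + l^2 * g' r ^ 2) := by
            refine intervalIntegral.integral_mono_on hs.1
              ((((continuous_const.mul hgc).mul hg').neg).intervalIntegrable _ _)
              ((continuous_const.mul hcA).intervalIntegrable _ _) fun r _ => ?_
            rw [one_div, inv_mul_eq_div, le_div_iff₀ hl]
            nlinarith [sq_nonneg (g r + l * g' r)]
        _ ≤ ∫ r in (0:ℝ)..l, (1/l) * (g r ^ 2 + l^2 * g' r ^ 2) := by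
            refine intervalIntegral.integral_mono_interval le_rfl hs.1 hs.2
              (Filter.Eventually.of_forall fun r => ?_) ((continuous_const.mul hcA).intervalIntegrable _ _)
            show 0 ≤ (1/l) * (g r ^ 2 + l^2 * g' r ^ 2)
            positivity
        _ = A / l := by rw [intervalIntegral.integral_const_mul]; ring
    linarith
  have hInt : ∫ _ in (0:ℝ)..l, g 0 ^ 2 ≤ ∫ s in (0:ℝ)..l, (g s ^ 2 + A / l) :=
    intervalIntegral.integral_mono_on hl.le (by simp)
      (((hgc.pow 2).add continuous_const).intervalIntegrable _ _) hpt
  have hint2 : ∫ s in (0:ℝ)..l, g s ^ 2 ≤ A :=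
    intervalIntegral.integral_mono_on hl.le ((hgc.pow 2).intervalIntegrable _ _)
      (hcA.intervalIntegrable _ _) fun s _ => by nlinarith [sq_nonneg (l * g' s)]
  rw [intervalIntegral.integral_add (f := fun s => g s ^ 2) ((hgc.pow 2).intervalIntegrable _ _) (by simp)] at hInt
  simp only [intervalIntegral.integral_const, smul_eq_mul, sub_zero] at hInt
  have : l * (A / l) = A := by field_simp
  rw [this] at hInt
  rw [div_mul_eq_mul_div, le_div_iff₀ hl]
  linarith

theorem Phi_le_integral_curve {l K : ℝ} (hl : 0 < l) (hK : 1 ≤ K) {γ : ℝ → Fin 5 → ℝ}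
    (hγ : ContDiff ℝ ((⊤ : ℕ∞) : WithTop ℕ∞) γ)
    (h : ∀ f, Smooth5 f → ∀ s ∈ Set.Icc 0 l, l^2 * (deriv (fun s => f (γ s)) s)^2 ≤
      K * ∑ i : Fin 10, (G5 i.castSucc f (γ s))^2) (n : ℕ) {f : (Fin 5 → ℝ) → ℝ} (hf : Smooth5 f) :
    Phi n f (γ 0) ≤ (2 * K / l) * ∫ s in (0:ℝ)..l, Phi (n+1) f (γ s) := by
  induction n generalizing f with
  | zero =>
    have hc : ContDiff ℝ ((⊤ : ℕ∞) : WithTop ℕ∞) fun s => f (γ s) := ContDiff.comp hf hγ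
    have h1 := sq_le_integral_sq_add (g := fun s => f (γ s)) (g' := deriv fun s => f (γ s))
      (fun s => (hc.differentiable (by simp) s).hasDerivAt) (hc.continuous_deriv (by simp)) hl
    refine h1.trans ?_
    rw [show 2 * K / l * ∫ s in (0:ℝ)..l, Phi (0+1) f (γ s) =
      2 / l * ∫ s in (0:ℝ)..l, K * Phi (0+1) f (γ s) by
        rw [intervalIntegral.integral_const_mul]; ring]
    refine mul_le_mul_of_nonneg_left ?_ (by positivity)
    refine intervalIntegral.integral_mono_on hl.le ?_ ?_ fun s hs => ?_
    · exact ((hc.continuous.pow 2).add (continuous_const.mul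
        ((hc.continuous_deriv (by simp)).pow 2))).intervalIntegrable _ _
    · exact (continuous_const.mul ((continuous_Phi _ hf).comp hγ.continuous)).intervalIntegrable _ _
    · have := h f hf s hs
      simp only [Phi]
      nlinarith [sq_nonneg (f (γ s))]
  | succ n ih =>
    have hc : ∀ g, Smooth5 g → IntervalIntegrable (fun s => Phi (n+1) g (γ s)) volume 0 l :=
      fun g hg => ((continuous_Phi _ hg).comp hγ.continuous).intervalIntegrable _ _
    have e : ∀ s, Phi (n+1+1) f (γ s) = Phi (n+1) f (γ s) +
        ∑ i : Fin 10, Phi (n+1) (G5 i.castSucc f) (γ s) := fun s => rfl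
    simp only [e]
    have hs : IntervalIntegrable (fun s => ∑ i : Fin 10, Phi (n+1) (G5 i.castSucc f) (γ s))
        volume 0 l := (continuous_finsetSum _ fun i _ =>
      (continuous_Phi _ (hf.G5 _)).comp hγ.continuous).intervalIntegrable _ _
    rw [intervalIntegral.integral_add (hc f hf) hs,
      intervalIntegral.integral_finsetSum fun i _ => hc _ (hf.G5 _), mul_add, Finset.mul_sum]
    exact add_le_add (ih hf) (Finset.sum_le_sum fun i _ => ih (hf.G5 _))

theorem ofReal_Phi_le_lintegral_curve {l K : ℝ} (hl : 0 < l) (hK : 1 ≤ K) {γ : ℝ → Fin 5 → ℝ}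
    (hγ : ContDiff ℝ ((⊤ : ℕ∞) : WithTop ℕ∞) γ)
    (h : ∀ f, Smooth5 f → ∀ s ∈ Set.Icc 0 l, l^2 * (deriv (fun s => f (γ s)) s)^2 ≤
      K * ∑ i : Fin 10, (G5 i.castSucc f (γ s))^2) (n : ℕ) {f : (Fin 5 → ℝ) → ℝ} (hf : Smooth5 f) :
    ENNReal.ofReal (Phi n f (γ 0)) ≤
      ENNReal.ofReal (2 * K / l) * ∫⁻ s in Set.Icc 0 l, ENNReal.ofReal (Phi (n+1) f (γ s)) := by
  have hc : Continuous fun s => Phi (n+1) f (γ s) := (continuous_Phi _ hf).comp hγ.continuous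
  rw [← ofReal_integral_eq_lintegral_ofReal (hc.continuousOn.integrableOn_compact isCompact_Icc)
    (Filter.Eventually.of_forall fun s => Phi_nonneg _ _ _),
    ← ENNReal.ofReal_mul (by positivity), integral_Icc_eq_integral_Ioc,
    ← intervalIntegral.integral_of_le hl.le]
  exact ENNReal.ofReal_le_ofReal (Phi_le_integral_curve hl hK hγ h n hf)

theorem lintegral_Icc_cons {n : ℕ} (l : ℝ) {F : (Fin (n+1) → ℝ) → ENNReal} (hF : Measurable F) :
    ∫⁻ ξ in Set.Icc (0 : Fin (n+1) → ℝ) (fun _ => l), F ξ =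
      ∫⁻ s in Set.Icc 0 l, ∫⁻ η in Set.Icc (0 : Fin n → ℝ) (fun _ => l), F (Fin.cons s η) := by
  have e := (volume_preserving_piFinSuccAbove (fun _ : Fin (n+1) => ℝ) 0).symm
  have happ : ∀ p : ℝ × (Fin n → ℝ),
      (MeasurableEquiv.piFinSuccAbove (fun _ : Fin (n+1) => ℝ) 0).symm p = Fin.cons p.1 p.2 := by
    intro p
    simp [MeasurableEquiv.piFinSuccAbove_symm_apply, Fin.insertNthEquiv]
  have hpre : (MeasurableEquiv.piFinSuccAbove (fun _ : Fin (n+1) => ℝ) 0).symm ⁻¹'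
      Set.Icc (0 : Fin (n+1) → ℝ) (fun _ => l) =
      Set.Icc 0 l ×ˢ Set.Icc (0 : Fin n → ℝ) (fun _ => l) := by
    ext p
    rw [Set.mem_preimage, happ]
    simp only [Set.mem_Icc, Set.mem_prod, Pi.le_def, Fin.forall_fin_succ]
    simp
    tauto
  rw [← e.setLIntegral_comp_preimage_emb (MeasurableEquiv.measurableEmbedding _), hpre]
  simp only [happ]
  rw [Measure.volume_eq_prod, setLIntegral_prod]
  have hm := hF.comp (MeasurableEquiv.piFinSuccAbove (fun _ : Fin (n+1) => ℝ) 0).symm.measurable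
  simp only [Function.comp_def, happ] at hm
  exact hm.aemeasurable

/-- A parametrised cube along which derivatives are controlled by tangential fields. -/
def TangCube {n : ℕ} (K l : ℝ) (γ : (Fin n → ℝ) → Fin 5 → ℝ) : Prop :=
  ∀ f, Smooth5 f → ∀ ξ ∈ Set.Icc (0 : Fin n → ℝ) (fun _ => l), ∀ j,
    l^2 * (pd j (fun ξ => f (γ ξ)) ξ)^2 ≤ K * ∑ i : Fin 10, (G5 i.castSucc f (γ ξ))^2

theorem contDiff_cons {n : ℕ} : ContDiff ℝ ((⊤ : ℕ∞) : WithTop ℕ∞)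
    fun p : ℝ × (Fin n → ℝ) => (Fin.cons p.1 p.2 : Fin (n+1) → ℝ) := by
  rw [contDiff_pi]
  intro i
  refine Fin.cases ?_ (fun j => ?_) i
  · simpa using contDiff_fst
  · simp only [Fin.cons_succ]
    exact (contDiff_apply ℝ ℝ j).comp contDiff_snd

theorem pd_comp_cons {n : ℕ} {F : (Fin (n+1) → ℝ) → ℝ} (hF : Differentiable ℝ F) (s : ℝ)
    (η : Fin n → ℝ) (j : Fin n) :
    pd j (fun η => F (Fin.cons s η)) η = pd j.succ F (Fin.cons s η) := by
  have hc : Differentiable ℝ fun η : Fin n → ℝ => (Fin.cons s η : Fin (n+1) → ℝ) :=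
    ((contDiff_cons (n := n)).comp (contDiff_const.prodMk contDiff_id)).differentiable (by simp)
  unfold pd
  rw [← (hF (Fin.cons s η)).lineDeriv_eq_fderiv,
    ← DifferentiableAt.lineDeriv_eq_fderiv (f := fun η => F (Fin.cons s η))
      ((hF.comp hc) η)]
  unfold lineDeriv
  congr 1
  funext r
  refine congrArg F (funext fun i => ?_)
  refine Fin.cases ?_ (fun k => ?_) i
  · simp
  · simp [Pi.single_apply]

theorem deriv_comp_cons_zero {n : ℕ} {F : (Fin (n+1) → ℝ) → ℝ} (hF : Differentiable ℝ F) (s : ℝ)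
    (η : Fin n → ℝ) : deriv (fun s => F (Fin.cons s η)) s = pd 0 F (Fin.cons s η) := by
  unfold pd
  have h1 : HasDerivAt (fun s : ℝ => (Fin.cons s η : Fin (n+1) → ℝ)) (Pi.single 0 1) s := by
    rw [hasDerivAt_pi]
    intro i
    refine Fin.cases ?_ (fun k => ?_) i
    · simp only [Fin.cons_zero, Pi.single_eq_same]
      exact hasDerivAt_id s
    · simpa using hasDerivAt_const s (η k)
  exact ((hF _).hasFDerivAt.comp_hasDerivAt s h1).deriv

theorem ofReal_Phi_le_lintegral_cube {l K : ℝ} (hl : 0 < l) (hK : 1 ≤ K) {n : ℕ}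
    {γ : (Fin n → ℝ) → Fin 5 → ℝ} (hγ : ContDiff ℝ ((⊤ : ℕ∞) : WithTop ℕ∞) γ)
    (h : TangCube K l γ) (m : ℕ) {f : (Fin 5 → ℝ) → ℝ} (hf : Smooth5 f) :
    ENNReal.ofReal (Phi m f (γ 0)) ≤ ENNReal.ofReal (2 * K / l) ^ n *
      ∫⁻ ξ in Set.Icc (0 : Fin n → ℝ) (fun _ => l), ENNReal.ofReal (Phi (m+n) f (γ ξ)) := by
  induction n generalizing m with
  | zero =>
    have : Set.Icc (0 : Fin 0 → ℝ) (fun _ => l) = Set.univ := by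
      ext x; simp
    rw [this, Measure.restrict_univ, volume_pi, Measure.pi_of_empty _ 0, lintegral_dirac]
    simp
  | succ n ih =>
    have hsm : ∀ g, Smooth5 g → Differentiable ℝ fun ξ => g (γ ξ) := fun g hg =>
      (ContDiff.comp hg hγ).differentiable (by simp)
    have hcons : ContDiff ℝ ((⊤ : ℕ∞) : WithTop ℕ∞) fun s : ℝ => γ (Fin.cons s (0 : Fin n → ℝ)) :=
      hγ.comp ((contDiff_cons (n := n)).comp (contDiff_id.prodMk contDiff_const))
    have h0 : (Fin.cons (0 : ℝ) (0 : Fin n → ℝ) : Fin (n+1) → ℝ) = 0 := by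
      funext i; refine Fin.cases ?_ (fun k => ?_) i <;> simp
    have hmem : ∀ s ∈ Set.Icc 0 l, ∀ η ∈ Set.Icc (0 : Fin n → ℝ) (fun _ => l),
        (Fin.cons s η : Fin (n+1) → ℝ) ∈ Set.Icc (0 : Fin (n+1) → ℝ) (fun _ => l) := by
      intro s hs η hη
      constructor <;> intro i <;> refine Fin.cases ?_ (fun k => ?_) i
      · simpa using hs.1
      · simpa using hη.1 k
      · simpa using hs.2
      · simpa using hη.2 k
    have h1 := ofReal_Phi_le_lintegral_curve hl hK hcons (fun g hg s hs => by
      rw [deriv_comp_cons_zero (F := fun ξ => g (γ ξ)) (hsm g hg) s 0]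
      exact h g hg _ (hmem s hs 0 ⟨le_rfl, fun _ => hl.le⟩) 0) m hf
    simp only [h0] at h1
    have hm : Measurable fun ξ => ENNReal.ofReal (Phi (m + (n+1)) f (γ ξ)) :=
      (((continuous_Phi _ hf).comp hγ.continuous).measurable).ennreal_ofReal
    rw [lintegral_Icc_cons l hm, pow_succ', mul_assoc]
    refine h1.trans (mul_le_mul_right ?_ _)
    rw [← lintegral_const_mul']
    · refine setLIntegral_mono' measurableSet_Icc fun s hs => ?_
      have h2 := ih (γ := fun η => γ (Fin.cons s η))
        (hγ.comp ((contDiff_cons (n := n)).comp (contDiff_const.prodMk contDiff_id)))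
        (fun g hg η hη j => by
          rw [pd_comp_cons (F := fun ξ => g (γ ξ)) (hsm g hg) s η j]
          exact h g hg _ (hmem s hs η hη) j.succ) (m+1)
      rw [show m + (n+1) = m + 1 + n by ring]
      exact h2
    · exact ENNReal.pow_ne_top ENNReal.ofReal_ne_top

theorem pd_comp {n m : ℕ} {f : (Fin m → ℝ) → ℝ} {γ : (Fin n → ℝ) → Fin m → ℝ}
    (hf : Differentiable ℝ f) (hγ : Differentiable ℝ γ) (j : Fin n) (ξ : Fin n → ℝ) :
    pd j (fun ξ => f (γ ξ)) ξ = ∑ i, pd i f (γ ξ) * pd j (fun ξ => γ ξ i) ξ := by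
  have h1 : ∀ i, pd j (fun ξ => γ ξ i) ξ = fderiv ℝ γ ξ (Pi.single j 1) i := by
    intro i
    unfold pd
    exact congrArg (fun A : (Fin n → ℝ) →L[ℝ] ℝ => A (Pi.single j 1))
      ((hasFDerivAt_pi'.1 (hγ ξ).hasFDerivAt) i).fderiv
  have h2 : fderiv ℝ γ ξ (Pi.single j 1) =
      ∑ i, fderiv ℝ γ ξ (Pi.single j 1) i • (Pi.single i (1 : ℝ) : Fin m → ℝ) := by
    funext k
    simp [Finset.sum_apply, Pi.single_apply]
  have h3 : pd j (fun ξ => f (γ ξ)) ξ = fderiv ℝ f (γ ξ) (fderiv ℝ γ ξ (Pi.single j 1)) := by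
    unfold pd
    rw [show (fun ξ => f (γ ξ)) = f ∘ γ from rfl, fderiv_comp ξ (hf _) (hγ _)]
    rfl
  rw [h3, h2, map_sum]
  refine Finset.sum_congr rfl fun i _ => ?_
  rw [map_smul, h1, smul_eq_mul, mul_comm]
  rfl

/-- The affine map `ξ ↦ X₀ + M ξ`. -/
def aff (X₀ : Fin 3 → ℝ) (M : Matrix (Fin 3) (Fin 3) ℝ) (ξ : Fin 3 → ℝ) : Fin 3 → ℝ :=
  X₀ + M.mulVec ξ

theorem aff_apply (X₀ : Fin 3 → ℝ) (M : Matrix (Fin 3) (Fin 3) ℝ) (ξ : Fin 3 → ℝ) (k : Fin 3) :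
    aff X₀ M ξ k = X₀ k + (M k 0 * ξ 0 + M k 1 * ξ 1 + M k 2 * ξ 2) := by
  simp [aff, Matrix.mulVec, dotProduct, Fin.sum_univ_three]

theorem contDiff_aff (X₀ : Fin 3 → ℝ) (M : Matrix (Fin 3) (Fin 3) ℝ) :
    ContDiff ℝ ((⊤ : ℕ∞) : WithTop ℕ∞) (aff X₀ M) := by
  rw [contDiff_pi]
  intro k
  simp only [aff_apply]
  fun_prop

theorem pd_aff (X₀ : Fin 3 → ℝ) (M : Matrix (Fin 3) (Fin 3) ℝ) (j k : Fin 3) (ξ : Fin 3 → ℝ) :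
    pd j (fun ξ => aff X₀ M ξ k) ξ = M k j := by
  unfold pd
  rw [← DifferentiableAt.lineDeriv_eq_fderiv
    (differentiableAt_pi.1 ((contDiff_aff X₀ M).differentiable (by simp) ξ) k)]
  unfold lineDeriv
  have : (fun s : ℝ => aff X₀ M (ξ + s • (Pi.single j (1:ℝ) : Fin 3 → ℝ)) k) =
      fun s => aff X₀ M ξ k + M k j * s := by
    funext s
    simp only [aff, Matrix.mulVec_add, Matrix.mulVec_smul, Pi.add_apply, Pi.smul_apply,
      Matrix.mulVec_single_one, smul_eq_mul, Matrix.col_apply]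
    ring
  rw [this]
  simp

theorem pt5_zero (t : ℝ) (x : Fin 3 → ℝ) (y : ℝ) : pt5 t x y 0 = t := rfl
theorem pt5_one (t : ℝ) (x : Fin 3 → ℝ) (y : ℝ) : pt5 t x y 1 = x 0 := rfl
theorem pt5_two (t : ℝ) (x : Fin 3 → ℝ) (y : ℝ) : pt5 t x y 2 = x 1 := rfl
theorem pt5_three (t : ℝ) (x : Fin 3 → ℝ) (y : ℝ) : pt5 t x y 3 = x 2 := rfl
theorem pt5_four (t : ℝ) (x : Fin 3 → ℝ) (y : ℝ) : pt5 t x y 4 = y := rfl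

theorem contDiff_pt5 {E : Type*} [NormedAddCommGroup E] [NormedSpace ℝ E] {τ : E → ℝ}
    {X : E → Fin 3 → ℝ} {y : E → ℝ} (hτ : ContDiff ℝ ((⊤ : ℕ∞) : WithTop ℕ∞) τ)
    (hX : ContDiff ℝ ((⊤ : ℕ∞) : WithTop ℕ∞) X) (hy : ContDiff ℝ ((⊤ : ℕ∞) : WithTop ℕ∞) y) :
    ContDiff ℝ ((⊤ : ℕ∞) : WithTop ℕ∞) fun p => pt5 (τ p) (X p) (y p) := by
  rw [contDiff_pi] at hX ⊢
  intro i
  fin_cases i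
  · exact hτ
  · exact hX 0
  · exact hX 1
  · exact hX 2
  · exact hy

theorem continuous_pt5 {E : Type*} [TopologicalSpace E] {τ : E → ℝ}
    {X : E → Fin 3 → ℝ} {y : E → ℝ} (hτ : Continuous τ) (hX : Continuous X) (hy : Continuous y) :
    Continuous fun p => pt5 (τ p) (X p) (y p) := by
  rw [continuous_pi_iff] at hX ⊢
  intro i
  fin_cases i
  · exact hτ
  · exact hX 0
  · exact hX 1
  · exact hX 2
  · exact hy

theorem pd_comp_pt5_aff {f : (Fin 5 → ℝ) → ℝ} (hf : Smooth5 f) {τ : (Fin 3 → ℝ) → ℝ}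
    (hτ : ContDiff ℝ ((⊤ : ℕ∞) : WithTop ℕ∞) τ) (X₀ : Fin 3 → ℝ) (M : Matrix (Fin 3) (Fin 3) ℝ)
    (y : ℝ) (j : Fin 3) (ξ : Fin 3 → ℝ) :
    pd j (fun ξ => f (pt5 (τ ξ) (aff X₀ M ξ) y)) ξ =
      pd 0 f (pt5 (τ ξ) (aff X₀ M ξ) y) * pd j τ ξ +
      (pd 1 f (pt5 (τ ξ) (aff X₀ M ξ) y) * M 0 j + pd 2 f (pt5 (τ ξ) (aff X₀ M ξ) y) * M 1 j +
        pd 3 f (pt5 (τ ξ) (aff X₀ M ξ) y) * M 2 j) := by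
  rw [pd_comp hf.differentiable
    ((contDiff_pt5 hτ (contDiff_aff X₀ M) contDiff_const).differentiable (by simp))]
  rw [Fin.sum_univ_five]
  simp only [pt5_zero, pt5_one, pt5_two, pt5_three, pt5_four, pd_aff]
  have : pd j (fun _ : Fin 3 → ℝ => y) ξ = 0 := by simp [pd]
  rw [this]
  ring

/-- The parametrised piece of hyperboloid over the affine image of a cube. -/
def hypCurve (δ : ℝ) (X₀ : Fin 3 → ℝ) (M : Matrix (Fin 3) (Fin 3) ℝ) (y : ℝ) (ξ : Fin 3 → ℝ) :
    Fin 5 → ℝ :=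
  pt5 (hyp δ 0 (pt5 0 (aff X₀ M ξ) 0)) (aff X₀ M ξ) y

theorem contDiff_hyp_aff {δ : ℝ} (hδ : 0 < δ) (X₀ : Fin 3 → ℝ) (M : Matrix (Fin 3) (Fin 3) ℝ) :
    ContDiff ℝ ((⊤ : ℕ∞) : WithTop ℕ∞) fun ξ => hyp δ 0 (pt5 0 (aff X₀ M ξ) 0) :=
  ContDiff.comp (g := hyp δ 0) (smooth5_hyp hδ 0) (contDiff_pt5 contDiff_const (contDiff_aff X₀ M) contDiff_const)

theorem boost_sq_le_sum (f : (Fin 5 → ℝ) → ℝ) (z : Fin 5 → ℝ) :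
    (z 1 * pd 0 f z + z 0 * pd 1 f z)^2 + (z 2 * pd 0 f z + z 0 * pd 2 f z)^2 +
      (z 3 * pd 0 f z + z 0 * pd 3 f z)^2 + (pd 0 f z)^2 + (pd 1 f z)^2 + (pd 2 f z)^2 +
      (pd 3 f z)^2 ≤ ∑ i : Fin 10, (G5 i.castSucc f z)^2 := by
  have h : ∑ i : Fin 10, (G5 i.castSucc f z)^2 = (pd 0 f z)^2 + (pd 1 f z)^2 + (pd 2 f z)^2 +
      (pd 3 f z)^2 + (z 1 * pd 2 f z - z 2 * pd 1 f z)^2 + (z 1 * pd 3 f z - z 3 * pd 1 f z)^2 +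
      (z 2 * pd 3 f z - z 3 * pd 2 f z)^2 + (z 1 * pd 0 f z + z 0 * pd 1 f z)^2 +
      (z 2 * pd 0 f z + z 0 * pd 2 f z)^2 + (z 3 * pd 0 f z + z 0 * pd 3 f z)^2 := by
    simp only [Fin.sum_univ_succ, Fin.sum_univ_zero]
    simp [G5]
    ring
  rw [h]
  linarith [sq_nonneg (z 1 * pd 2 f z - z 2 * pd 1 f z), sq_nonneg (z 1 * pd 3 f z - z 3 * pd 1 f z),
    sq_nonneg (z 2 * pd 3 f z - z 3 * pd 2 f z)]

theorem cauchy_three {m₀ m₁ m₂ g₀ g₁ g₂ : ℝ} :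
    (g₀ * m₀ + g₁ * m₁ + g₂ * m₂)^2 ≤ (m₀^2 + m₁^2 + m₂^2) * (g₀^2 + g₁^2 + g₂^2) := by
  nlinarith [sq_nonneg (g₀ * m₁ - g₁ * m₀), sq_nonneg (g₀ * m₂ - g₂ * m₀),
    sq_nonneg (g₁ * m₂ - g₂ * m₁)]

theorem tangCube_hypCurve {δ : ℝ} (hδ : 0 < δ) (X₀ : Fin 3 → ℝ) (M : Matrix (Fin 3) (Fin 3) ℝ)
    (y : ℝ) {l : ℝ} (hl : 0 < l) (hM : ∀ k j, |M k j| ≤ 2)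
    (hlh : ∀ ξ ∈ Set.Icc (0 : Fin 3 → ℝ) (fun _ => l), l ≤ hyp δ 0 (pt5 0 (aff X₀ M ξ) 0)) :
    TangCube 12 l (hypCurve δ X₀ M y) := by
  intro f hf ξ hξ j
  have hl' := hlh ξ hξ
  unfold hypCurve
  rw [pd_comp_pt5_aff hf (contDiff_hyp_aff hδ X₀ M)]
  have hh : hyp δ 0 (pt5 0 (aff X₀ M ξ) 0) * pd j (fun ξ => hyp δ 0 (pt5 0 (aff X₀ M ξ) 0)) ξ =
      aff X₀ M ξ 0 * M 0 j + aff X₀ M ξ 1 * M 1 j + aff X₀ M ξ 2 * M 2 j := by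
    rw [pd_comp_pt5_aff (smooth5_hyp hδ 0) contDiff_const]
    have e := fun i => hyp_mul_pd hδ 0 i (pt5 0 (aff X₀ M ξ) 0)
    have e1 := e 1
    have e2 := e 2
    have e3 := e 3
    simp +decide only [pt5_one, pt5_two, pt5_three, Pi.zero_apply, sub_zero, if_true, if_false,
      mul_zero, mul_one, add_zero, zero_add] at e1 e2 e3
    have : pd j (fun _ : Fin 3 → ℝ => (0:ℝ)) ξ = 0 := by simp [pd]
    rw [this, ← e1, ← e2, ← e3]
    ring
  set h := hyp δ 0 (pt5 0 (aff X₀ M ξ) 0) with hh0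
  set z := pt5 h (aff X₀ M ξ) y with hz
  set Q := pd 0 f z * pd j (fun ξ => hyp δ 0 (pt5 0 (aff X₀ M ξ) 0)) ξ +
      (pd 1 f z * M 0 j + pd 2 f z * M 1 j + pd 3 f z * M 2 j) with hQ
  have hhQ : h * Q = (z 1 * pd 0 f z + z 0 * pd 1 f z) * M 0 j +
      (z 2 * pd 0 f z + z 0 * pd 2 f z) * M 1 j + (z 3 * pd 0 f z + z 0 * pd 3 f z) * M 2 j := by
    have : h * Q = pd 0 f z * (h * pd j (fun ξ => hyp δ 0 (pt5 0 (aff X₀ M ξ) 0)) ξ) +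
      h * (pd 1 f z * M 0 j + pd 2 f z * M 1 j + pd 3 f z * M 2 j) := by rw [hQ]; ring
    rw [this, hh]
    simp only [hz, pt5_zero, pt5_one, pt5_two, pt5_three]
    ring
  have hMsq : ∀ k, (M k j)^2 ≤ 4 := fun k => by
    have := sq_le_sq' (abs_le.1 (hM k j)).1 (abs_le.1 (hM k j)).2
    linarith
  have hb := boost_sq_le_sum f z
  calc l^2 * Q^2 ≤ h^2 * Q^2 := by gcongr
    _ = (h * Q)^2 := by ring
    _ ≤ ((M 0 j)^2 + (M 1 j)^2 + (M 2 j)^2) * ((z 1 * pd 0 f z + z 0 * pd 1 f z)^2 +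
        (z 2 * pd 0 f z + z 0 * pd 2 f z)^2 + (z 3 * pd 0 f z + z 0 * pd 3 f z)^2) := by
        rw [hhQ]; exact cauchy_three
    _ ≤ 12 * ∑ i : Fin 10, (G5 i.castSucc f z)^2 := by
        refine mul_le_mul (by linarith [hMsq 0, hMsq 1, hMsq 2]) ?_ (by positivity) (by norm_num)
        linarith [sq_nonneg (pd 0 f z), sq_nonneg (pd 1 f z), sq_nonneg (pd 2 f z),
          sq_nonneg (pd 3 f z)]

/-- The flat piece at time `t` over a translated cube. -/
def flatCurve (t : ℝ) (X₀ : Fin 3 → ℝ) (y : ℝ) (ξ : Fin 3 → ℝ) : Fin 5 → ℝ :=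
  pt5 t (aff X₀ 1 ξ) y

theorem pd_flatCurve {f : (Fin 5 → ℝ) → ℝ} (hf : Smooth5 f) (t : ℝ) (X₀ : Fin 3 → ℝ)
    (y : ℝ) (j : Fin 3) (ξ : Fin 3 → ℝ) :
    pd j (fun ξ => f (flatCurve t X₀ y ξ)) ξ = pd j.succ.castSucc f (flatCurve t X₀ y ξ) := by
  unfold flatCurve
  rw [pd_comp_pt5_aff hf contDiff_const]
  have : pd j (fun _ : Fin 3 → ℝ => t) ξ = 0 := by simp [pd]
  rw [this]
  simp only [Matrix.one_apply]
  fin_cases j <;> simp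

theorem tangCube_flatCurve_one (t : ℝ) (X₀ : Fin 3 → ℝ) (y : ℝ) :
    TangCube 1 1 (flatCurve t X₀ y) := by
  intro f hf ξ hξ j
  rw [pd_flatCurve hf]
  have hb := boost_sq_le_sum f (flatCurve t X₀ y ξ)
  set z := flatCurve t X₀ y ξ
  have h1 := sq_nonneg (z 1 * pd 0 f z + z 0 * pd 1 f z)
  have h2 := sq_nonneg (z 2 * pd 0 f z + z 0 * pd 2 f z)
  have h3 := sq_nonneg (z 3 * pd 0 f z + z 0 * pd 3 f z)
  have h4 := sq_nonneg (pd 0 f z)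
  have h5 := sq_nonneg (pd 1 f z)
  have h6 := sq_nonneg (pd 2 f z)
  have h7 := sq_nonneg (pd 3 f z)
  fin_cases j
  · change 1^2 * (pd 1 f z)^2 ≤ _; linarith
  · change 1^2 * (pd 2 f z)^2 ≤ _; linarith
  · change 1^2 * (pd 3 f z)^2 ≤ _; linarith

theorem tangCube_flatCurve {t l : ℝ} (hl : 1 ≤ l) (ht : t = l^3) (X₀ : Fin 3 → ℝ) (y : ℝ)
    (hX : ∀ ξ ∈ Set.Icc (0 : Fin 3 → ℝ) (fun _ => l), ∀ k, |aff X₀ 1 ξ k| ≤ 2 * l^2) :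
    TangCube 10 l (flatCurve t X₀ y) := by
  intro f hf ξ hξ j
  rw [pd_flatCurve hf]
  have hb := boost_sq_le_sum f (flatCurve t X₀ y ξ)
  have hk := hX ξ hξ
  have key : ∀ X A P b : ℝ, b = X * A + t * P → |X| ≤ 2 * l^2 →
      l^2 * P^2 ≤ 10 * (b^2 + A^2) := by
    intro X A P b hb hX
    have hX2 : X^2 ≤ 4 * l^4 := by
      have := sq_le_sq' (abs_le.1 hX).1 (abs_le.1 hX).2
      nlinarith
    have h1 : (t * P)^2 ≤ 2 * b^2 + 2 * (X * A)^2 := by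
      rw [show t * P = b - X * A by rw [hb]; ring]
      nlinarith [sq_nonneg (b + X * A)]
    have h2 : (X * A)^2 ≤ 4 * l^4 * A^2 := by
      rw [mul_pow]; gcongr
    have h3 : l^4 * (l^2 * P^2) ≤ l^4 * (10 * (b^2 + A^2)) := by
      have h4 : 1 ≤ l^4 := one_le_pow₀ hl
      have : l^4 * (l^2 * P^2) = (t * P)^2 := by rw [ht]; ring
      rw [this]
      nlinarith [sq_nonneg b, mul_nonneg (by linarith : (0:ℝ) ≤ l^4 - 1) (sq_nonneg b),
        mul_nonneg (by linarith : (0:ℝ) ≤ l^4) (sq_nonneg A)]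
    exact le_of_mul_le_mul_left h3 (by positivity)
  set z := flatCurve t X₀ y ξ with hz
  have h0 : z 0 = t := rfl
  rw [h0] at hb
  have h1 := sq_nonneg (z 1 * pd 0 f z + t * pd 1 f z)
  have h2 := sq_nonneg (z 2 * pd 0 f z + t * pd 2 f z)
  have h3 := sq_nonneg (z 3 * pd 0 f z + t * pd 3 f z)
  have h5 := sq_nonneg (pd 1 f z)
  have h6 := sq_nonneg (pd 2 f z)
  have h7 := sq_nonneg (pd 3 f z)
  fin_cases j
  · change l^2 * (pd 1 f z)^2 ≤ _
    have := key (z 1) (pd 0 f z) (pd 1 f z) _ rfl (hk 0); linarith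
  · change l^2 * (pd 2 f z)^2 ≤ _
    have := key (z 2) (pd 0 f z) (pd 2 f z) _ rfl (hk 1); linarith
  · change l^2 * (pd 3 f z)^2 ≤ _
    have := key (z 3) (pd 0 f z) (pd 3 f z) _ rfl (hk 2); linarith

theorem lintegral_aff_le (X₀ : Fin 3 → ℝ) (M : Matrix (Fin 3) (Fin 3) ℝ) (hdet : 1 ≤ |M.det|)
    {S T : Set (Fin 3 → ℝ)} (hS : MeasurableSet S) (hT : MeasurableSet T) (hST : ∀ ξ ∈ S, aff X₀ M ξ ∈ T)
    {G : (Fin 3 → ℝ) → ENNReal} (hG : Measurable G) :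
    ∫⁻ ξ in S, G (aff X₀ M ξ) ≤ ∫⁻ X in T, G X := by
  have hd : M.det ≠ 0 := by
    intro h; rw [h, abs_zero] at hdet; linarith
  rw [← lintegral_indicator hT, ← lintegral_indicator hS]
  have hI : Measurable (T.indicator G) := hG.indicator hT
  calc ∫⁻ ξ, S.indicator (fun ξ => G (aff X₀ M ξ)) ξ ≤ ∫⁻ ξ, T.indicator G (aff X₀ M ξ) := by
        refine lintegral_mono fun ξ => ?_
        by_cases h : ξ ∈ S
        · simp only [Set.indicator_of_mem h, Set.indicator_of_mem (hST ξ h)]; exact le_rfl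
        · simp only [Set.indicator_of_notMem h]; exact zero_le
    _ = ∫⁻ X, T.indicator G (X₀ + X) ∂(Measure.map (Matrix.toLin' M) volume) := by
        rw [lintegral_map (f := fun X => T.indicator G (X₀ + X)) (hI.comp (measurable_const_add X₀))
          (LinearMap.continuous_of_finiteDimensional _).measurable]
        rfl
    _ = ENNReal.ofReal |M.det⁻¹| * ∫⁻ X, T.indicator G (X₀ + X) := by
        rw [Real.map_matrix_volume_pi_eq_smul_volume_pi hd, lintegral_smul_measure, smul_eq_mul]
    _ = ENNReal.ofReal |M.det⁻¹| * ∫⁻ X, T.indicator G X := by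
        rw [lintegral_add_left_eq_self]
    _ ≤ 1 * ∫⁻ X, T.indicator G X := by
        gcongr
        rw [ENNReal.ofReal_le_one, abs_inv]
        exact inv_le_one_of_one_le₀ hdet
    _ = _ := one_mul _

theorem ofReal_Phi_le_lintegral_time {B t : ℝ} {f : (Fin 5 → ℝ) → ℝ} (hf : Smooth5 f) {δ : ℝ}
    (n : ℕ) (X : Fin 3 → ℝ) (y : ℝ) (h1 : 2 * B + 1 ≤ hyp δ 0 (pt5 0 X 0))
    (h2 : hyp δ 0 (pt5 0 X 0) ≤ t) :
    ENNReal.ofReal (Phi n f (pt5 (hyp δ 0 (pt5 0 X 0)) X y)) ≤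
      4 * ∫⁻ τ in Set.Icc (2*B) t, ENNReal.ofReal (1 / (1 + (τ - hyp δ 0 (pt5 τ X y))^2)) *
        ENNReal.ofReal (Phi (n+1) f (pt5 τ X y)) := by
  set h := hyp δ 0 (pt5 0 X 0) with hh
  have hW : ∀ τ, hyp δ 0 (pt5 τ X y) = h := fun τ => rfl
  simp only [hW]
  set W : ℝ → ENNReal := fun τ => ENNReal.ofReal (1 / (1 + (τ - h)^2)) *
        ENNReal.ofReal (Phi (n+1) f (pt5 τ X y)) with hWdef
  have hγ : ContDiff ℝ ((⊤ : ℕ∞) : WithTop ℕ∞) fun s : ℝ => pt5 (h - s) X y :=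
    contDiff_pt5 (contDiff_const.sub contDiff_id) contDiff_const contDiff_const
  have hcurve := ofReal_Phi_le_lintegral_curve (l := 1) (K := 1) one_pos le_rfl hγ
    (fun g hg s _ => by
      have hd : deriv (fun s => g (pt5 (h - s) X y)) s = - pd 0 g (pt5 (h - s) X y) := by
        have e : (fun s => g (pt5 (h - s) X y)) =
            fun s => g (pt5 h X y + (-s) • (Pi.single 0 (1 : ℝ) : Fin 5 → ℝ)) := by
          funext s
          congr 1
          funext i
          refine Fin.cases ?_ (fun k => ?_) i
          · simp [pt5, sub_eq_add_neg]
          · simp [pt5]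
        rw [e]
        have h3 := (hasDerivAt_line_pd_at hg (pt5 h X y) 0 (-s)).scomp s (hasDerivAt_neg s)
        have h4 := h3.deriv
        simp only [Function.comp_def] at h4
        rw [h4]
        simp only [neg_smul, one_smul, neg_inj]
        congr 1
        funext i
        refine Fin.cases ?_ (fun k => ?_) i
        · simp [pt5, sub_eq_add_neg]
        · simp [pt5]
      rw [hd]
      have := boost_sq_le_sum g (pt5 (h - s) X y)
      set z := pt5 (h - s) X y
      have h1 := sq_nonneg (z 1 * pd 0 g z + z 0 * pd 1 g z)
      have h2 := sq_nonneg (z 2 * pd 0 g z + z 0 * pd 2 g z)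
      have h3 := sq_nonneg (z 3 * pd 0 g z + z 0 * pd 3 g z)
      have h5 := sq_nonneg (pd 1 g z)
      have h6 := sq_nonneg (pd 2 g z)
      have h7 := sq_nonneg (pd 3 g z)
      linarith) n hf
  simp only [sub_zero] at hcurve
  refine hcurve.trans ?_
  have hpt : ∀ s ∈ Set.Icc (0:ℝ) 1, ENNReal.ofReal (Phi (n+1) f (pt5 (h - s) X y)) ≤
      2 * (Set.Icc (2*B) t).indicator W (h - s) := by
    intro s hs
    rw [Set.indicator_of_mem (by constructor <;> linarith [hs.1, hs.2])]
    simp only [hWdef]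
    rw [← ENNReal.ofReal_mul (by positivity), show (2 : ENNReal) = ENNReal.ofReal 2 by simp,
      ← ENNReal.ofReal_mul (by norm_num)]
    refine ENNReal.ofReal_le_ofReal ?_
    have hP := Phi_nonneg (n+1) f (pt5 (h - s) X y)
    have : (1:ℝ)/2 ≤ 1 / (1 + (h - s - h)^2) := by
      refine one_div_le_one_div_of_le (by positivity) ?_
      nlinarith [hs.1, hs.2]
    nlinarith
  have hc : Continuous fun τ => pt5 τ X y :=
    continuous_pt5 continuous_id continuous_const continuous_const
  have hWm : Measurable W := by
    refine Measurable.mul ?_ (((continuous_Phi _ hf).comp hc).measurable.ennreal_ofReal)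
    refine Measurable.ennreal_ofReal ?_
    fun_prop
  calc _ ≤ ENNReal.ofReal 2 * ∫⁻ s in Set.Icc (0:ℝ) 1,
        2 * (Set.Icc (2*B) t).indicator W (h - s) := by
        rw [show 2 * 1 / 1 = (2:ℝ) by norm_num]
        gcongr 1
        exact setLIntegral_mono' measurableSet_Icc hpt
    _ ≤ ENNReal.ofReal 2 * ∫⁻ s, 2 * (Set.Icc (2*B) t).indicator W (h - s) := by
        gcongr 1
        exact setLIntegral_le_lintegral _ _
    _ = ENNReal.ofReal 2 * (2 * ∫⁻ s, (Set.Icc (2*B) t).indicator W (h - s)) := by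
        rw [lintegral_const_mul' _ _ (by simp)]
    _ = 4 * ∫⁻ s in Set.Icc (2*B) t, W s := by
        rw [lintegral_sub_left_eq_self (fun s => (Set.Icc (2*B) t).indicator W s) h,
          lintegral_indicator measurableSet_Icc, ← mul_assoc]
        congr 1
        rw [ENNReal.ofReal_ofNat]
        norm_num

theorem measurableSet_box3 (R : ℝ) : MeasurableSet (box3 R) := by
  unfold box3
  exact measurableSet_Icc

theorem lintegral_swap_box {B t a b : ℝ} {F : ℝ → (Fin 3 → ℝ) → ℝ → ENNReal}
    (hF : Measurable fun p : ℝ × (Fin 3 → ℝ) × ℝ => F p.1 p.2.1 p.2.2) :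
    ∫⁻ y in Set.Icc a b, ∫⁻ X in box3 t, ∫⁻ τ in Set.Icc (2*B) t, F τ X y =
      ∫⁻ τ in Set.Icc (2*B) t, ∫⁻ X in box3 t, ∫⁻ y in Set.Icc a b, F τ X y := by
  have e1 : ∀ y, ∫⁻ X in box3 t, ∫⁻ τ in Set.Icc (2*B) t, F τ X y =
      ∫⁻ τ in Set.Icc (2*B) t, ∫⁻ X in box3 t, F τ X y := by
    intro y
    refine lintegral_lintegral_swap (f := fun X τ => F τ X y) ?_
    exact (hF.comp (measurable_snd.prodMk (measurable_fst.prodMk measurable_const))).aemeasurable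
  simp only [e1]
  rw [lintegral_lintegral_swap]
  · refine lintegral_congr fun τ => ?_
    refine lintegral_lintegral_swap (f := fun y X => F τ X y) ?_
    exact (hF.comp (measurable_const.prodMk (measurable_snd.prodMk measurable_fst))).aemeasurable
  · refine Measurable.aemeasurable ?_
    refine Measurable.lintegral_prod_right' (f := fun q : (ℝ × ℝ) × (Fin 3 → ℝ) => F q.1.2 q.2 q.1.1) ?_
    exact hF.comp ((measurable_snd.comp measurable_fst).prodMk
      (measurable_snd.prodMk (measurable_fst.comp measurable_fst)))

theorem measurable_lintegral_pt5 {W : (Fin 5 → ℝ) → ENNReal} (hW : Measurable W) (T : Set ℝ) (y : ℝ) :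
    Measurable fun X : Fin 3 → ℝ => ∫⁻ τ in T, W (pt5 τ X y) := by
  have hc : Measurable fun q : (Fin 3 → ℝ) × ℝ => pt5 q.2 q.1 y :=
    (continuous_pt5 continuous_snd continuous_fst continuous_const).measurable
  exact Measurable.lintegral_prod_right' (f := fun q : (Fin 3 → ℝ) × ℝ => W (pt5 q.2 q.1 y))
    (hW.comp hc)

theorem Ctl.hyperboloid_bound {a b B t D : ℝ} (hab : a < b) (hB : 0 < B) (ht : 2 * B ≤ t)
    {v : (Fin 5 → ℝ) → ℝ} (hv : ∀ w : List (Fin 10), w.length ≤ 4 → Ctl a b B t D (tang w v))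
    {δ : ℝ} (hδ : 0 < δ) {l : ℝ} (hl : 0 < l) (X₀ : Fin 3 → ℝ) (M : Matrix (Fin 3) (Fin 3) ℝ)
    (hM : ∀ k j, |M k j| ≤ 2) (hdet : 1 ≤ |M.det|)
    (hgeo : ∀ ξ ∈ Set.Icc (0 : Fin 3 → ℝ) (fun _ => l), aff X₀ M ξ ∈ box3 t ∧
      l ≤ hyp δ 0 (pt5 0 (aff X₀ M ξ) 0) ∧ 2 * B + 1 ≤ hyp δ 0 (pt5 0 (aff X₀ M ξ) 0) ∧
      hyp δ 0 (pt5 0 (aff X₀ M ξ) 0) ≤ t) :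
    ∫⁻ y in Set.Icc a b, ENNReal.ofReal ((pd 4 v (pt5 (hyp δ 0 (pt5 0 X₀ 0)) X₀ y))^2) ≤
      ENNReal.ofReal (24 / l) ^ 3 * (4 * (11 ^ 4 * ENNReal.ofReal (16 * D^2))) := by
  have hvs : Smooth5 v := (hv [] (by simp)).good.smooth
  set f := pd 4 v with hfdef
  have hf : Smooth5 f := hvs.pd 4
  set W : (Fin 5 → ℝ) → ENNReal := fun z => ENNReal.ofReal (1 / (1 + (z 0 - hyp δ 0 z)^2)) *
        ENNReal.ofReal (Phi 4 f z) with hWdef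
  have hω : Measurable fun z : Fin 5 → ℝ => ENNReal.ofReal (1 / (1 + (z 0 - hyp δ 0 z)^2)) := by
    refine Measurable.ennreal_ofReal ?_
    have := (smooth5_hyp hδ 0).continuous.measurable
    fun_prop
  have hWm : Measurable W := hω.mul ((continuous_Phi _ hf).measurable.ennreal_ofReal)
  have hpt : Continuous fun p : ℝ × (Fin 3 → ℝ) × ℝ => pt5 p.1 p.2.1 p.2.2 :=
    continuous_pt5 continuous_fst (continuous_fst.comp continuous_snd)
      (continuous_snd.comp continuous_snd)
  have hWp : Measurable fun p : ℝ × (Fin 3 → ℝ) × ℝ => W (pt5 p.1 p.2.1 p.2.2) :=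
    hWm.comp hpt.measurable
  have haff0 : aff X₀ M 0 = X₀ := by simp [aff]
  have step1 : ∀ y, ENNReal.ofReal ((f (pt5 (hyp δ 0 (pt5 0 X₀ 0)) X₀ y))^2) ≤
      ENNReal.ofReal (24 / l) ^ 3 * (4 * ∫⁻ X in box3 t, ∫⁻ τ in Set.Icc (2*B) t, W (pt5 τ X y)) := by
    intro y
    have h1 := ofReal_Phi_le_lintegral_cube hl (by norm_num)
      (contDiff_pt5 (contDiff_hyp_aff hδ X₀ M) (contDiff_aff X₀ M) contDiff_const)
      (tangCube_hypCurve hδ X₀ M y hl hM fun ξ hξ => (hgeo ξ hξ).2.1) 0 hf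
    simp only [haff0] at h1
    rw [show (2:ℝ) * 12 = 24 by norm_num] at h1
    refine h1.trans ?_
    gcongr 1
    calc _ ≤ ∫⁻ ξ in Set.Icc (0 : Fin 3 → ℝ) (fun _ => l),
          4 * ∫⁻ τ in Set.Icc (2*B) t, W (pt5 τ (aff X₀ M ξ) y) := by
          refine setLIntegral_mono' measurableSet_Icc fun ξ hξ => ?_
          exact ofReal_Phi_le_lintegral_time hf 3 _ y (hgeo ξ hξ).2.2.1 (hgeo ξ hξ).2.2.2
      _ = 4 * ∫⁻ ξ in Set.Icc (0 : Fin 3 → ℝ) (fun _ => l),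
          ∫⁻ τ in Set.Icc (2*B) t, W (pt5 τ (aff X₀ M ξ) y) := lintegral_const_mul' _ _ (by simp)
      _ ≤ _ := by
          gcongr 1
          refine lintegral_aff_le X₀ M hdet measurableSet_Icc (measurableSet_box3 t)
            (fun ξ hξ => (hgeo ξ hξ).1)
            (G := fun X => ∫⁻ τ in Set.Icc (2*B) t, W (pt5 τ X y))
            (measurable_lintegral_pt5 hWm _ y)
  have hcs : Continuous fun p : ℝ × (Fin 4 → ℝ) => cs p.1 p.2 := continuous_cs
  calc _ ≤ ∫⁻ y in Set.Icc a b, ENNReal.ofReal (24 / l) ^ 3 *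
        (4 * ∫⁻ X in box3 t, ∫⁻ τ in Set.Icc (2*B) t, W (pt5 τ X y)) := lintegral_mono step1
    _ = ENNReal.ofReal (24 / l) ^ 3 * (4 * ∫⁻ y in Set.Icc a b,
        ∫⁻ X in box3 t, ∫⁻ τ in Set.Icc (2*B) t, W (pt5 τ X y)) := by
        rw [lintegral_const_mul' _ _ (ENNReal.pow_ne_top ENNReal.ofReal_ne_top),
          lintegral_const_mul' _ _ (by simp)]
    _ = ENNReal.ofReal (24 / l) ^ 3 * (4 * ∫⁻ p, W (cs p.1 p.2)
        ∂((volume.restrict (Set.Icc (2*B) t)).prod (volume.restrict (box4 t a b)))) := by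
        rw [lintegral_swap_box (F := fun τ X y => W (pt5 τ X y)) hWp,
          lintegral_prod (fun p : ℝ × (Fin 4 → ℝ) => W (cs p.1 p.2)) (hWm.comp hcs.measurable).aemeasurable]
        congr 3
        funext τ
        rw [lintegral_box4 t a b (F := fun Y => W (cs τ Y))
          (hWm.comp (continuous_cs_right τ).measurable)]
        rfl
    _ ≤ _ := by
        gcongr 2
        refine lintegral_Phi_le (ω := fun p : ℝ × (Fin 4 → ℝ) => ENNReal.ofReal
          (1 / (1 + ((cs p.1 p.2) 0 - hyp δ 0 (cs p.1 p.2))^2))) (hω.comp hcs.measurable)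
          hcs.measurable 4 hf fun w hw => ?_
        have hen := (hv w hw).hyperboloid_energy hab hB ht hδ
        rw [pd_four_opIter hvs] at hen
        refine le_trans (le_of_eq ?_) hen
        rw [lintegral_prod]
        · refine lintegral_congr fun τ => lintegral_congr fun Y => ?_
          rw [ENNReal.ofReal_mul (by positivity)]
          rfl
        · refine ((hω.comp hcs.measurable).mul ?_).aemeasurable
          exact (((hf.opIter _).continuous.comp hcs).measurable.pow_const 2).ennreal_ofReal

theorem pt5_eq_add_single (t : ℝ) (x : Fin 3 → ℝ) (y : ℝ) :
    pt5 t x y = pt5 t x 0 + y • (Pi.single 4 (1 : ℝ) : Fin 5 → ℝ) := by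
  funext i
  fin_cases i <;> simp [pt5_zero, pt5_one, pt5_two, pt5_three, pt5_four]

theorem hasDerivAt_pt5_y {f : (Fin 5 → ℝ) → ℝ} (hf : Smooth5 f) (t : ℝ) (x : Fin 3 → ℝ) (y : ℝ) :
    HasDerivAt (fun y => f (pt5 t x y)) (pd 4 f (pt5 t x y)) y := by
  have h := hasDerivAt_line_pd_at hf (pt5 t x 0) 4 y
  simpa only [← pt5_eq_add_single] using h

theorem continuous_pt5_y {f : (Fin 5 → ℝ) → ℝ} (hf : Continuous f) (t : ℝ) (x : Fin 3 → ℝ) :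
    Continuous fun y => f (pt5 t x y) :=
  hf.comp (continuous_pt5 continuous_const continuous_const continuous_id)

/-- Integral over the fibre `{t} × {x} × [a,b]`. -/
def yInt (a b : ℝ) (f : (Fin 5 → ℝ) → ℝ) (t : ℝ) (x : Fin 3 → ℝ) : ℝ := ∫ y in a..b, f (pt5 t x y)

theorem ofReal_yInt {a b : ℝ} (hab : a < b) {f : (Fin 5 → ℝ) → ℝ} (hf : Continuous f)
    (h0 : ∀ z, 0 ≤ f z) (t : ℝ) (x : Fin 3 → ℝ) :
    ENNReal.ofReal (yInt a b f t x) = ∫⁻ y in Set.Icc a b, ENNReal.ofReal (f (pt5 t x y)) := by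
  rw [yInt, intervalIntegral.integral_of_le hab.le, ← integral_Icc_eq_integral_Ioc]
  exact ofReal_integral_eq_lintegral_ofReal
    ((continuous_pt5_y hf t x).continuousOn.integrableOn_compact isCompact_Icc)
    (Filter.Eventually.of_forall fun _ => h0 _)

theorem yInt_nonneg {a b : ℝ} (hab : a < b) {f : (Fin 5 → ℝ) → ℝ}
    (h0 : ∀ z, 0 ≤ f z) (t : ℝ) (x : Fin 3 → ℝ) : 0 ≤ yInt a b f t x :=
  intervalIntegral.integral_nonneg hab.le fun _ _ => h0 _

theorem yInt_mono {a b : ℝ} (hab : a < b) {f g : (Fin 5 → ℝ) → ℝ} (hf : Continuous f)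
    (hg : Continuous g) (h : ∀ z, f z ≤ g z) (t : ℝ) (x : Fin 3 → ℝ) :
    yInt a b f t x ≤ yInt a b g t x :=
  intervalIntegral.integral_mono_on hab.le ((continuous_pt5_y hf t x).intervalIntegrable _ _)
    ((continuous_pt5_y hg t x).intervalIntegrable _ _) fun _ _ => h _

theorem yInt_add {a b : ℝ} {f g : (Fin 5 → ℝ) → ℝ} (hf : Continuous f)
    (hg : Continuous g) (t : ℝ) (x : Fin 3 → ℝ) :
    yInt a b (fun z => f z + g z) t x = yInt a b f t x + yInt a b g t x :=
  intervalIntegral.integral_add ((continuous_pt5_y hf t x).intervalIntegrable _ _)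
    ((continuous_pt5_y hg t x).intervalIntegrable _ _)

theorem yInt_const_mul {a b : ℝ} (c : ℝ) (f : (Fin 5 → ℝ) → ℝ) (t : ℝ) (x : Fin 3 → ℝ) :
    yInt a b (fun z => c * f z) t x = c * yInt a b f t x :=
  intervalIntegral.integral_const_mul _ _

theorem sq_integral_le {p : ℝ → ℝ} (hp : Continuous p) {a y : ℝ} (hay : a ≤ y) :
    (∫ s in a..y, p s)^2 ≤ (y - a) * ∫ s in a..y, p s ^ 2 := by
  rcases hay.eq_or_lt with rfl | hlt
  · simp
  have hd : 0 < y - a := by linarith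
  set I := ∫ s in a..y, p s with hI
  set m := I / (y - a) with hm
  have h : 0 ≤ ∫ s in a..y, (p s ^ 2 + (m^2 - 2 * m * p s)) :=
    intervalIntegral.integral_nonneg hay fun s _ => by nlinarith [sq_nonneg (p s - m)]
  have i1 : IntervalIntegrable (fun s => p s ^ 2) volume a y := (hp.pow 2).intervalIntegrable _ _
  have i2 : IntervalIntegrable (fun s => 2 * m * p s) volume a y :=
    (continuous_const.mul hp).intervalIntegrable _ _
  have i3 : IntervalIntegrable (fun _ : ℝ => m^2) volume a y := by simp
  rw [intervalIntegral.integral_add i1 (i3.sub i2), intervalIntegral.integral_sub i3 i2,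
    intervalIntegral.integral_const_mul, intervalIntegral.integral_const, smul_eq_mul, ← hI] at h
  have hmI : (y - a) * m = I := by rw [hm]; field_simp
  have h2 : (y - a) * ((y - a) * m^2 - 2 * m * I) = - I^2 := by rw [← hmI]; ring
  nlinarith [mul_nonneg hd.le h]

/-- The one-dimensional Poincaré inequality with a vanishing endpoint value. -/
theorem sq_le_yInt_of_dirichlet {a b : ℝ} {f : (Fin 5 → ℝ) → ℝ} (hf : Smooth5 f)
    (h : Dirichlet a b f) (t : ℝ) (x : Fin 3 → ℝ) {y : ℝ} (hy : y ∈ Set.Icc a b) :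
    f (pt5 t x y)^2 ≤ (b - a) * yInt a b (fun z => pd 4 f z ^ 2) t x := by
  have hc := continuous_pt5_y (hf.pd 4).continuous t x
  have hft : ∫ s in a..y, pd 4 f (pt5 t x s) = f (pt5 t x y) := by
    rw [intervalIntegral.integral_eq_sub_of_hasDerivAt (f := fun s => f (pt5 t x s))
      (fun s _ => hasDerivAt_pt5_y hf t x s) (hc.intervalIntegrable _ _),
      h (pt5 t x a) (Or.inl rfl), sub_zero]
  rw [← hft]
  have hcc : Continuous fun s => pd 4 f (pt5 t x s) ^ 2 := hc.pow 2
  refine (sq_integral_le hc hy.1).trans ?_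
  have h1 : ∫ s in a..y, pd 4 f (pt5 t x s) ^ 2 ≤ yInt a b (fun z => pd 4 f z ^ 2) t x :=
    intervalIntegral.integral_mono_interval le_rfl hy.1 hy.2
      (Filter.Eventually.of_forall fun _ => sq_nonneg _) (hcc.intervalIntegrable _ _)
  have h2 : 0 ≤ ∫ s in a..y, pd 4 f (pt5 t x s) ^ 2 :=
    intervalIntegral.integral_nonneg hy.1 fun _ _ => sq_nonneg _
  have := hy.2
  have := hy.1
  exact mul_le_mul (by linarith) h1 h2 (by linarith)

theorem yInt_sq_le_of_dirichlet {a b : ℝ} (hab : a < b) {f : (Fin 5 → ℝ) → ℝ} (hf : Smooth5 f)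
    (h : Dirichlet a b f) (t : ℝ) (x : Fin 3 → ℝ) :
    yInt a b (fun z => f z ^ 2) t x ≤ (b - a)^2 * yInt a b (fun z => pd 4 f z ^ 2) t x := by
  have hc : Continuous fun y => f (pt5 t x y) ^ 2 := (continuous_pt5_y hf.continuous t x).pow 2
  have h1 : yInt a b (fun z => f z ^ 2) t x ≤
      ∫ _ in a..b, (b - a) * yInt a b (fun z => pd 4 f z ^ 2) t x :=
    intervalIntegral.integral_mono_on hab.le (hc.intervalIntegrable _ _) (by simp)
      fun y hy => sq_le_yInt_of_dirichlet hf h t x hy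
  rw [intervalIntegral.integral_const, smul_eq_mul] at h1
  linarith

/-- The one-dimensional Sobolev inequality on the fibre. -/
theorem sq_le_yInt_sobolev {a b : ℝ} (hab : a < b) {f : (Fin 5 → ℝ) → ℝ} (hf : Smooth5 f)
    (t : ℝ) (x : Fin 3 → ℝ) {y : ℝ} (hy : y ∈ Set.Icc a b) :
    f (pt5 t x y)^2 ≤ (2 / (b - a)) * yInt a b (fun z => f z ^ 2) t x +
      2 * (b - a) * yInt a b (fun z => pd 4 f z ^ 2) t x := by
  have hd : 0 < b - a := by linarith
  have hc := continuous_pt5_y (hf.pd 4).continuous t x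
  have hcf : Continuous fun y => f (pt5 t x y) ^ 2 := (continuous_pt5_y hf.continuous t x).pow 2
  have hcc : Continuous fun s => pd 4 f (pt5 t x s) ^ 2 := hc.pow 2
  set J := yInt a b (fun z => pd 4 f z ^ 2) t x with hJ
  have key : ∀ s ∈ Set.Icc a b, f (pt5 t x y)^2 ≤ 2 * f (pt5 t x s)^2 + 2 * (b - a) * J := by
    have main : ∀ p q, a ≤ p → p ≤ q → q ≤ b →
        (f (pt5 t x q) - f (pt5 t x p))^2 ≤ (b - a) * J := by
      intro p q hap hpq hqb
      have hft := intervalIntegral.integral_eq_sub_of_hasDerivAt (f := fun s => f (pt5 t x s))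
        (fun s _ => hasDerivAt_pt5_y hf t x s) (hc.intervalIntegrable p q)
      rw [← hft]
      refine (sq_integral_le hc hpq).trans ?_
      refine mul_le_mul (by linarith) ?_
        (intervalIntegral.integral_nonneg hpq fun _ _ => sq_nonneg _) hd.le
      exact intervalIntegral.integral_mono_interval hap hpq hqb
        (Filter.Eventually.of_forall fun _ => sq_nonneg _) (hcc.intervalIntegrable _ _)
    intro s hs
    have h1 : (f (pt5 t x y) - f (pt5 t x s))^2 ≤ (b - a) * J := by
      rcases le_total s y with h | h
      · exact main s y hs.1 h hy.2
      · have := main y s hy.1 h hs.2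
        nlinarith
    nlinarith [sq_nonneg (f (pt5 t x y) - 2 * f (pt5 t x s))]
  have h1 : ∫ _ in a..b, f (pt5 t x y)^2 ≤ ∫ s in a..b, (2 * f (pt5 t x s)^2 + 2 * (b - a) * J) :=
    intervalIntegral.integral_mono_on hab.le (by simp)
      (((continuous_const.mul hcf).add continuous_const).intervalIntegrable _ _) key
  have hi : IntervalIntegrable (fun s => 2 * f (pt5 t x s)^2) volume a b :=
    (continuous_const.mul hcf).intervalIntegrable _ _
  rw [intervalIntegral.integral_add hi (by simp), intervalIntegral.integral_const_mul, intervalIntegral.integral_const,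
    intervalIntegral.integral_const, smul_eq_mul, smul_eq_mul] at h1
  change (b - a) * f (pt5 t x y)^2 ≤ 2 * yInt a b (fun z => f z ^ 2) t x + (b - a) * (2 * (b - a) * J) at h1
  rw [div_mul_eq_mul_div, div_add' _ _ _ hd.ne', le_div_iff₀ hd]
  linarith

theorem Ctl.yInt_hyperboloid {a b B t D : ℝ} (hab : a < b) (hB : 0 < B) (ht : 2 * B ≤ t)
    {v : (Fin 5 → ℝ) → ℝ} (hv : ∀ w : List (Fin 10), w.length ≤ 4 → Ctl a b B t D (tang w v))
    {δ : ℝ} (hδ : 0 < δ) {l : ℝ} (hl : 0 < l) (X₀ : Fin 3 → ℝ) (M : Matrix (Fin 3) (Fin 3) ℝ)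
    (hM : ∀ k j, |M k j| ≤ 2) (hdet : 1 ≤ |M.det|)
    (hgeo : ∀ ξ ∈ Set.Icc (0 : Fin 3 → ℝ) (fun _ => l), aff X₀ M ξ ∈ box3 t ∧
      l ≤ hyp δ 0 (pt5 0 (aff X₀ M ξ) 0) ∧ 2 * B + 1 ≤ hyp δ 0 (pt5 0 (aff X₀ M ξ) 0) ∧
      hyp δ 0 (pt5 0 (aff X₀ M ξ) 0) ≤ t) :
    yInt a b (fun z => pd 4 v z ^ 2) (hyp δ 0 (pt5 0 X₀ 0)) X₀ ≤
      24^3 * 4 * 11^4 * 16 * (D^2 / l^3) := by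
  have hvs : Smooth5 v := (hv [] (by simp)).good.smooth
  have h := Ctl.hyperboloid_bound hab hB ht hv hδ hl X₀ M hM hdet hgeo
  rw [← ofReal_yInt hab (f := fun z => pd 4 v z ^ 2) ((hvs.pd 4).continuous.pow 2)
    (fun _ => sq_nonneg _)] at h
  have e : ENNReal.ofReal (24 / l) ^ 3 * (4 * (11 ^ 4 * ENNReal.ofReal (16 * D^2))) =
      ENNReal.ofReal (24^3 * 4 * 11^4 * 16 * (D^2 / l^3)) := by
    rw [show (4 : ENNReal) = ENNReal.ofReal 4 by simp, show (11 : ENNReal) = ENNReal.ofReal 11 by simp,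
      ← ENNReal.ofReal_pow (by positivity), ← ENNReal.ofReal_pow (by positivity),
      ← ENNReal.ofReal_mul (by positivity), ← ENNReal.ofReal_mul (by positivity),
      ← ENNReal.ofReal_mul (by positivity)]
    congr 1
    rw [div_pow]
    ring
  rw [e] at h
  exact (ENNReal.ofReal_le_ofReal_iff (by positivity)).1 h

/-- Sobolev inequality on a flat cube, weighted. -/
theorem yInt_flat_le {a b t R l K c : ℝ} (hab : a < b) (hl : 0 < l) (hK : 1 ≤ K)
    {f : (Fin 5 → ℝ) → ℝ} (hf : Smooth5 f) (x : Fin 3 → ℝ)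
    (hT : ∀ y, TangCube K l (flatCurve t x y)) {χ : (Fin 5 → ℝ) → ℝ} (hχ : Continuous χ)
    (hχ0 : ∀ z, 0 ≤ χ z)
    (hgeo : ∀ ξ ∈ Set.Icc (0 : Fin 3 → ℝ) (fun _ => l), aff x 1 ξ ∈ box3 R ∧
      ∀ y, 1 ≤ χ (pt5 t (aff x 1 ξ) y))
    (hc : ∀ w : List (Fin 10), w.length ≤ 3 → boxInt R a b (fun z => χ z * tang w f z ^ 2) t ≤ c) :
    yInt a b (fun z => f z ^ 2) t x ≤ (2 * K / l)^3 * (11^3 * c) := by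
  have hc0 : 0 ≤ c := (boxInt_nonneg R a b t fun z => mul_nonneg (hχ0 z) (sq_nonneg _)).trans
    (hc [] (by simp))
  set W : (Fin 5 → ℝ) → ENNReal := fun z => ENNReal.ofReal (χ z) * ENNReal.ofReal (Phi 3 f z) with hWdef
  have hω : Measurable fun z => ENNReal.ofReal (χ z) := hχ.measurable.ennreal_ofReal
  have hWm : Measurable W := hω.mul ((continuous_Phi _ hf).measurable.ennreal_ofReal)
  have haff0 : aff x 1 0 = x := by simp [aff]
  have step1 : ∀ y, ENNReal.ofReal (f (pt5 t x y)^2) ≤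
      ENNReal.ofReal (2 * K / l) ^ 3 * ∫⁻ X in box3 R, W (pt5 t X y) := by
    intro y
    have h1 := ofReal_Phi_le_lintegral_cube hl hK
      (contDiff_pt5 contDiff_const (contDiff_aff x 1) contDiff_const) (hT y) 0 hf
    simp only [haff0] at h1
    refine h1.trans ?_
    gcongr 1
    calc _ ≤ ∫⁻ ξ in Set.Icc (0 : Fin 3 → ℝ) (fun _ => l), W (pt5 t (aff x 1 ξ) y) := by
          refine setLIntegral_mono' measurableSet_Icc fun ξ hξ => ?_
          simp only [hWdef]
          refine le_mul_of_one_le_left zero_le ?_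
          rw [ENNReal.one_le_ofReal]
          exact (hgeo ξ hξ).2 y
      _ ≤ _ := lintegral_aff_le x 1 (by simp) measurableSet_Icc (measurableSet_box3 R)
            (fun ξ hξ => (hgeo ξ hξ).1) (G := fun X => W (pt5 t X y))
            (hWm.comp (continuous_pt5 continuous_const continuous_id continuous_const).measurable)
  have hmain : ENNReal.ofReal (yInt a b (fun z => f z ^ 2) t x) ≤
      ENNReal.ofReal (2 * K / l) ^ 3 * (11^3 * ENNReal.ofReal c) := by
    rw [ofReal_yInt hab (f := fun z => f z ^ 2) (hf.continuous.pow 2) (fun _ => sq_nonneg _)]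
    calc _ ≤ ∫⁻ y in Set.Icc a b, ENNReal.ofReal (2 * K / l) ^ 3 * ∫⁻ X in box3 R, W (pt5 t X y) :=
          lintegral_mono step1
      _ = ENNReal.ofReal (2 * K / l) ^ 3 * ∫⁻ Y in box4 R a b, W (cs t Y) := by
          rw [lintegral_const_mul' _ _ (ENNReal.pow_ne_top ENNReal.ofReal_ne_top),
            lintegral_box4 R a b (F := fun Y => W (cs t Y))
              (hWm.comp (continuous_cs_right t).measurable),
            lintegral_lintegral_swap (f := fun y X => W (pt5 t X y))]
          · rfl
          · have hcm : Measurable fun q : ℝ × (Fin 3 → ℝ) => pt5 t q.2 q.1 :=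
              (continuous_pt5 continuous_const continuous_snd continuous_fst).measurable
            exact (hWm.comp hcm).aemeasurable
      _ ≤ _ := by
          gcongr 1
          refine lintegral_Phi_le (ω := fun Y : Fin 4 → ℝ => ENNReal.ofReal (χ (cs t Y)))
            (hω.comp (continuous_cs_right t).measurable) (continuous_cs_right t).measurable 3 hf
            fun w hw => ?_
          refine le_trans (le_of_eq ?_) (ENNReal.ofReal_le_ofReal (hc w hw))
          rw [← lintegral_box4_ofReal R a b t (f := fun z => χ z * tang w f z ^ 2)
            (hχ.mul ((hf.opIter _).continuous.pow 2)) (fun z => mul_nonneg (hχ0 z) (sq_nonneg _))]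
          refine lintegral_congr fun Y => ?_
          rw [← ENNReal.ofReal_mul (hχ0 _)]
  rw [show (11 : ENNReal) = ENNReal.ofReal 11 by simp, ← ENNReal.ofReal_pow (by positivity),
    ← ENNReal.ofReal_pow (by positivity), ← ENNReal.ofReal_mul (by positivity),
    ← ENNReal.ofReal_mul (by positivity)] at hmain
  exact (ENNReal.ofReal_le_ofReal_iff (by positivity)).1 hmain

theorem mem_box3 {R : ℝ} {X : Fin 3 → ℝ} : X ∈ box3 R ↔ ∀ k, |X k| ≤ R := by
  simp only [box3, Set.mem_Icc, Pi.le_def, abs_le, ← forall_and]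

theorem yInt_sq_le_L2ab {a b B : ℝ} (hab : a < b) (hB : 0 < B) {f : (Fin 5 → ℝ) → ℝ}
    (hf : Smooth5 f) (hvan : Vanish a b B f) {t S : ℝ} (ht : 0 ≤ t) (x : Fin 3 → ℝ)
    (hS : ∀ w : List (Fin 10), w.length ≤ 3 → L2ab a b (tang w f) t ≤ S) :
    yInt a b (fun z => f z ^ 2) t x ≤ 8 * 11^3 * S^2 := by
  set R := t + 1 + |x 0| + |x 1| + |x 2| with hR
  have h0 := abs_nonneg (x 0)
  have h1 := abs_nonneg (x 1)
  have h2 := abs_nonneg (x 2)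
  have := yInt_flat_le (R := R) (c := S^2) hab one_pos le_rfl hf x
    (fun y => tangCube_flatCurve_one t x y) (χ := fun _ => 1) continuous_const (by simp) ?_ ?_
  · refine this.trans (le_of_eq ?_)
    norm_num
    ring
  · intro ξ hξ
    refine ⟨mem_box3.2 fun k => ?_, fun _ => le_rfl⟩
    have e : aff x 1 ξ k = x k + ξ k := by simp [aff]
    rw [e]
    have hk : |ξ k| ≤ 1 := abs_le.2 ⟨by linarith [show (0:ℝ) ≤ ξ k from hξ.1 k], hξ.2 k⟩
    have := abs_add_le (x k) (ξ k)
    have hxk : |x k| ≤ |x 0| + |x 1| + |x 2| := by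
      fin_cases k
      · change |x 0| ≤ _; linarith
      · change |x 1| ≤ _; linarith
      · change |x 2| ≤ _; linarith
    linarith
  · intro w hw
    simp only [one_mul]
    have h := hS w hw
    rw [L2ab_eq_boxInt hB (hf.opIter _).continuous (hvan.opIter hab hB hf _) ht
      (by linarith : t ≤ R)] at h
    have hnn := boxInt_nonneg R a b t (f := fun z => tang w f z ^ 2) fun z => sq_nonneg _
    rw [← Real.sq_sqrt hnn]
    gcongr

theorem tang_tang (w w' : List (Fin 10)) (f : (Fin 5 → ℝ) → ℝ) :
    tang w (tang w' f) = tang (w ++ w') f := by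
  simp only [tang, List.map_append, opIter_append]

theorem hyp_pt5_sq {δ : ℝ} (hδ : 0 < δ) (s : ℝ) (X : Fin 3 → ℝ) (y : ℝ) :
    hyp δ 0 (pt5 s X y) ^ 2 = δ^2 + (X 0 ^ 2 + X 1 ^ 2 + X 2 ^ 2) := by
  rw [hyp_sq hδ]
  simp only [pt5_one, pt5_two, pt5_three, Pi.zero_apply, sub_zero]

theorem boxInt_le_of_cube {R a b τ N r : ℝ} (hab : a < b) (hr : 0 ≤ r) {f : (Fin 5 → ℝ) → ℝ}
    (hf : Continuous f) (h0 : ∀ z, 0 ≤ f z) (x : Fin 3 → ℝ)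
    (hout : ∀ X, (∃ k, r < |X k - x k|) → ∀ y, f (pt5 τ X y) = 0)
    (hin : ∀ X, (∀ k, |X k - x k| ≤ r) → yInt a b f τ X ≤ N) :
    boxInt R a b f τ ≤ N * (2 * r)^3 := by
  have hN : 0 ≤ N := (yInt_nonneg hab h0 τ x).trans (hin x (by simpa using hr))
  set S : Set (Fin 3 → ℝ) := Set.Icc (fun k => x k - r) (fun k => x k + r) with hS
  have hmem : ∀ X, X ∈ S ↔ ∀ k, |X k - x k| ≤ r := by
    intro X
    simp only [hS, Set.mem_Icc, Pi.le_def, ← forall_and]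
    refine forall_congr' fun k => ?_
    rw [abs_le]
    constructor <;> rintro ⟨h1, h2⟩ <;> constructor <;> linarith
  have hvol : volume S = ENNReal.ofReal ((2 * r)^3) := by
    rw [hS, Real.volume_Icc_pi, Fin.prod_univ_three]
    have e : ∀ k, x k + r - (x k - r) = 2 * r := fun k => by ring
    simp only [e]
    rw [← ENNReal.ofReal_mul (by positivity), ← ENNReal.ofReal_mul (by positivity)]
    congr 1
    ring
  have key : ENNReal.ofReal (boxInt R a b f τ) ≤ ENNReal.ofReal (N * (2 * r)^3) := by
    rw [← lintegral_box4_ofReal R a b τ hf h0, lintegral_box4 R a b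
      (F := fun Y => ENNReal.ofReal (f (cs τ Y)))
      (hf.measurable.ennreal_ofReal.comp (continuous_cs_right τ).measurable)]
    calc _ ≤ ∫⁻ X in box3 R, S.indicator (fun _ => ENNReal.ofReal N) X := by
          refine lintegral_mono fun X => ?_
          change ∫⁻ y in Set.Icc a b, ENNReal.ofReal (f (pt5 τ X y)) ≤ _
          rw [← ofReal_yInt hab hf h0]
          by_cases hX : X ∈ S
          · rw [Set.indicator_of_mem hX]
            exact ENNReal.ofReal_le_ofReal (hin X ((hmem X).1 hX))
          · rw [Set.indicator_of_notMem hX]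
            have hX' : ∃ k, r < |X k - x k| := by
              by_contra hcon
              push Not at hcon
              exact hX ((hmem X).2 hcon)
            have : yInt a b f τ X = 0 := by
              simp only [yInt, hout X hX', intervalIntegral.integral_zero]
            simp [this]
      _ ≤ ∫⁻ X, S.indicator (fun _ => ENNReal.ofReal N) X := setLIntegral_le_lintegral _ _
      _ = ENNReal.ofReal (N * (2 * r)^3) := by
          rw [lintegral_indicator measurableSet_Icc, setLIntegral_const, hvol,
            ← ENNReal.ofReal_mul hN]
  exact (ENNReal.ofReal_le_ofReal_iff (by positivity)).1 key

theorem yInt_ed_le {a b N : ℝ} (hab : a < b) {v : (Fin 5 → ℝ) → ℝ} (hv : Smooth5 v)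
    (hd : Dirichlet a b v) {t : ℝ} {x : Fin 3 → ℝ}
    (hN : ∀ w : List (Fin 10), w.length ≤ 1 → yInt a b (fun z => pd 4 (tang w v) z ^ 2) t x ≤ N) :
    yInt a b (ed v) t x ≤ (4 * (b - a)^2 + 1) / 2 * N := by
  have c : ∀ i : Fin 5, Continuous fun z => pd i v z ^ 2 := fun i => (hv.pd i).continuous.pow 2
  have e : yInt a b (ed v) t x = 1 / 2 * (yInt a b (fun z => pd 0 v z ^ 2) t x +
      yInt a b (fun z => pd 1 v z ^ 2) t x + yInt a b (fun z => pd 2 v z ^ 2) t x +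
      yInt a b (fun z => pd 3 v z ^ 2) t x + yInt a b (fun z => pd 4 v z ^ 2) t x) := by
    have c2 : Continuous fun z => pd 0 v z ^ 2 + pd 1 v z ^ 2 := (c 0).add (c 1)
    have c3 : Continuous fun z => pd 0 v z ^ 2 + pd 1 v z ^ 2 + pd 2 v z ^ 2 := c2.add (c 2)
    have c4 : Continuous fun z => pd 0 v z ^ 2 + pd 1 v z ^ 2 + pd 2 v z ^ 2 + pd 3 v z ^ 2 :=
      c3.add (c 3)
    rw [← yInt_add (c 0) (c 1), ← yInt_add c2 (c 2), ← yInt_add c3 (c 3), ← yInt_add c4 (c 4),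
      ← yInt_const_mul]
    congr 1
    funext z
    simp only [ed]
    ring
  have h4 := hN [] (by simp)
  have hp : ∀ (i : Fin 5) (j : Fin 10), i ≠ 4 → tang [j] v = pd i v →
      yInt a b (fun z => pd i v z ^ 2) t x ≤ (b - a)^2 * N := by
    intro i j hi hj
    have := hN [j] (by simp)
    rw [hj] at this
    exact (yInt_sq_le_of_dirichlet hab (hv.pd i) (Dirichlet.pd hv hd hi) t x).trans (by gcongr)
  have h0 := hp 0 0 (by decide) rfl
  have h1 := hp 1 1 (by decide) rfl
  have h2 := hp 2 2 (by decide) rfl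
  have h3 := hp 3 3 (by decide) rfl
  have h4' : yInt a b (fun z => pd 4 v z ^ 2) t x ≤ N := h4
  rw [e]
  nlinarith

/-- Fibre energy bound in the interior region slightly before the final time. -/
theorem Ctl.yInt_interior {a b B t D : ℝ} (hab : a < b) (hB : 0 < B) (ht : 2 * B ≤ t)
    {v : (Fin 5 → ℝ) → ℝ} (hv : ∀ w : List (Fin 10), w.length ≤ 4 → Ctl a b B t D (tang w v))
    {l : ℝ} (hl : 10 ≤ l) (htl : t = l^3) (hBt : 2 * B + 1 ≤ t / 2) (X : Fin 3 → ℝ)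
    (hX : ∀ k, |X k| ≤ 3 / 2 * l^2) :
    yInt a b (fun z => pd 4 v z ^ 2) (t - l) X ≤
      24^3 * 4 * 11^4 * 16 * (D^2 / (l^2 / 10)^3) := by
  have hl0 : 0 < l := by linarith
  have hX2 : ∀ k, X k ^ 2 ≤ 9 / 4 * l^4 := fun k => by
    have := pow_le_pow_left₀ (abs_nonneg (X k)) (hX k) 2
    rw [sq_abs] at this
    nlinarith
  have h46 : l^4 ≤ l^6 / 100 := by nlinarith [pow_pos hl0 4, mul_le_mul hl hl (by norm_num) hl0.le]
  have h24 : l^2 ≤ l^4 / 100 := by nlinarith [pow_pos hl0 2, mul_le_mul hl hl (by norm_num) hl0.le]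
  have h23 : l^2 ≤ l^3 / 10 := by nlinarith [pow_pos hl0 2]
  have ht' : 0 < t - l := by rw [htl]; nlinarith
  have hts : (t - l)^2 = l^6 - 2 * l^4 + l^2 := by rw [htl]; ring
  have hpos : 0 < (t - l)^2 - (X 0 ^ 2 + X 1 ^ 2 + X 2 ^ 2) := by
    have := hX2 0; have := hX2 1; have := hX2 2
    have := pow_pos hl0 2; have := pow_pos hl0 6
    linarith
  set δ := Real.sqrt ((t - l)^2 - (X 0 ^ 2 + X 1 ^ 2 + X 2 ^ 2)) with hδdef
  have hδ : 0 < δ := Real.sqrt_pos.2 hpos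
  have hδ2 : δ^2 = (t - l)^2 - (X 0 ^ 2 + X 1 ^ 2 + X 2 ^ 2) := Real.sq_sqrt hpos.le
  have hhyp : hyp δ 0 (pt5 0 X 0) = t - l := by
    have h := hyp_pt5_sq hδ 0 X 0
    rw [hδ2] at h
    exact (sq_eq_sq₀ (hyp_pos hδ _ _).le ht'.le).1 (by linarith)
  rw [← hhyp]
  refine Ctl.yInt_hyperboloid hab hB ht hv hδ (by positivity) X 1 ?_ (by simp) ?_
  · intro k j
    simp only [Matrix.one_apply]
    split_ifs <;> norm_num
  · intro ξ hξ
    have hξ0 : ∀ k, 0 ≤ ξ k := fun k => hξ.1 k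
    have hξ1 : ∀ k, ξ k ≤ l^2 / 10 := fun k => hξ.2 k
    have e : ∀ k, aff X 1 ξ k = X k + ξ k := fun k => by simp [aff]
    have hh := hyp_pt5_sq hδ 0 (aff X 1 ξ) 0
    set h := hyp δ 0 (pt5 0 (aff X 1 ξ) 0) with hdef
    have hh0 : 0 < h := hyp_pos hδ _ _
    have hd : ∀ k, (X k + ξ k)^2 - X k ^ 2 ≤ 31 / 100 * l^4 ∧ -(3 / 10 * l^4) ≤ (X k + ξ k)^2 - X k ^ 2 := by
      intro k
      have h1 := hξ0 k
      have h2 := hξ1 k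
      have h3 := abs_le.1 (hX k)
      constructor
      · have : X k * ξ k ≤ (3 / 2 * l^2) * (l^2 / 10) := by
          calc X k * ξ k ≤ (3 / 2 * l^2) * ξ k := mul_le_mul_of_nonneg_right h3.2 h1
            _ ≤ _ := by gcongr
        have : ξ k * ξ k ≤ (l^2 / 10) * (l^2 / 10) := mul_le_mul h2 h2 h1 (by positivity)
        nlinarith
      · have : -(3 / 2 * l^2) * (l^2 / 10) ≤ X k * ξ k := by
          calc -(3 / 2 * l^2) * (l^2 / 10) ≤ -(3 / 2 * l^2) * ξ k := by nlinarith [sq_nonneg l]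
            _ ≤ _ := mul_le_mul_of_nonneg_right h3.1 h1
        nlinarith [sq_nonneg (ξ k)]
    rw [e, e, e, hδ2, hts] at hh
    have d0 := hd 0; have d1 := hd 1; have d2 := hd 2
    have p4 := pow_pos hl0 4; have p6 := pow_pos hl0 6; have p2 := pow_pos hl0 2
    have hlow : t / 2 ≤ h := by
      refine abs_le_of_sq_le_sq' ?_ hh0.le |>.2
      rw [htl]
      have : (l^3 / 2)^2 = l^6 / 4 := by ring
      rw [this, hh]
      linarith
    refine ⟨mem_box3.2 fun k => ?_, ?_, by linarith, ?_⟩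
    · rw [e]
      have := abs_add_le (X k) (ξ k)
      rw [abs_of_nonneg (hξ0 k)] at this
      have := hX k; have := hξ1 k
      rw [htl]
      linarith
    · rw [htl] at hlow
      linarith
    · refine abs_le_of_sq_le_sq' ?_ (by rw [htl]; positivity) |>.2
      rw [hh, htl]
      have : (l^3)^2 = l^6 := by ring
      rw [this]
      linarith

theorem inward_displacement {r x y z σ₁ σ₂ σ₃ p q s : ℝ} (hr : 0 < r)
    (hxr : x^2 + y^2 + z^2 = r^2) (h1 : σ₁^2 = 1) (h2 : σ₂^2 = 1) (h3 : σ₃^2 = 1)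
    (hx : σ₁ * x = -|x|) (hy : σ₂ * y = -|y|) (hz : σ₃ * z = -|z|)
    (hp : 0 ≤ p) (hq : 0 ≤ q) (hs : 0 ≤ s) (hp' : p ≤ r / 24) (hq' : q ≤ r / 24)
    (hs' : s ≤ r / 24) :
    r^2 / 2 ≤ (x + (σ₁ * p - x / r * (p + q + s)))^2 + (y + (σ₂ * q - y / r * (p + q + s)))^2 +
        (z + (σ₃ * s - z / r * (p + q + s)))^2 ∧
      (x + (σ₁ * p - x / r * (p + q + s)))^2 + (y + (σ₂ * q - y / r * (p + q + s)))^2 +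
        (z + (σ₃ * s - z / r * (p + q + s)))^2 ≤ r^2 := by
  have hS0 : 0 ≤ p + q + s := by positivity
  have hS1 : p + q + s ≤ r / 8 := by linarith
  have hle : ∀ c, c^2 ≤ r^2 → |c| ≤ r := fun c hc => abs_le_of_sq_le_sq hc hr.le
  have hP1 : |x| * p + |y| * q + |z| * s ≤ r * (p + q + s) := by
    have ax := mul_le_mul_of_nonneg_right (hle x (by nlinarith)) hp
    have ay := mul_le_mul_of_nonneg_right (hle y (by nlinarith)) hq
    have az := mul_le_mul_of_nonneg_right (hle z (by nlinarith)) hs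
    linarith
  have hP0 : 0 ≤ |x| * p + |y| * q + |z| * s := by positivity
  have hQ0 : 0 ≤ p^2 + q^2 + s^2 := by positivity
  have hQ1 : p^2 + q^2 + s^2 ≤ (p + q + s)^2 := by
    nlinarith [mul_nonneg hp hq, mul_nonneg hp hs, mul_nonneg hq hs]
  have hnorm : (x + (σ₁ * p - x / r * (p + q + s)))^2 + (y + (σ₂ * q - y / r * (p + q + s)))^2 +
      (z + (σ₃ * s - z / r * (p + q + s)))^2 =
      r^2 - 2 * (|x| * p + |y| * q + |z| * s) - 2 * r * (p + q + s) + (p^2 + q^2 + s^2) +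
        2 * ((p + q + s) / r) * (|x| * p + |y| * q + |z| * s) + (p + q + s)^2 := by
    rw [show |x| = -(σ₁ * x) by linarith, show |y| = -(σ₂ * y) by linarith,
      show |z| = -(σ₃ * z) by linarith]
    have hxr' : x^2 / r^2 + y^2 / r^2 + z^2 / r^2 = 1 := by
      rw [← add_div, ← add_div, hxr, div_self (by positivity)]
    have hxr'' : x^2 / r + y^2 / r + z^2 / r = r := by
      rw [← add_div, ← add_div, hxr, sq, mul_div_assoc, div_self hr.ne', mul_one]
    generalize p + q + s = S
    linear_combination hxr + p^2 * h1 + q^2 * h2 + s^2 * h3 + S^2 * hxr' - 2 * S * hxr''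
  rw [hnorm]
  generalize p + q + s = S at *
  generalize |x| * p + |y| * q + |z| * s = P at *
  generalize p^2 + q^2 + s^2 = Q at *
  constructor
  · have : 0 ≤ S / r * P := by positivity
    have : S * r ≤ r / 8 * r := mul_le_mul_of_nonneg_right hS1 hr.le
    nlinarith [sq_nonneg S]
  · have : S / r * P ≤ 1 / 8 * P := by
      refine mul_le_mul_of_nonneg_right ?_ hP0
      rw [div_le_iff₀ hr]; linarith
    have : S * S ≤ r / 8 * S := mul_le_mul_of_nonneg_right hS1 hS0
    nlinarith [mul_nonneg hr.le hS0]

/-- Fibre energy bound away from the spatial origin. -/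
theorem Ctl.yInt_exterior {a b B t D : ℝ} (hab : a < b) (hB : 0 < B)
    {v : (Fin 5 → ℝ) → ℝ} (hv : ∀ w : List (Fin 10), w.length ≤ 4 → Ctl a b B t D (tang w v))
    (hBt : 2 * B + 1 ≤ t / 2) (x : Fin 3 → ℝ) {r : ℝ} (hr : 0 < r)
    (hxr : x 0 ^ 2 + x 1 ^ 2 + x 2 ^ 2 = r^2) (hrt : r < t) :
    yInt a b (fun z => pd 4 v z ^ 2) t x ≤ 24^3 * 4 * 11^4 * 16 * (D^2 / (r / 24)^3) := by
  have ht0 : 0 < t := by linarith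
  have hpos : 0 < t^2 - r^2 := by nlinarith
  set δ := Real.sqrt (t^2 - r^2) with hδdef
  have hδ : 0 < δ := Real.sqrt_pos.2 hpos
  have hδ2 : δ^2 = t^2 - r^2 := Real.sq_sqrt hpos.le
  have hhyp : hyp δ 0 (pt5 0 x 0) = t := by
    have h := hyp_pt5_sq hδ 0 x 0
    rw [hδ2, hxr] at h
    exact (sq_eq_sq₀ (hyp_pos hδ _ _).le ht0.le).1 (by linarith)
  obtain ⟨σ, hσ1, hσx⟩ : ∃ σ : Fin 3 → ℝ, (∀ k, σ k ^ 2 = 1) ∧ ∀ k, σ k * x k = -|x k| := by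
    refine ⟨fun k => if 0 ≤ x k then -1 else 1, fun k => ?_, fun k => ?_⟩
    · dsimp only; split_ifs <;> norm_num
    · dsimp only
      split_ifs with h
      · rw [abs_of_nonneg h]; ring
      · rw [abs_of_neg (not_le.1 h)]; ring
  have hσabs : ∀ k, |σ k| = 1 := fun k => by
    rw [← sq_eq_sq₀ (abs_nonneg _) zero_le_one, sq_abs, hσ1, one_pow]
  have hxk : ∀ k, |x k| ≤ r := fun k => by
    refine abs_le_of_sq_le_sq ?_ hr.le
    rw [← hxr]
    have h0 := sq_nonneg (x 0); have h1 := sq_nonneg (x 1); have h2 := sq_nonneg (x 2)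
    fin_cases k
    · change x 0 ^ 2 ≤ _; linarith
    · change x 1 ^ 2 ≤ _; linarith
    · change x 2 ^ 2 ≤ _; linarith
  have hxr1 : ∀ k, |x k / r| ≤ 1 := fun k => by
    rw [abs_div, abs_of_pos hr, div_le_one hr]
    exact hxk k
  set M : Matrix (Fin 3) (Fin 3) ℝ := Matrix.of fun k j => (if k = j then σ j else 0) - x k / r
    with hMdef
  have hMdiag : ∀ k, M k k = σ k - x k / r := fun k => by simp [hMdef]
  have hMoff : ∀ k j, k ≠ j → M k j = -(x k / r) := fun k j hkj => by simp [hMdef, hkj]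
  have m01 := hMoff 0 1 (by decide); have m02 := hMoff 0 2 (by decide)
  have m10 := hMoff 1 0 (by decide); have m12 := hMoff 1 2 (by decide)
  have m20 := hMoff 2 0 (by decide); have m21 := hMoff 2 1 (by decide)
  conv_lhs => rw [← hhyp]
  refine Ctl.yInt_hyperboloid hab hB (by linarith) hv hδ (by positivity) x M ?_ ?_ ?_
  · intro k j
    by_cases hkj : k = j
    · subst hkj
      rw [hMdiag]
      have := abs_sub (σ k) (x k / r)
      have := hxr1 k
      have := hσabs k
      linarith
    · rw [hMoff k j hkj, abs_neg]
      linarith [hxr1 k]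
  · have hdet : M.det = σ 0 * σ 1 * σ 2 * (1 + (|x 0| + |x 1| + |x 2|) / r) := by
      have e : (|x 0| + |x 1| + |x 2|) / r = -(σ 0 * (x 0 / r) + σ 1 * (x 1 / r) + σ 2 * (x 2 / r)) := by
        have h0 := hσx 0; have h1 := hσx 1; have h2 := hσx 2
        rw [show |x 0| = -(σ 0 * x 0) by linarith, show |x 1| = -(σ 1 * x 1) by linarith,
          show |x 2| = -(σ 2 * x 2) by linarith]
        ring
      rw [e, Matrix.det_fin_three, hMdiag, hMdiag, hMdiag, m01, m02, m10, m12, m20, m21]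
      have s0 := hσ1 0; have s1 := hσ1 1; have s2 := hσ1 2
      linear_combination (σ 1 * σ 2 * (x 0 / r)) * s0 + (σ 0 * σ 2 * (x 1 / r)) * s1 +
        (σ 0 * σ 1 * (x 2 / r)) * s2
    rw [hdet, abs_mul, abs_mul, abs_mul, hσabs, hσabs, hσabs]
    have : 0 ≤ (|x 0| + |x 1| + |x 2|) / r := by positivity
    rw [abs_of_nonneg (by linarith)]
    linarith
  · intro ξ hξ
    have hξ0 : ∀ k, 0 ≤ ξ k := fun k => hξ.1 k
    have hξ1 : ∀ k, ξ k ≤ r / 24 := fun k => hξ.2 k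
    have e0 : aff x M ξ 0 = x 0 + (σ 0 * ξ 0 - x 0 / r * (ξ 0 + ξ 1 + ξ 2)) := by
      rw [aff_apply, hMdiag, m01, m02]; ring
    have e1 : aff x M ξ 1 = x 1 + (σ 1 * ξ 1 - x 1 / r * (ξ 0 + ξ 1 + ξ 2)) := by
      rw [aff_apply, hMdiag, m10, m12]; ring
    have e2 : aff x M ξ 2 = x 2 + (σ 2 * ξ 2 - x 2 / r * (ξ 0 + ξ 1 + ξ 2)) := by
      rw [aff_apply, hMdiag, m20, m21]; ring
    obtain ⟨hlo, hup⟩ := inward_displacement hr hxr (hσ1 0) (hσ1 1) (hσ1 2) (hσx 0) (hσx 1) (hσx 2)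
      (hξ0 0) (hξ0 1) (hξ0 2) (hξ1 0) (hξ1 1) (hξ1 2)
    rw [← e0, ← e1, ← e2] at hlo hup
    have hh := hyp_pt5_sq hδ 0 (aff x M ξ) 0
    rw [hδ2] at hh
    set h := hyp δ 0 (pt5 0 (aff x M ξ) 0) with hdef
    have hh0 : 0 < h := hyp_pos hδ _ _
    have hlow : t / 2 ≤ h := by
      refine abs_le_of_sq_le_sq' ?_ hh0.le |>.2
      nlinarith
    refine ⟨mem_box3.2 fun k => ?_, by linarith, by linarith, ?_⟩
    · refine abs_le_of_sq_le_sq ?_ ht0.le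
      have q0 := sq_nonneg (aff x M ξ 0); have q1 := sq_nonneg (aff x M ξ 1)
      have q2 := sq_nonneg (aff x M ξ 2)
      fin_cases k
      · change aff x M ξ 0 ^ 2 ≤ _; linarith
      · change aff x M ξ 1 ^ 2 ≤ _; linarith
      · change aff x M ξ 2 ^ 2 ≤ _; linarith
    · refine abs_le_of_sq_le_sq' ?_ ht0.le |>.2
      linarith

/-- Fibre energy bound in the interior region at the final time. -/
theorem Ctl.yInt_core {a b B t D : ℝ} (hab : a < b) (hB : 0 < B)
    {v : (Fin 5 → ℝ) → ℝ} (hv : ∀ w : List (Fin 10), w.length ≤ 8 → Ctl a b B t D (tang w v))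
    {l : ℝ} (hl : 10 ≤ l) (htl : t = l^3) (hBt : 2 * B + 1 ≤ t / 2) (x : Fin 3 → ℝ)
    (hx : ∀ k, |x k| ≤ l^2) :
    yInt a b (fun z => pd 4 v z ^ 2) t x ≤
      20^3 * 11^3 * 4 * ((4 * (b - a)^2 + 1) / 2 * (24^3 * 4 * 11^4 * 16) * 10^6 + 1) *
        (D^2 / l^6) := by
  have hl0 : 0 < l := by linarith
  have ht0 : 0 < t := by linarith
  have ht : 2 * B ≤ t := by linarith
  have h12 : l ≤ l^2 / 10 := by nlinarith
  have h23 : l^2 ≤ l^3 / 10 := by nlinarith [pow_pos hl0 2]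
  have htl2 : t / 2 ≤ t - l := by rw [htl]; linarith
  have hvs : Smooth5 v := (hv [] (by simp)).good.smooth
  set K₀ : ℝ := 24^3 * 4 * 11^4 * 16 with hK₀
  have hK0 : 0 < K₀ := by rw [hK₀]; norm_num
  clear_value K₀
  set A : ℝ := (4 * (b - a)^2 + 1) / 2 with hA
  have hA0 : 0 < A := by positivity
  set χ : (Fin 5 → ℝ) → ℝ :=
    fun z => Real.smoothTransition ((4 * l - (z 0 - t + hyp l x z)) / l) with hχdef
  have hχ : Continuous χ := by
    refine Real.smoothTransition.continuous.comp ?_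
    have := (smooth5_hyp hl0 x).continuous
    fun_prop
  have hχ0 : ∀ z, 0 ≤ χ z := fun z => Real.smoothTransition.nonneg _
  have hmain := yInt_flat_le (t := t) (R := t) (K := 10) (l := l) (c := 4 * (A * K₀ * 10^6 + 1) * (D^2 / l^3))
    hab hl0 (by norm_num) (hvs.pd 4) x ?_ hχ hχ0 ?_ ?_
  · refine hmain.trans (le_of_eq ?_)
    field_simp
    ring
  · intro y
    refine tangCube_flatCurve (by linarith) htl x y fun ξ hξ k => ?_
    have e : aff x 1 ξ k = x k + ξ k := by simp [aff]
    have h1 : 0 ≤ ξ k := hξ.1 k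
    have h2 : ξ k ≤ l := hξ.2 k
    have := abs_add_le (x k) (ξ k)
    rw [abs_of_nonneg h1] at this
    rw [e]
    linarith [hx k]
  · intro ξ hξ
    have e : ∀ k, aff x 1 ξ k = x k + ξ k := fun k => by simp [aff]
    have h1 : ∀ k, 0 ≤ ξ k := fun k => hξ.1 k
    have h2 : ∀ k, ξ k ≤ l := fun k => hξ.2 k
    refine ⟨mem_box3.2 fun k => ?_, fun y => ?_⟩
    · have := abs_add_le (x k) (ξ k)
      rw [abs_of_nonneg (h1 k)] at this
      rw [e, htl]
      linarith [hx k, h2 k]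
    · refine (Real.smoothTransition.one_of_one_le ?_).ge
      rw [le_div_iff₀ hl0, pt5_zero]
      have hh := hyp_sq hl0 x (pt5 t (aff x 1 ξ) y)
      simp only [pt5_one, pt5_two, pt5_three, e, add_sub_cancel_left] at hh
      have : hyp l x (pt5 t (aff x 1 ξ) y) ≤ 2 * l := by
        refine abs_le_of_sq_le_sq' ?_ (by linarith) |>.2
        rw [hh]
        nlinarith [mul_le_mul (h2 0) (h2 0) (h1 0) hl0.le, mul_le_mul (h2 1) (h2 1) (h1 1) hl0.le,
          mul_le_mul (h2 2) (h2 2) (h1 2) hl0.le]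
      linarith
  · intro w hw
    have hV := hv w (by omega)
    set V := tang w v with hVdef
    have hVs : Smooth5 V := hV.good.smooth
    have hcomm : tang w (pd 4 v) = pd 4 V := (pd_four_opIter hvs _).symm
    have hedc : Continuous fun z => χ z * ed V z := hχ.mul hVs.ed.continuous
    have hM0 : boxInt t a b (fun z => χ z * ed V z) (t - l) ≤
        A * (K₀ * (D^2 / (l^2 / 10)^3)) * (2 * (5 * l))^3 := by
      refine boxInt_le_of_cube hab (by linarith) hedc (fun z => mul_nonneg (hχ0 z) (ed_nonneg V z))
        x ?_ ?_
      · rintro X ⟨k, hk⟩ y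
        have hle : |X k - x k| ≤ hyp l x (pt5 (t - l) X y) := by
          refine abs_le_of_sq_le_sq ?_ (hyp_pos hl0 _ _).le
          rw [hyp_sq hl0]
          simp only [pt5_one, pt5_two, pt5_three]
          have q0 := sq_nonneg (X 0 - x 0); have q1 := sq_nonneg (X 1 - x 1)
          have q2 := sq_nonneg (X 2 - x 2); have q := sq_nonneg l
          fin_cases k
          · change (X 0 - x 0)^2 ≤ _; linarith
          · change (X 1 - x 1)^2 ≤ _; linarith
          · change (X 2 - x 2)^2 ≤ _; linarith
        have : χ (pt5 (t - l) X y) = 0 := by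
          refine Real.smoothTransition.zero_of_nonpos ?_
          rw [pt5_zero]
          exact div_nonpos_of_nonpos_of_nonneg (by linarith) hl0.le
        rw [this, zero_mul]
      · intro X hX
        refine (yInt_mono hab hedc hVs.ed.continuous (fun z => ?_) _ X).trans
          (yInt_ed_le hab hVs hV.good.dirichlet fun w' hw' => ?_)
        · exact mul_le_of_le_one_left (ed_nonneg V z) (Real.smoothTransition.le_one _)
        · rw [hK₀]
          refine Ctl.yInt_interior hab hB ht (fun w'' hw'' => ?_) hl htl hBt X fun k => ?_
          · rw [hVdef, tang_tang, tang_tang]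
            refine hv _ ?_
            simp only [List.length_append]
            omega
          · have h1 := abs_add_le (X k - x k) (x k)
            rw [sub_add_cancel] at h1
            linarith [hX k, hx k]
    have hloc := hV.local_energy hab hB hl0 (by linarith) htl2 x
    rw [hcomm]
    have hle : boxInt t a b (fun z => χ z * pd 4 V z ^ 2) t ≤ 2 * boxInt t a b (fun z => χ z * ed V z) t := by
      rw [boxInt, boxInt, ← integral_const_mul]
      refine boxInt_mono t a b t (f := fun z => χ z * pd 4 V z ^ 2)
        (g := fun z => 2 * (χ z * ed V z)) (hχ.mul ((hVs.pd 4).continuous.pow 2))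
        (continuous_const.mul hedc) fun z => ?_
      have : pd 4 V z ^ 2 ≤ 2 * ed V z := by
        unfold ed
        nlinarith [sq_nonneg (pd 0 V z), sq_nonneg (pd 1 V z), sq_nonneg (pd 2 V z),
          sq_nonneg (pd 3 V z)]
      nlinarith [hχ0 z]
    have e1 : A * (K₀ * (D^2 / (l^2 / 10)^3)) * (2 * (5 * l))^3 = A * K₀ * 10^6 * (D^2 / l^3) := by
      field_simp
      ring
    have e2 : (l * (D / t))^2 ≤ D^2 / l^3 := by
      rw [htl]
      have : (l * (D / l^3))^2 = D^2 / l^3 / l := by field_simp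
      rw [this]
      exact div_le_self (by positivity) (by linarith)
    rw [e1] at hM0
    change boxInt t a b (fun z => χ z * ed V z) t ≤
      2 * boxInt t a b (fun z => χ z * ed V z) (t - l) + _ at hloc
    refine hle.trans ?_
    have e3 : 4 * (A * K₀ * 10^6 + 1) * (D^2 / l^3) =
      2 * (2 * (A * K₀ * 10^6 * (D^2 / l^3)) + 2 * (D^2 / l^3)) := by ring
    rw [e3]
    linarith

theorem boxInt_pd_sq_le_ed (R a b τ : ℝ) {v : (Fin 5 → ℝ) → ℝ} (hv : Smooth5 v) :
    boxInt R a b (fun z => pd 4 v z ^ 2) τ ≤ 2 * boxInt R a b (ed v) τ := by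
  rw [boxInt, boxInt, ← integral_const_mul]
  refine boxInt_mono R a b τ (f := fun z => pd 4 v z ^ 2) (g := fun z => 2 * ed v z)
    ((hv.pd 4).continuous.pow 2) (continuous_const.mul hv.ed.continuous) fun z => ?_
  unfold ed
  nlinarith [sq_nonneg (pd 0 v z), sq_nonneg (pd 1 v z), sq_nonneg (pd 2 v z),
    sq_nonneg (pd 3 v z)]

theorem yInt_eq_zero_of_far {a b B : ℝ} (hab : a < b) {f : (Fin 5 → ℝ) → ℝ}
    (hf : Vanish a b B f) {t : ℝ} (ht : 0 ≤ t) {x : Fin 3 → ℝ}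
    (hx : t - B < Real.sqrt (x 0 ^ 2 + x 1 ^ 2 + x 2 ^ 2)) :
    yInt a b (fun z => f z ^ 2) t x = 0 := by
  rw [yInt, intervalIntegral.integral_congr (g := fun _ => 0), intervalIntegral.integral_zero]
  intro y hy
  rw [Set.uIcc_of_le hab.le] at hy
  change f (pt5 t x y) ^ 2 = 0
  rw [hf.far (pt5 t x y) hy ht hx]
  ring

/-- Uniform decay of the fibre energy of a controlled Dirichlet wave. -/
theorem Ctl.exists_yInt_decay {a b B : ℝ} (hab : a < b) (hB : 0 < B) :
    ∃ C : ℝ, 0 < C ∧ ∀ (v : (Fin 5 → ℝ) → ℝ) (t D : ℝ), 2 * B ≤ t →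
      (∀ w : List (Fin 10), w.length ≤ 8 → Ctl a b B t D (tang w v)) → ∀ x,
        (1 + t)^2 * yInt a b (fun z => pd 4 v z ^ 2) t x ≤ C * D^2 := by
  set T₀ := 1002 + 4 * B with hT₀
  set K₁ : ℝ := 20^3 * 11^3 * 4 * ((4 * (b - a)^2 + 1) / 2 * (24^3 * 4 * 11^4 * 16) * 10^6 + 1)
    with hK₁
  set K₂ : ℝ := 24^3 * 4 * 11^4 * 16 * 24^3 with hK₂
  set K₃ : ℝ := (1 + T₀)^2 * (8 * 11^3 * 4) with hK₃
  have hT0 : 0 < T₀ := by positivity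
  have h1 : 0 < K₁ := by positivity
  have h2 : 0 < K₂ := by positivity
  have h3 : 0 < K₃ := by positivity
  refine ⟨4 * K₁ + 4 * K₂ + K₃, by positivity, fun v t D ht hv x => ?_⟩
  have hv0 : Ctl a b B t D v := hv [] (by simp)
  have hvs : Smooth5 v := hv0.good.smooth
  have hD : 0 ≤ D := hv0.nonneg ht
  have hD2 : 0 ≤ D^2 := sq_nonneg D
  have hvan : Vanish a b B (pd 4 v) := hv0.good.vanish.pd hab hB hvs 4
  rcases le_total t T₀ with htT | htT
  · have hy := yInt_sq_le_L2ab hab hB (hvs.pd 4) hvan (t := t) (S := 2 * D) (by linarith) x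
      fun w hw => by
        have hV := hv w (by omega)
        have hcomm : tang w (pd 4 v) = pd 4 (tang w v) := (pd_four_opIter hvs _).symm
        rw [hcomm, L2ab_eq_boxInt hB (hV.good.smooth.pd 4).continuous
          (hV.good.vanish.pd hab hB hV.good.smooth 4) (by linarith) le_rfl]
        refine Real.sqrt_le_iff.2 ⟨by linarith, ?_⟩
        have e1 := boxInt_pd_sq_le_ed t a b t hV.good.smooth
        have e2 := hV.flat_energy hab hB (τ := t) ⟨ht, le_rfl⟩
        nlinarith
    have hsq : (1 + t)^2 ≤ (1 + T₀)^2 := pow_le_pow_left₀ (by linarith) (by linarith) 2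
    calc (1 + t)^2 * yInt a b (fun z => pd 4 v z ^ 2) t x
        ≤ (1 + T₀)^2 * (8 * 11^3 * (2 * D)^2) := mul_le_mul hsq hy
          (yInt_nonneg hab (fun _ => sq_nonneg _) t x) (sq_nonneg _)
      _ = K₃ * D^2 := by rw [hK₃]; ring
      _ ≤ _ := by gcongr; linarith
  · have ht0 : 0 < t := by linarith
    obtain ⟨l, hl, htl⟩ : ∃ l : ℝ, 10 ≤ l ∧ t = l^3 := by
      refine ⟨t ^ ((1:ℝ) / 3), ?_, ?_⟩
      · have h1000 : (10 : ℝ) = (1000 : ℝ) ^ ((1:ℝ) / 3) := by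
          rw [show (1000 : ℝ) = 10 ^ (3:ℝ) by norm_num, ← Real.rpow_mul (by norm_num)]
          norm_num
        rw [h1000]
        exact Real.rpow_le_rpow (by norm_num) (by linarith) (by norm_num)
      · rw [← Real.rpow_natCast, ← Real.rpow_mul ht0.le]
        norm_num
    have hl0 : 0 < l := by linarith
    have hBt : 2 * B + 1 ≤ t / 2 := by linarith
    have hsq : (1 + t)^2 ≤ 4 * l^6 := by
      have : l^6 = t^2 := by rw [htl]; ring
      nlinarith
    have hfin : ∀ K, 0 < K → K ≤ K₁ + K₂ → yInt a b (fun z => pd 4 v z ^ 2) t x ≤ K * (D^2 / l^6) →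
        (1 + t)^2 * yInt a b (fun z => pd 4 v z ^ 2) t x ≤ (4 * K₁ + 4 * K₂ + K₃) * D^2 := by
      intro K hK hKK h
      calc (1 + t)^2 * yInt a b (fun z => pd 4 v z ^ 2) t x
          ≤ 4 * l^6 * (K * (D^2 / l^6)) := mul_le_mul hsq h
            (yInt_nonneg hab (fun _ => sq_nonneg _) t x) (by positivity)
        _ = 4 * K * D^2 := by field_simp
        _ ≤ _ := by gcongr; linarith
    by_cases hx : ∀ k, |x k| ≤ l^2
    · exact hfin K₁ h1 (by linarith) (Ctl.yInt_core hab hB hv hl htl hBt x hx)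
    · push Not at hx
      obtain ⟨k, hk⟩ := hx
      set r := Real.sqrt (x 0 ^ 2 + x 1 ^ 2 + x 2 ^ 2) with hr
      have hr2 : x 0 ^ 2 + x 1 ^ 2 + x 2 ^ 2 = r^2 := (Real.sq_sqrt (by positivity)).symm
      have hlr : l^2 ≤ r := by
        refine hk.le.trans (abs_le_of_sq_le_sq ?_ (Real.sqrt_nonneg _))
        rw [← hr2]
        have h0 := sq_nonneg (x 0); have h1 := sq_nonneg (x 1); have h2 := sq_nonneg (x 2)
        fin_cases k
        · change x 0 ^ 2 ≤ _; linarith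
        · change x 1 ^ 2 ≤ _; linarith
        · change x 2 ^ 2 ≤ _; linarith
      have hr0 : 0 < r := by nlinarith
      by_cases hfar : t - B < r
      · rw [yInt_eq_zero_of_far hab hvan ht0.le hfar]
        have : 0 ≤ (4 * K₁ + 4 * K₂ + K₃) * D^2 := by positivity
        linarith
      · refine hfin K₂ h2 (by linarith) ((Ctl.yInt_exterior hab hB (fun w hw => hv w (by omega))
          hBt x hr0 hr2 (by linarith)).trans ?_)
        have e : (l^2 / 24)^3 ≤ (r / 24)^3 := by gcongr
        have e2 : D^2 / (r / 24)^3 ≤ D^2 / (l^2 / 24)^3 :=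
          div_le_div_of_nonneg_left hD2 (by positivity) e
        have e3 : D^2 / (l^2 / 24)^3 = 24^3 * (D^2 / l^6) := by field_simp
        rw [hK₂]
        rw [e3] at e2
        nlinarith

/-- Control, by `D` and `S`, of the derivatives of the source of `u` up to time `t`. -/
structure SourceCtl (a b B t : ℝ) (N : ℕ) (D S : ℝ) (u : (Fin 5 → ℝ) → ℝ) : Prop where
  int_le : ∀ W : List (Fin 11), W.length ≤ N + 10 →
    ∫ τ in (2*B)..t, L2ab a b (opIter G5 W (Box5 u)) τ ≤ D
  mul_le : ∀ W : List (Fin 11), W.length ≤ N + 10 → ∀ τ ∈ Set.Icc (2*B) t, t / 2 ≤ τ →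
    t * L2ab a b (opIter G5 W (Box5 u)) τ ≤ D
  slice_le : ∀ W : List (Fin 11), W.length ≤ N + 6 → L2ab a b (opIter G5 W (Box5 u)) t ≤ S

theorem Good.tang {a b B : ℝ} (hab : a < b) (hB : 0 < B) {v : (Fin 5 → ℝ) → ℝ} (h : Good a b B v)
    (w : List (Fin 10)) : Good a b B (tang w v) := by
  induction w with
  | nil => exact h
  | cons i w ih => exact ih.G5 hab hB i

theorem pd_four_eq_opIter (f : (Fin 5 → ℝ) → ℝ) : pd 4 f = opIter G5 [Fin.last 10] f := by
  change _ = G5 (Fin.last 10) f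
  rw [G5_last]

theorem SourceCtl.nonneg {a b B t D S : ℝ} {N : ℕ} {u : (Fin 5 → ℝ) → ℝ} (ht : 2 * B ≤ t)
    (h : SourceCtl a b B t N D S u) : 0 ≤ D ∧ 0 ≤ S :=
  ⟨(intervalIntegral.integral_nonneg ht fun _ _ => L2ab_nonneg _ _ _ _).trans
    (h.int_le [] (by simp)), (L2ab_nonneg _ _ _ _).trans (h.slice_le [] (by simp))⟩

theorem SourceCtl.ctl {a b B t D S : ℝ} {N : ℕ} {u : (Fin 5 → ℝ) → ℝ} (hab : a < b) (hB : 0 < B)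
    (hu : NeumannSol a b B u) (h : SourceCtl a b B t N D S u) {w : List (Fin 10)}
    (hw : w.length ≤ N + 9) : Ctl a b B t D (tang w (pd 4 u)) := by
  have e : Box5 (tang w (pd 4 u)) =
      opIter G5 (w.map Fin.castSucc ++ [Fin.last 10]) (Box5 u) := by
    rw [Box5_opIter (hu.smooth.pd 4), pd_four_eq_opIter, Box5_opIter hu.smooth, opIter_append]
  have hlen : (w.map Fin.castSucc ++ [Fin.last 10]).length ≤ N + 10 := by simp; omega
  refine ⟨(hu.good hab hB).tang hab hB w, ?_, ?_⟩
  · rw [e]; exact h.int_le _ hlen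
  · rw [e]; exact h.mul_le _ hlen

theorem SourceCtl.source_yInt_le {a b B t D S : ℝ} {N : ℕ} {u : (Fin 5 → ℝ) → ℝ} (hab : a < b)
    (hB : 0 < B) (ht : 2 * B ≤ t) (hu : NeumannSol a b B u) (h : SourceCtl a b B t N D S u)
    {W : List (Fin 11)} (hW : W.length ≤ N + 3) (x : Fin 3 → ℝ) :
    yInt a b (fun z => opIter G5 W (Box5 u) z ^ 2) t x ≤ 8 * 11^3 * S^2 := by
  have hv := (hu.vanish hab hB).Box5 hab hB hu.smooth
  have hs := hu.smooth.Box5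
  refine yInt_sq_le_L2ab hab hB (hs.opIter W) (hv.opIter hab hB hs W) (by linarith) x fun w hw => ?_
  rw [tang, ← opIter_append]
  refine h.slice_le _ ?_
  simp
  omega

theorem SourceCtl.source_sq_le {a b B t D S : ℝ} {N : ℕ} {u : (Fin 5 → ℝ) → ℝ} (hab : a < b)
    (hB : 0 < B) (ht : 2 * B ≤ t) (hu : NeumannSol a b B u) (h : SourceCtl a b B t N D S u)
    {W : List (Fin 11)} (hW : W.length ≤ N + 2) (x : Fin 3 → ℝ) {y : ℝ} (hy : y ∈ Set.Icc a b) :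
    opIter G5 W (Box5 u) (pt5 t x y) ^ 2 ≤ (2 / (b - a) + 2 * (b - a)) * (8 * 11^3) * S^2 := by
  have hd : 0 < b - a := by linarith
  have h1 := h.source_yInt_le hab hB ht hu (W := W) (by omega) x
  have h2 := h.source_yInt_le hab hB ht hu (W := Fin.last 10 :: W) (by simpa using hW) x
  have e : opIter G5 (Fin.last 10 :: W) (Box5 u) = pd 4 (opIter G5 W (Box5 u)) := by
    change G5 (Fin.last 10) _ = _
    rw [G5_last]
  rw [e] at h2
  refine (sq_le_yInt_sobolev hab (hu.smooth.Box5.opIter W) t x hy).trans ?_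
  have h3 := mul_le_mul_of_nonneg_left h1 (show 0 ≤ 2 / (b - a) by positivity)
  have h4 := mul_le_mul_of_nonneg_left h2 (show 0 ≤ 2 * (b - a) by positivity)
  linarith

theorem exists_opIter_eq_tang {f : (Fin 5 → ℝ) → ℝ} (hf : Smooth5 f) (L : List (Fin 11)) :
    ∃ (w : List (Fin 10)) (j : ℕ), w.length + j = L.length ∧
      opIter G5 L f = tang w (opIter G5 (List.replicate j (Fin.last 10)) f) := by
  induction L with
  | nil => exact ⟨[], 0, rfl, rfl⟩
  | cons i L ih =>
    obtain ⟨w, j, hlen, he⟩ := ih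
    rcases Fin.eq_castSucc_or_eq_last i with ⟨k, rfl⟩ | rfl
    · refine ⟨k :: w, j, by simp only [List.length_cons]; omega, ?_⟩
      change G5 k.castSucc (opIter G5 L f) = G5 k.castSucc (tang w _)
      rw [he]
    · refine ⟨w, j + 1, by simp only [List.length_cons]; omega, ?_⟩
      change G5 (Fin.last 10) (opIter G5 L f) = _
      rw [he, G5_last, pd_four_opIter (hf.opIter _)]
      simp only [List.replicate_succ, opIter, G5_last]

theorem abs_le_of_sq_le_mul_sq {f K E : ℝ} (hK : 0 ≤ K) (hE : 0 ≤ E) (h : f^2 ≤ K * E^2) :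
    |f| ≤ (K + 1) * E := by
  refine abs_le_of_sq_le_sq (h.trans ?_) (by positivity)
  rw [mul_pow]
  have : K ≤ (K + 1)^2 := by nlinarith
  gcongr

theorem pd_four_pd_four (f : (Fin 5 → ℝ) → ℝ) (z : Fin 5 → ℝ) :
    pd 4 (pd 4 f) z = pd 0 (pd 0 f) z - pd 1 (pd 1 f) z - pd 2 (pd 2 f) z - pd 3 (pd 3 f) z -
      Box5 f z := by
  simp only [Box5]
  ring

theorem yInt_pd_four_sq_le {a b N M : ℝ} (hab : a < b) {v : (Fin 5 → ℝ) → ℝ} (hv : Smooth5 v)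
    (hd : Dirichlet a b v) {t : ℝ} {x : Fin 3 → ℝ}
    (hN : ∀ w : List (Fin 10), w.length ≤ 2 → yInt a b (fun z => pd 4 (tang w v) z ^ 2) t x ≤ N)
    (hM : yInt a b (fun z => Box5 v z ^ 2) t x ≤ M) :
    yInt a b (fun z => pd 4 (pd 4 v) z ^ 2) t x ≤ 5 * (4 * (b - a)^2 * N + M) := by
  have c : ∀ i : Fin 5, Continuous fun z => pd i (pd i v) z ^ 2 :=
    fun i => ((hv.pd i).pd i).continuous.pow 2
  have cb : Continuous fun z => Box5 v z ^ 2 := hv.Box5.continuous.pow 2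
  have hp : ∀ (i : Fin 5) (j : Fin 10), i ≠ 4 → tang [j, j] v = pd i (pd i v) →
      yInt a b (fun z => pd i (pd i v) z ^ 2) t x ≤ (b - a)^2 * N := by
    intro i j hi hj
    have := hN [j, j] (by simp)
    rw [hj] at this
    exact (yInt_sq_le_of_dirichlet hab ((hv.pd i).pd i)
      (Dirichlet.pd (hv.pd i) (Dirichlet.pd hv hd hi) hi) t x).trans (by gcongr)
  have h0 := hp 0 0 (by decide) rfl
  have h1 := hp 1 1 (by decide) rfl
  have h2 := hp 2 2 (by decide) rfl
  have h3 := hp 3 3 (by decide) rfl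
  have c2 : Continuous fun z => pd 0 (pd 0 v) z ^ 2 + pd 1 (pd 1 v) z ^ 2 := (c 0).add (c 1)
  have c3 : Continuous fun z => pd 0 (pd 0 v) z ^ 2 + pd 1 (pd 1 v) z ^ 2 + pd 2 (pd 2 v) z ^ 2 :=
    c2.add (c 2)
  have c4 : Continuous fun z => pd 0 (pd 0 v) z ^ 2 + pd 1 (pd 1 v) z ^ 2 + pd 2 (pd 2 v) z ^ 2 +
      pd 3 (pd 3 v) z ^ 2 := c3.add (c 3)
  have c5 : Continuous fun z => pd 0 (pd 0 v) z ^ 2 + pd 1 (pd 1 v) z ^ 2 + pd 2 (pd 2 v) z ^ 2 +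
      pd 3 (pd 3 v) z ^ 2 + Box5 v z ^ 2 := c4.add cb
  have hpt : ∀ z, pd 4 (pd 4 v) z ^ 2 ≤ 5 * (pd 0 (pd 0 v) z ^ 2 + pd 1 (pd 1 v) z ^ 2 +
      pd 2 (pd 2 v) z ^ 2 + pd 3 (pd 3 v) z ^ 2 + Box5 v z ^ 2) := by
    intro z
    rw [pd_four_pd_four]
    generalize pd 0 (pd 0 v) z = p
    generalize pd 1 (pd 1 v) z = q
    generalize pd 2 (pd 2 v) z = r
    generalize pd 3 (pd 3 v) z = s
    generalize Box5 v z = e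
    nlinarith [sq_nonneg (p + q), sq_nonneg (p + r), sq_nonneg (p + s), sq_nonneg (p + e),
      sq_nonneg (q - r), sq_nonneg (q - s), sq_nonneg (q - e), sq_nonneg (r - s),
      sq_nonneg (r - e), sq_nonneg (s - e)]
  have c6 : Continuous fun z => 5 * (pd 0 (pd 0 v) z ^ 2 + pd 1 (pd 1 v) z ^ 2 +
      pd 2 (pd 2 v) z ^ 2 + pd 3 (pd 3 v) z ^ 2 + Box5 v z ^ 2) := continuous_const.mul c5
  have hle := yInt_mono hab (c 4) c6 hpt t x
  rw [yInt_const_mul, yInt_add c4 cb, yInt_add c3 (c 3), yInt_add c2 (c 2),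
    yInt_add (c 0) (c 1)] at hle
  linarith

theorem exists_pointwise_bound {a b B : ℝ} (hab : a < b) (hB : 0 < B) (j : ℕ) :
    ∃ C : ℝ, 0 < C ∧ ∀ (u : (Fin 5 → ℝ) → ℝ) (t D S : ℝ) (N : ℕ), 2 * B ≤ t →
      NeumannSol a b B u → SourceCtl a b B t N D S u → ∀ w : List (Fin 10), w.length + j ≤ N →
        ∀ x, ∀ y ∈ Set.Icc a b,
          (1 + t) * |tang w (opIter G5 (List.replicate j (Fin.last 10)) (pd 4 u)) (pt5 t x y)| ≤
            C * (D + (1 + t) * S) := by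
  obtain ⟨K, hK, hdecay⟩ := Ctl.exists_yInt_decay hab hB
  have hd : 0 < b - a := by linarith
  induction j using Nat.twoStepInduction with
  | zero =>
    refine ⟨(b - a) * K + 1, by positivity, fun u t D S N ht hu h w hw x y hy => ?_⟩
    have ht0 : 0 < t := by linarith
    obtain ⟨hD, hS⟩ := h.nonneg ht
    have hg := (hu.good hab hB).tang hab hB w
    have h1 := hdecay (tang w (pd 4 u)) t D ht (fun w' hw' => by
      rw [tang_tang]
      exact h.ctl hab hB hu (by simp only [List.length_append]; omega)) x
    have h2 := sq_le_yInt_of_dirichlet hg.smooth hg.dirichlet t x hy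
    change (1 + t) * |tang w (pd 4 u) (pt5 t x y)| ≤ _
    rw [← abs_of_pos (show 0 < 1 + t by linarith), ← abs_mul, abs_of_pos (show 0 < 1 + t by linarith)]
    refine abs_le_of_sq_le_mul_sq (by positivity) (by positivity) ?_
    have hDE : D^2 ≤ (D + (1 + t) * S)^2 := by
      gcongr
      have : 0 ≤ (1 + t) * S := by positivity
      linarith
    calc ((1 + t) * tang w (pd 4 u) (pt5 t x y))^2
        = (1 + t)^2 * tang w (pd 4 u) (pt5 t x y) ^ 2 := by ring
      _ ≤ (1 + t)^2 * ((b - a) * yInt a b (fun z => pd 4 (tang w (pd 4 u)) z ^ 2) t x) := by gcongr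
      _ = (b - a) * ((1 + t)^2 * yInt a b (fun z => pd 4 (tang w (pd 4 u)) z ^ 2) t x) := by ring
      _ ≤ (b - a) * (K * D^2) := by gcongr
      _ ≤ (b - a) * (K * (D + (1 + t) * S)^2) := by gcongr
      _ = _ := by ring
  | one =>
    set A := 2 / (b - a) * K + 2 * (b - a) * (5 * (4 * (b - a)^2 * K + 8 * 11^3)) with hA
    have hA0 : 0 < A := by positivity
    refine ⟨A + 1, by positivity, fun u t D S N ht hu h w hw x y hy => ?_⟩
    have ht0 : 0 < t := by linarith
    obtain ⟨hD, hS⟩ := h.nonneg ht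
    have hg := (hu.good hab hB).tang hab hB w
    set v := tang w (pd 4 u) with hv
    have e : tang w (opIter G5 (List.replicate 1 (Fin.last 10)) (pd 4 u)) = pd 4 v := by
      rw [hv, pd_four_opIter (hu.smooth.pd 4)]
      simp only [List.replicate_succ, List.replicate_zero, opIter, G5_last, id]
    have hN : ∀ w' : List (Fin 10), w'.length ≤ 2 →
        yInt a b (fun z => pd 4 (tang w' v) z ^ 2) t x ≤ K * D^2 / (1 + t)^2 := by
      intro w' hw'
      rw [le_div_iff₀ (by positivity), mul_comm]
      refine hdecay _ t D ht (fun w'' hw'' => ?_) x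
      rw [hv, tang_tang, tang_tang]
      exact h.ctl hab hB hu (by simp only [List.length_append]; omega)
    have hM : yInt a b (fun z => Box5 v z ^ 2) t x ≤ 8 * 11^3 * S^2 := by
      have eb : Box5 v = opIter G5 (w.map Fin.castSucc ++ [Fin.last 10]) (Box5 u) := by
        rw [hv, Box5_opIter (hu.smooth.pd 4), pd_four_eq_opIter, Box5_opIter hu.smooth,
          opIter_append]
      rw [eb]
      exact h.source_yInt_le hab hB ht hu (by simp; omega) x
    have h1 := sq_le_yInt_sobolev hab (hg.smooth.pd 4) t x hy
    have h2 := yInt_pd_four_sq_le hab hg.smooth hg.dirichlet hN hM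
    have h3 := hN [] (by simp)
    change yInt a b (fun z => pd 4 v z ^ 2) t x ≤ _ at h3
    rw [e, ← abs_of_pos (show 0 < 1 + t by linarith), ← abs_mul,
      abs_of_pos (show 0 < 1 + t by linarith)]
    refine abs_le_of_sq_le_mul_sq hA0.le (by positivity) ?_
    set E := D + (1 + t) * S with hE
    have hDE : D^2 ≤ E^2 := by
      gcongr
      have : 0 ≤ (1 + t) * S := by positivity
      linarith
    have hSE : ((1 + t) * S)^2 ≤ E^2 := by
      gcongr
      linarith
    have hle : pd 4 v (pt5 t x y) ^ 2 ≤ 2 / (b - a) * (K * D^2 / (1 + t)^2) +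
        2 * (b - a) * (5 * (4 * (b - a)^2 * (K * D^2 / (1 + t)^2) + 8 * 11^3 * S^2)) :=
      h1.trans (by gcongr)
    calc ((1 + t) * pd 4 v (pt5 t x y))^2 = (1 + t)^2 * pd 4 v (pt5 t x y) ^ 2 := by ring
      _ ≤ (1 + t)^2 * (2 / (b - a) * (K * D^2 / (1 + t)^2) +
        2 * (b - a) * (5 * (4 * (b - a)^2 * (K * D^2 / (1 + t)^2) + 8 * 11^3 * S^2))) := by gcongr
      _ = 2 / (b - a) * (K * D^2) +
          2 * (b - a) * (5 * (4 * (b - a)^2 * (K * D^2) + 8 * 11^3 * ((1 + t) * S)^2)) := by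
        field_simp
      _ ≤ 2 / (b - a) * (K * E^2) +
          2 * (b - a) * (5 * (4 * (b - a)^2 * (K * E^2) + 8 * 11^3 * E^2)) := by gcongr
      _ = _ := by rw [hA]; ring
  | more j ih _ =>
    obtain ⟨C, hC, ih⟩ := ih
    set A := (2 / (b - a) + 2 * (b - a)) * (8 * 11^3) with hA
    have hA0 : 0 < A := by positivity
    refine ⟨4 * C + (A + 1), by positivity, fun u t D S N ht hu h w hw x y hy => ?_⟩
    have ht0 : 0 < t := by linarith
    obtain ⟨hD, hS⟩ := h.nonneg ht
    set g := opIter G5 (List.replicate j (Fin.last 10)) (pd 4 u) with hg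
    have hgs : Smooth5 g := (hu.smooth.pd 4).opIter _
    set Q := tang w g with hQ
    have e : tang w (opIter G5 (List.replicate (j + 1 + 1) (Fin.last 10)) (pd 4 u)) =
        pd 4 (pd 4 Q) := by
      rw [hQ, pd_four_opIter hgs, pd_four_opIter (hgs.pd 4)]
      simp only [List.replicate_succ, opIter, G5_last, ← hg]
    have hsecond : ∀ i : Fin 10, (1 + t) * |G5 i.castSucc (G5 i.castSucc Q) (pt5 t x y)| ≤
        C * (D + (1 + t) * S) := fun i =>
      ih u t D S N ht hu h (i :: i :: w) (by simp only [List.length_cons]; omega) x y hy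
    have h0 : (1 + t) * |pd 0 (pd 0 Q) (pt5 t x y)| ≤ _ := hsecond 0
    have h1 : (1 + t) * |pd 1 (pd 1 Q) (pt5 t x y)| ≤ _ := hsecond 1
    have h2 : (1 + t) * |pd 2 (pd 2 Q) (pt5 t x y)| ≤ _ := hsecond 2
    have h3 : (1 + t) * |pd 3 (pd 3 Q) (pt5 t x y)| ≤ _ := hsecond 3
    have hb : |Box5 Q (pt5 t x y)| ≤ (A + 1) * S := by
      have eb : Box5 Q = opIter G5 (w.map Fin.castSucc ++
          (List.replicate j (Fin.last 10) ++ [Fin.last 10])) (Box5 u) := by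
        rw [hQ, Box5_opIter hgs, hg, Box5_opIter (hu.smooth.pd 4), pd_four_eq_opIter,
          Box5_opIter hu.smooth, opIter_append, opIter_append]
      rw [eb]
      exact abs_le_of_sq_le_mul_sq hA0.le hS
        (h.source_sq_le hab hB ht hu (by simp; omega) x hy)
    rw [e, pd_four_pd_four]
    have hb' : (1 + t) * |Box5 Q (pt5 t x y)| ≤ (A + 1) * (D + (1 + t) * S) := by
      calc (1 + t) * |Box5 Q (pt5 t x y)| ≤ (1 + t) * ((A + 1) * S) := by gcongr
        _ = (A + 1) * ((1 + t) * S) := by ring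
        _ ≤ _ := by gcongr; linarith
    have htri : |pd 0 (pd 0 Q) (pt5 t x y) - pd 1 (pd 1 Q) (pt5 t x y) -
        pd 2 (pd 2 Q) (pt5 t x y) - pd 3 (pd 3 Q) (pt5 t x y) - Box5 Q (pt5 t x y)| ≤
        |pd 0 (pd 0 Q) (pt5 t x y)| + |pd 1 (pd 1 Q) (pt5 t x y)| +
        |pd 2 (pd 2 Q) (pt5 t x y)| + |pd 3 (pd 3 Q) (pt5 t x y)| + |Box5 Q (pt5 t x y)| := by
      refine (abs_sub _ _).trans (add_le_add_left ?_ _)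
      refine (abs_sub _ _).trans (add_le_add_left ?_ _)
      refine (abs_sub _ _).trans (add_le_add_left ?_ _)
      exact abs_sub _ _
    refine (mul_le_mul_of_nonneg_left htri (by linarith)).trans ?_
    linarith

/-- The `k`-th summand of `dyadic g B t`. -/
def dyadicTerm (g : ℝ → ℝ) (B t : ℝ) (k : ℤ) : ℝ :=
  sSup ((fun τ => (2:ℝ)^k * g τ) ''
    (Set.Icc ((2:ℝ)^(k-1)) ((2:ℝ)^(k+1)) ∩ Set.Icc (2*B) t))

theorem dyadicTerm_nonneg {g : ℝ → ℝ} (hg : ∀ τ, 0 ≤ g τ) (B t : ℝ) (k : ℤ) :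
    0 ≤ dyadicTerm g B t k := by
  refine Real.sSup_nonneg ?_
  rintro _ ⟨τ, _, rfl⟩
  exact mul_nonneg (by positivity) (hg τ)

theorem dyadic_nonneg {g : ℝ → ℝ} (hg : ∀ τ, 0 ≤ g τ) (B t : ℝ) : 0 ≤ dyadic g B t :=
  tsum_nonneg fun k => dyadicTerm_nonneg hg B t k

theorem summable_dyadicTerm (g : ℝ → ℝ) {B t : ℝ} (hB : 0 < B) :
    Summable (dyadicTerm g B t) := by
  obtain ⟨p, hp, -⟩ := exists_mem_Ico_zpow (x := 2 * B) (y := (2:ℝ)) (by positivity) (by norm_num)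
  rcases le_or_gt t 0 with ht | ht
  · refine summable_of_ne_finset_zero (s := ∅) fun k _ => ?_
    have : Set.Icc ((2:ℝ)^(k-1)) ((2:ℝ)^(k+1)) ∩ Set.Icc (2*B) t = ∅ := by
      rw [Set.Icc_eq_empty (a := 2 * B) (by linarith), Set.inter_empty]
    rw [dyadicTerm, this, Set.image_empty, Real.sSup_empty]
  obtain ⟨q, -, hq⟩ := exists_mem_Ico_zpow (x := t) (y := (2:ℝ)) ht (by norm_num)
  refine summable_of_ne_finset_zero (s := Finset.Icc (p - 1) (q + 2)) fun k hk => ?_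
  have : Set.Icc ((2:ℝ)^(k-1)) ((2:ℝ)^(k+1)) ∩ Set.Icc (2*B) t = ∅ := by
    refine Set.eq_empty_of_forall_notMem fun τ hτ => hk ?_
    have h1 : p ≤ k + 1 :=
      (zpow_le_zpow_iff_right₀ (by norm_num : (1:ℝ) < 2)).1 (by linarith [hτ.1.2, hτ.2.1])
    have h2 : k - 1 < q + 1 :=
      (zpow_lt_zpow_iff_right₀ (by norm_num : (1:ℝ) < 2)).1 (by linarith [hτ.1.1, hτ.2.2])
    rw [Finset.mem_Icc]
    omega
  rw [dyadicTerm, this, Set.image_empty, Real.sSup_empty]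

theorem sum_dyadicTerm_le {g : ℝ → ℝ} (hg : ∀ τ, 0 ≤ g τ) {B t : ℝ} (hB : 0 < B)
    (s : Finset ℤ) : ∑ k ∈ s, dyadicTerm g B t k ≤ dyadic g B t :=
  (summable_dyadicTerm g hB).sum_le_tsum s fun k _ => dyadicTerm_nonneg hg B t k

theorem zpow_mul_le_dyadicTerm {g : ℝ → ℝ} {B t : ℝ}
    (hgc : ContinuousOn g (Set.Icc (2*B) t)) {τ : ℝ} (hτ : τ ∈ Set.Icc (2*B) t) {k : ℤ}
    (hk : τ ∈ Set.Ico ((2:ℝ)^k) ((2:ℝ)^(k+1))) : (2:ℝ)^k * g τ ≤ dyadicTerm g B t k := by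
  have hb : BddAbove ((fun τ => (2:ℝ)^k * g τ) '' Set.Icc (2*B) t) :=
    isCompact_Icc.bddAbove_image (hgc.const_mul _)
  refine le_csSup (hb.mono (Set.image_mono Set.inter_subset_right)) ⟨τ, ⟨⟨?_, hk.2.le⟩, hτ⟩, rfl⟩
  exact (zpow_le_zpow_right₀ (by norm_num) (by omega)).trans hk.1

theorem mul_le_dyadic {g : ℝ → ℝ} (hg : ∀ τ, 0 ≤ g τ) {B t : ℝ} (hB : 0 < B)
    (hgc : ContinuousOn g (Set.Icc (2*B) t)) {τ : ℝ} (hτ : τ ∈ Set.Icc (2*B) t)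
    (h : t / 2 ≤ τ) : t * g τ ≤ 4 * dyadic g B t := by
  obtain ⟨k, hk⟩ := exists_mem_Ico_zpow (x := τ) (y := (2:ℝ)) (by linarith [hτ.1]) (by norm_num)
  have h1 := zpow_mul_le_dyadicTerm hgc hτ hk
  have h2 : dyadicTerm g B t k ≤ dyadic g B t := by
    simpa using sum_dyadicTerm_le hg hB {k}
  have h3 : t ≤ 4 * (2:ℝ)^k := by
    have := hk.2
    rw [zpow_add_one₀ (by norm_num)] at this
    linarith
  calc t * g τ ≤ 4 * (2:ℝ)^k * g τ := mul_le_mul_of_nonneg_right h3 (hg τ)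
    _ = 4 * ((2:ℝ)^k * g τ) := by ring
    _ ≤ 4 * dyadic g B t := by linarith

theorem intervalIntegral_le_dyadic {g : ℝ → ℝ} (hg : ∀ τ, 0 ≤ g τ) {B t : ℝ} (hB : 0 < B)
    (ht : 2*B ≤ t) (hgc : ContinuousOn g (Set.Icc (2*B) t)) :
    ∫ τ in (2*B)..t, g τ ≤ dyadic g B t := by
  obtain ⟨p, hp, -⟩ := exists_mem_Ico_zpow (x := 2 * B) (y := (2:ℝ)) (by positivity) (by norm_num)
  obtain ⟨q, -, hq⟩ := exists_mem_Ico_zpow (x := t) (y := (2:ℝ)) (by linarith) (by norm_num)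
  set s := Finset.Icc p q with hs
  set I : ℤ → Set ℝ := fun k => Set.Ico ((2:ℝ)^k) ((2:ℝ)^(k+1)) with hI
  set F : ℤ → ℝ → ℝ := fun k =>
    (I k).indicator fun _ => ((2:ℝ)^k)⁻¹ * dyadicTerm g B t k with hF
  have hc0 : ∀ k : ℤ, 0 ≤ ((2:ℝ)^k)⁻¹ * dyadicTerm g B t k := fun k =>
    mul_nonneg (by positivity) (dyadicTerm_nonneg hg B t k)
  have hInt : ∀ k, Integrable (F k) := fun k =>
    (integrable_indicator_iff measurableSet_Ico).2 (integrableOn_const (by simp))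
  have hF0 : ∀ k τ, 0 ≤ F k τ := fun k => Set.indicator_nonneg fun _ _ => hc0 k
  have hle : ∀ τ ∈ Set.Ioc (2*B) t, g τ ≤ ∑ k ∈ s, F k τ := by
    intro τ hτ
    obtain ⟨k, hk⟩ := exists_mem_Ico_zpow (x := τ) (y := (2:ℝ)) (by linarith [hτ.1]) (by norm_num)
    have hks : k ∈ s := by
      have h1 : p < k + 1 :=
        (zpow_lt_zpow_iff_right₀ (by norm_num : (1:ℝ) < 2)).1 (by linarith [hτ.1, hk.2])
      have h2 : k < q + 1 :=
        (zpow_lt_zpow_iff_right₀ (by norm_num : (1:ℝ) < 2)).1 (by linarith [hτ.2, hk.1])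
      rw [hs, Finset.mem_Icc]
      omega
    refine le_trans ?_ (Finset.single_le_sum (f := fun k => F k τ) (fun k _ => hF0 k τ) hks)
    change g τ ≤ (I k).indicator _ τ
    rw [Set.indicator_of_mem hk, inv_mul_eq_div, le_div_iff₀ (by positivity), mul_comm]
    exact zpow_mul_le_dyadicTerm hgc (Set.Ioc_subset_Icc_self hτ) hk
  have hval : ∀ k, ∫ τ, F k τ = dyadicTerm g B t k := by
    intro k
    have hp2 : (0:ℝ) < (2:ℝ)^k := by positivity
    have hv : volume.real (I k) = (2:ℝ)^k := by
      rw [hI, Real.volume_real_Ico_of_le (zpow_le_zpow_right₀ (by norm_num) (by omega)),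
        zpow_add_one₀ (by norm_num)]
      ring
    rw [hF, integral_indicator_const _ measurableSet_Ico, hv, smul_eq_mul,
      mul_inv_cancel_left₀ hp2.ne']
  have hsum : Integrable fun τ => ∑ k ∈ s, F k τ := integrable_finsetSum s fun k _ => hInt k
  rw [intervalIntegral.integral_of_le ht]
  calc ∫ τ in Set.Ioc (2*B) t, g τ ≤ ∫ τ in Set.Ioc (2*B) t, ∑ k ∈ s, F k τ :=
        setIntegral_mono_on (hgc.integrableOn_Icc.mono_set Set.Ioc_subset_Icc_self)
          hsum.integrableOn measurableSet_Ioc hle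
    _ ≤ ∫ τ, ∑ k ∈ s, F k τ := setIntegral_le_integral hsum
        (Filter.Eventually.of_forall fun τ => Finset.sum_nonneg fun k _ => hF0 k τ)
    _ = ∑ k ∈ s, dyadicTerm g B t k := by
        rw [integral_finsetSum s fun k _ => hInt k]
        exact Finset.sum_congr rfl fun k _ => hval k
    _ ≤ dyadic g B t := sum_dyadicTerm_le hg hB s

theorem Vanish.continuousOn_L2ab {a b B : ℝ} (hB : 0 < B) {f : (Fin 5 → ℝ) → ℝ}
    (hf : Continuous f) (h : Vanish a b B f) (t : ℝ) :
    ContinuousOn (L2ab a b f) (Set.Icc (2*B) t) := by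
  have hgc : Continuous fun τ => Real.sqrt (boxInt t a b (fun z => f z ^ 2) τ) :=
    (continuous_boxInt t a b (hf.pow 2)).sqrt
  exact hgc.continuousOn.congr fun τ hτ => L2ab_eq_boxInt hB hf h (by linarith [hτ.1]) hτ.2

theorem le_sum_words {α : Type*} [Fintype α] {φ : List α → ℝ} (hφ : ∀ W, 0 ≤ φ W) {M : ℕ}
    {W : List α} (hW : W.length < M) :
    φ W ≤ ∑ n ∈ Finset.range M, ∑ σ : Fin n → α, φ (List.ofFn σ) := by
  have h1 : φ W ≤ ∑ σ : Fin W.length → α, φ (List.ofFn σ) := by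
    conv_lhs => rw [← List.ofFn_get W]
    exact Finset.single_le_sum (f := fun σ : Fin W.length → α => φ (List.ofFn σ))
      (fun σ _ => hφ _) (Finset.mem_univ W.get)
  exact h1.trans (Finset.single_le_sum
    (f := fun n => ∑ σ : Fin n → α, φ (List.ofFn σ))
    (fun n _ => Finset.sum_nonneg fun σ _ => hφ _) (Finset.mem_range.2 hW))

theorem NeumannSol.sourceCtl {a b B : ℝ} (hab : a < b) (hB : 0 < B) {u : (Fin 5 → ℝ) → ℝ}
    (hu : NeumannSol a b B u) {t : ℝ} (ht : 2*B ≤ t) (N : ℕ) :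
    SourceCtl a b B t N
      (4 * ∑ n ∈ Finset.range (N + 11), ∑ σ : Fin n → Fin 11,
        dyadic (L2ab a b (opIter G5 (List.ofFn σ) (Box5 u))) B t)
      (∑ n ∈ Finset.range (N + 7), ∑ σ : Fin n → Fin 11,
        L2ab a b (opIter G5 (List.ofFn σ) (Box5 u)) t) u := by
  have hcont : ∀ W, ContinuousOn (L2ab a b (opIter G5 W (Box5 u))) (Set.Icc (2*B) t) := fun W =>
    (((hu.vanish hab hB).Box5 hab hB hu.smooth).opIter hab hB hu.smooth.Box5 W).continuousOn_L2ab
      hB (hu.smooth.Box5.opIter W).continuous t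
  have hnn : ∀ W, 0 ≤ dyadic (L2ab a b (opIter G5 W (Box5 u))) B t := fun W =>
    dyadic_nonneg (L2ab_nonneg a b _) B t
  have hsum : ∀ W : List (Fin 11), W.length ≤ N + 10 →
      dyadic (L2ab a b (opIter G5 W (Box5 u))) B t ≤
        ∑ n ∈ Finset.range (N + 11), ∑ σ : Fin n → Fin 11,
          dyadic (L2ab a b (opIter G5 (List.ofFn σ) (Box5 u))) B t := fun W hW =>
    le_sum_words hnn (by omega)
  refine ⟨fun W hW => ?_, fun W hW τ hτ h => ?_, fun W hW => ?_⟩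
  · have h1 := intervalIntegral_le_dyadic (L2ab_nonneg a b (opIter G5 W (Box5 u))) hB ht (hcont W)
    linarith [hsum W hW, hnn W]
  · have h1 := mul_le_dyadic (L2ab_nonneg a b (opIter G5 W (Box5 u))) hB (hcont W) hτ h
    linarith [hsum W hW]
  · exact le_sum_words (φ := fun W => L2ab a b (opIter G5 W (Box5 u)) t)
      (fun W => L2ab_nonneg a b _ t) (by omega)

/-- decay of `∂_y u` for the Neumann waveguide `ℝ³×[a,b]`: let `a < b` and
fix `B > 0`.  For every multi-index length `m` there is a constant `C` such that: if
`u ∈ C^∞(ℝ₊×ℝ³×[a,b])` vanishes for `t ≤ 2B`, has `□u = 0` for `|x| > t-B` and satisfies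
`∂_y u(t,x,a) = ∂_y u(t,x,b) = 0`, then for every product `Γ̃^β` of `|β| ≤ m` admissible fields
and all `t ≥ 2B`, `x`, `y ∈ [a,b]`,
`(1+t)|Γ̃^β ∂_y u(t,x,y)| ≤ C Σ_{|α|≤|β|+10} Σ_k sup 2^k ‖Γ̃^α □u(τ,·)‖₂
  + C (1+t) Σ_{|α|≤|β|+6} ‖Γ̃^α □u(t,·)‖₂`. -/
theorem stmt19 (a b : ℝ) (hab : a < b) (B : ℝ) (hB : 0 < B) (m : ℕ) :
    ∃ C : ℝ, 0 < C ∧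
      ∀ u : (Fin 5 → ℝ) → ℝ, ContDiff ℝ (⊤ : ℕ∞) u →
        (∀ z : Fin 5 → ℝ, z 4 ∈ Set.Icc a b → 0 ≤ z 0 → z 0 ≤ 2*B → u z = 0) →
        (∀ z : Fin 5 → ℝ, z 4 ∈ Set.Icc a b → 0 ≤ z 0 → rad5 z > z 0 - B → Box5 u z = 0) →
        (∀ z : Fin 5 → ℝ, z 4 = a ∨ z 4 = b → pd 4 u z = 0) →
        ∀ L : List (Fin 11), L.length ≤ m →
          ∀ t : ℝ, 2*B ≤ t → ∀ x : Fin 3 → ℝ, ∀ y ∈ Set.Icc a b,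
            (1 + t) * |opIter G5 L (pd 4 u) (pt5 t x y)| ≤
              C * (∑ n ∈ Finset.range (L.length + 11), ∑ σ : Fin n → Fin 11,
                    dyadic (L2ab a b (opIter G5 (List.ofFn σ) (Box5 u))) B t) +
              C * (1 + t) * (∑ n ∈ Finset.range (L.length + 7), ∑ σ : Fin n → Fin 11,
                    L2ab a b (opIter G5 (List.ofFn σ) (Box5 u)) t) := by
  choose K hK hbound using fun j => exists_pointwise_bound hab hB j
  refine ⟨4 * ∑ j ∈ Finset.range (m + 1), K j,
    mul_pos (by norm_num) (Finset.sum_pos (fun j _ => hK j) (by simp)),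
    fun u hsm hearly hsrc hneu L hL t ht x y hy => ?_⟩
  have hu : NeumannSol a b B u := ⟨hsm, hearly, hsrc, hneu⟩
  obtain ⟨w, j, hwj, e⟩ := exists_opIter_eq_tang (hu.smooth.pd 4) L
  have hmain := hbound j u t _ _ _ ht hu (hu.sourceCtl hab hB ht L.length) w hwj.le x y hy
  have hKj : K j ≤ ∑ j ∈ Finset.range (m + 1), K j :=
    Finset.single_le_sum (f := K) (fun j _ => (hK j).le) (Finset.mem_range.2 (by omega))
  rw [e]
  refine hmain.trans ?_
  set D := ∑ n ∈ Finset.range (L.length + 11), ∑ σ : Fin n → Fin 11,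
    dyadic (L2ab a b (opIter G5 (List.ofFn σ) (Box5 u))) B t with hD
  set S := ∑ n ∈ Finset.range (L.length + 7), ∑ σ : Fin n → Fin 11,
    L2ab a b (opIter G5 (List.ofFn σ) (Box5 u)) t with hS
  have hD0 : 0 ≤ D := Finset.sum_nonneg fun n _ => Finset.sum_nonneg fun σ _ =>
    dyadic_nonneg (L2ab_nonneg a b _) B t
  have hS0 : 0 ≤ (1 + t) * S := mul_nonneg (by linarith)
    (Finset.sum_nonneg fun n _ => Finset.sum_nonneg fun σ _ => L2ab_nonneg a b _ t)
  calc K j * (4 * D + (1 + t) * S)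
      ≤ (∑ j ∈ Finset.range (m + 1), K j) * (4 * D + 4 * ((1 + t) * S)) := by
        refine mul_le_mul hKj ?_ (by linarith) ((hK j).le.trans hKj)
        linarith
    _ = _ := by ring
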